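/- Let SC(Q,w) be a nonempty subword complex. The greedy facet (the lexicographically first facet of SC(Q,w), facets being regarded as increasingly sorted sets of positions) is the unique facet I with R(I) ⊆ Φ⁺, and the antigreedy facet (the lexicographically last facet) is the unique facet I with R(I) ⊆ w(Φ⁺). -/

import Mathlib

open Pointwise RealInnerProductSpace

noncomputable section

/-- The cone (set of all nonnegative linear combinations) over a set `X`
in a real vector space. -/
def coneOf {V : Type} [AddCommGroup V] [Module ℝ V] (X : Set V) : Set V :=
  {v | ∃ (n : ℕ) (c : Fin n → ℝ) (x : Fin n → V),
    (∀ i, 0 ≤ c i) ∧ (∀ i, x i ∈ X) ∧ v = ∑ i, c i • x i}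

/-- `v` spans an extremal ray of the cone `C`. -/
def IsExtremeDir {V : Type} [AddCommGroup V] [Module ℝ V] (C : Set V) (v : V) : Prop :=
  v ∈ C ∧ v ≠ 0 ∧ ∀ a ∈ C, ∀ b ∈ C, a + b = v → ∃ c : ℝ, 0 ≤ c ∧ a = c • v

/-- The inner normal cone of the polyhedron `P` at a point `p` : the set of (inner products
with) linear functionals attaining their minimum over `P` exactly at `p`, together with `0`. -/
def normalConeVertex {V : Type} [NormedAddCommGroup V] [InnerProductSpace ℝ V]
    (P : Set V) (p : V) : Set V :=
  {u | ∀ q ∈ P, ⟪u, p⟫ ≤ ⟪u, q⟫ ∧ (⟪u, q⟫ = ⟪u, p⟫ → q = p)} ∪ {0}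

/-- A finite Coxeter system `(W, S)` together with its geometric action on a Euclidean
vector space `V`, a root system `Φ = Φ⁺ ⊔ (-Φ⁺)` with simple roots `α s` (`s ∈ S`),
reflections `sβ β` for positive roots `β`, fundamental weights `ω s` (`s ∈ S`),
and the length function `len`. -/
structure CoxeterRootSystem (V : Type) [NormedAddCommGroup V] [InnerProductSpace ℝ V] where
  W : Type
  [grp : Group W]
  [fin : Fintype W]
  [deceq : DecidableEq W]
  S : Set W
  ρ : W →* (V ≃ₗ[ℝ] V)
  Φpos : Set V
  α : W → V
  sβ : V → W
  ω : W → V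
  len : W → ℕ
  hS_inv : ∀ s ∈ S, s * s = 1
  hS_ne : ∀ s ∈ S, s ≠ 1
  hS_gen : Subgroup.closure S = ⊤
  hρ_inj : ∀ u v : W, ρ u = ρ v → u = v
  hΦfin : Φpos.Finite
  hΦdisj : ∀ β ∈ Φpos, -β ∉ Φpos
  hΦperm : ∀ u : W, ∀ β ∈ Φpos, ρ u β ∈ Φpos ∨ -(ρ u β) ∈ Φpos
  hα_mem : ∀ s ∈ S, α s ∈ Φpos
  hα_indep : LinearIndependent ℝ (fun s : S => α s.1)
  hα_span : Submodule.span ℝ (α '' S) = ⊤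
  horbit : ∀ β ∈ Φpos, ∃ u s : W, s ∈ S ∧ β = ρ u (α s)
  hsβ_simple : ∀ s ∈ S, sβ (α s) = s
  hsβ_conj : ∀ u s : W, s ∈ S → ρ u (α s) ∈ Φpos → sβ (ρ u (α s)) = u * s * u⁻¹
  hsβ_reflect : ∀ β ∈ Φpos, ρ (sβ β) β = -β
  hsβ_fix : ∀ β ∈ Φpos, ∀ v : V, ⟪β, v⟫ = 0 → ρ (sβ β) v = v
  hlen : ∀ u : W,
    len u = sInf {n | ∃ l : List W, (∀ x ∈ l, x ∈ S) ∧ l.length = n ∧ l.prod = u}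
  hlen_geom : ∀ u : W, ∀ s ∈ S, (len (u * s) = len u + 1 ↔ ρ u (α s) ∈ Φpos)
  hω_dual : ∀ s ∈ S, ∀ t ∈ S, ⟪ω s, α t⟫ = if s = t then ⟪α t, α t⟫ / 2 else 0

attribute [instance] CoxeterRootSystem.grp CoxeterRootSystem.fin CoxeterRootSystem.deceq

namespace CoxeterRootSystem

variable {V : Type} [NormedAddCommGroup V] [InnerProductSpace ℝ V] (D : CoxeterRootSystem V)

/-- The full root system `Φ = Φ⁺ ∪ (-Φ⁺)`. -/
def Φ : Set V := D.Φpos ∪ -D.Φpos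

/-- The reflections of `W` : the conjugates of the simple reflections. -/
def IsRefl (r : D.W) : Prop := ∃ u : D.W, ∃ s ∈ D.S, r = u * s * u⁻¹

/-- The Bruhat cover relation `x ≺ r x` with `ℓ(r x) = ℓ(x) + 1`, `r` a reflection. -/
def Cov (x y : D.W) : Prop :=
  (∃ r : D.W, D.IsRefl r ∧ y = r * x) ∧ D.len y = D.len x + 1

/-- Bruhat order: the partial order generated by the cover relations. -/
def BruhatLE : D.W → D.W → Prop := Relation.ReflTransGen D.Cov

/-- `E⁺(x,y)` : the labels of the atoms of the Bruhat interval `[x,y]`. -/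
def Eplus (x y : D.W) : Set V :=
  {β | β ∈ D.Φpos ∧ D.Cov x (D.sβ β * x) ∧ D.BruhatLE (D.sβ β * x) y}

/-- The upper Bruhat cone `C⁺(x,y)`. -/
def Cplus (x y : D.W) : Set V := coneOf (D.Eplus x y)

/-- `E⁻(x,y)` : the labels of the coatoms of the Bruhat interval `[x,y]`. -/
def Eminus (x y : D.W) : Set V :=
  {β | β ∈ D.Φpos ∧ D.Cov (D.sβ β * y) y ∧ D.BruhatLE x (D.sβ β * y)}

/-- The lower Bruhat cone `C⁻(x,y)`. -/
def Cminus (x y : D.W) : Set V := coneOf (D.Eminus x y)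

/-- The inversion set `Inv(u) = Φ⁺ ∩ u (Φ⁻)`. -/
def invSet (u : D.W) : Set V := {β | β ∈ D.Φpos ∧ -(D.ρ u⁻¹ β) ∈ D.Φpos}

/-- The Demazure product of a word. -/
def demazure (Q : List D.W) : D.W :=
  Q.foldl (fun v s => if D.len (v * s) = D.len v + 1 then v * s else v) 1

/-- The subword of `Q` on the positions in the complement of `P`. -/
def cword (Q : List D.W) (P : Finset (Fin Q.length)) : List D.W :=
  ((List.finRange Q.length).filter (fun k => decide (k ∉ P))).map Q.get

/-- `I` is a facet of the subword complex `SC(Q,w)` : the complement of `I` in `Q` is a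
reduced word for `w`. -/
def IsFacet (Q : List D.W) (w : D.W) (I : Finset (Fin Q.length)) : Prop :=
  (D.cword Q I).prod = w ∧ (D.cword Q I).length = D.len w

/-- The root function `r(I,k)`. -/
def rootf (Q : List D.W) (I : Finset (Fin Q.length)) (k : Fin Q.length) : V :=
  D.ρ (((List.finRange Q.length).filter (fun j => decide (j < k ∧ j ∉ I))).map Q.get).prod
    (D.α (Q.get k))

/-- The root configuration `R(I)` (as a set). -/
def rootConf (Q : List D.W) (I : Finset (Fin Q.length)) : Set V :=
  {v | ∃ i ∈ I, D.rootf Q I i = v}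

/-- The weight function `ω(I,k)`. -/
def weightf (Q : List D.W) (I : Finset (Fin Q.length)) (k : Fin Q.length) : V :=
  D.ρ (((List.finRange Q.length).filter (fun j => decide (j < k ∧ j ∉ I))).map Q.get).prod
    (D.ω (Q.get k))

/-- The brick vector `B(I) = -∑ₖ ω(I,k)`. -/
def brickVec (Q : List D.W) (I : Finset (Fin Q.length)) : V :=
  -∑ k : Fin Q.length, D.weightf Q I k

/-- The brick polyhedron : the Minkowski sum of the convex hull of the brick vectors of the
facets of `SC(Q,w)` and the Bruhat cone `C⁺(w, δ(Q))`. -/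
def brickPoly (Q : List D.W) (w : D.W) : Set V :=
  convexHull ℝ {v | ∃ I : Finset (Fin Q.length), D.IsFacet Q w I ∧ v = D.brickVec Q I} +
    D.Cplus w (D.demazure Q)

/-- The position `i` of the facet `I` is flippable. -/
def Flippable (Q : List D.W) (w : D.W) (I : Finset (Fin Q.length)) (i : Fin Q.length) : Prop :=
  ∃ J : Finset (Fin Q.length), D.IsFacet Q w J ∧ J ≠ I ∧ ∃ j ∈ J, I.erase i = J.erase j

/-- The facets `I` and `J` are related by an `f`-preserving flip. -/
def FPresFlip (f : V →ₗ[ℝ] ℝ) (Q : List D.W) (w : D.W) (I J : Finset (Fin Q.length)) : Prop :=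
  D.IsFacet Q w I ∧ D.IsFacet Q w J ∧ I ≠ J ∧
    ∃ i ∈ I, ∃ j ∈ J, I.erase i = J.erase j ∧ f (D.rootf Q I i) = 0

end CoxeterRootSystem

open Pointwise RealInnerProductSpace
noncomputable section
namespace CoxeterRootSystem
variable {V : Type} [NormedAddCommGroup V] [InnerProductSpace ℝ V] (D : CoxeterRootSystem V)

/-! ### Length function -/

theorem gen_mul_self {s : D.W} (hs : s ∈ D.S) : s * s = 1 := D.hS_inv s hs

theorem gen_inv {s : D.W} (hs : s ∈ D.S) : s⁻¹ = s :=
  inv_eq_of_mul_eq_one_left (D.hS_inv s hs)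

theorem exists_word (u : D.W) : ∃ l : List D.W, (∀ x ∈ l, x ∈ D.S) ∧ l.prod = u := by
  have hu : u ∈ Subgroup.closure D.S := by rw [D.hS_gen]; trivial
  induction hu using Subgroup.closure_induction'' with
  | one => exact ⟨[], by simp, by simp⟩
  | mem x hx => exact ⟨[x], by simpa using hx, by simp⟩
  | inv_mem x hx => exact ⟨[x], by simpa using hx, by rw [D.gen_inv hx]; simp⟩
  | mul x y _ _ h1 h2 =>
    obtain ⟨l1, h1, rfl⟩ := h1
    obtain ⟨l2, h2, rfl⟩ := h2
    refine ⟨l1 ++ l2, fun x hx => ?_, by simp⟩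
    rcases List.mem_append.1 hx with h | h
    · exact h1 x h
    · exact h2 x h

theorem len_le {u : D.W} {l : List D.W} (hl : ∀ x ∈ l, x ∈ D.S) (hp : l.prod = u) :
    D.len u ≤ l.length := by
  rw [D.hlen]
  exact Nat.sInf_le ⟨l, hl, rfl, hp⟩

theorem exists_reduced (u : D.W) :
    ∃ l : List D.W, (∀ x ∈ l, x ∈ D.S) ∧ l.length = D.len u ∧ l.prod = u := by
  have hne : {n | ∃ l : List D.W, (∀ x ∈ l, x ∈ D.S) ∧ l.length = n ∧ l.prod = u}.Nonempty := by
    obtain ⟨l, hl, hp⟩ := D.exists_word u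
    exact ⟨l.length, l, hl, rfl, hp⟩
  have := Nat.sInf_mem hne
  rw [← D.hlen] at this
  exact this

theorem len_one : D.len 1 = 0 := by
  have := D.len_le (u := 1) (l := []) (by simp) (by simp)
  simpa using this

theorem word_inv {l : List D.W} (hl : ∀ x ∈ l, x ∈ D.S) : l.reverse.prod = l.prod⁻¹ := by
  induction l with
  | nil => simp
  | cons a l ih =>
    have ha := hl a (by simp)
    rw [List.reverse_cons, List.prod_append, ih (fun x hx => hl x (by simp [hx])), List.prod_singleton,
      List.prod_cons, mul_inv_rev, D.gen_inv ha]

theorem len_inv_le (u : D.W) : D.len u⁻¹ ≤ D.len u := by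
  obtain ⟨l, hl, hn, hp⟩ := D.exists_reduced u
  rw [← hn, ← l.length_reverse]
  exact D.len_le (by simpa using hl) (by rw [D.word_inv hl, hp])

theorem len_inv (u : D.W) : D.len u⁻¹ = D.len u :=
  le_antisymm (D.len_inv_le u) (by simpa using D.len_inv_le u⁻¹)

theorem rho_gen_alpha {s : D.W} (hs : s ∈ D.S) : D.ρ s (D.α s) = -(D.α s) := by
  have := D.hsβ_reflect _ (D.hα_mem s hs)
  rwa [D.hsβ_simple s hs] at this

/-- Right multiplication by a generator changes the length by exactly one. -/
theorem len_mul_gen (u : D.W) {s : D.W} (hs : s ∈ D.S) :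
    D.len (u * s) = D.len u + 1 ∨ D.len u = D.len (u * s) + 1 := by
  by_cases h : D.len (u * s) = D.len u + 1
  · exact Or.inl h
  · right
    have h1 : ¬ D.ρ u (D.α s) ∈ D.Φpos := fun h' => h ((D.hlen_geom u s hs).2 h')
    have h2 : -(D.ρ u (D.α s)) ∈ D.Φpos := (D.hΦperm u _ (D.hα_mem s hs)).resolve_left h1
    have h4 : D.ρ (u * s) (D.α s) = -(D.ρ u (D.α s)) := by
      rw [map_mul, LinearEquiv.mul_apply, D.rho_gen_alpha hs, map_neg]
    have h5 := (D.hlen_geom (u * s) s hs).2 (by rw [h4]; exact h2)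
    rwa [mul_assoc, D.hS_inv s hs, mul_one] at h5

theorem len_gen_mul (u : D.W) {s : D.W} (hs : s ∈ D.S) :
    D.len (s * u) = D.len u + 1 ∨ D.len u = D.len (s * u) + 1 := by
  have h := D.len_mul_gen u⁻¹ hs
  have e : u⁻¹ * s = (s * u)⁻¹ := by rw [mul_inv_rev, D.gen_inv hs]
  rw [e, D.len_inv, D.len_inv] at h
  exact h

theorem len_parity {l : List D.W} (hl : ∀ x ∈ l, x ∈ D.S) :
    D.len l.prod % 2 = l.length % 2 := by
  induction l with
  | nil => simp [D.len_one]
  | cons a l ih =>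
    have ih := ih (fun x hx => hl x (by simp [hx]))
    have := D.len_gen_mul l.prod (hl a (by simp))
    rw [List.prod_cons, List.length_cons]
    omega

/-! ### Unit roots -/

theorem alpha_ne_zero {s : D.W} (hs : s ∈ D.S) : D.α s ≠ 0 := by
  intro h
  have h1 := D.hα_mem s hs
  exact D.hΦdisj _ h1 (by rw [h, neg_zero, ← h]; exact h1)

/-- normalized simple root -/
def e (s : D.W) : V := ‖D.α s‖⁻¹ • D.α s

theorem norm_alpha_pos {s : D.W} (hs : s ∈ D.S) : 0 < ‖D.α s‖ := norm_pos_iff.2 (D.alpha_ne_zero hs)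

theorem alpha_eq {s : D.W} (hs : s ∈ D.S) : D.α s = ‖D.α s‖ • D.e s := by
  rw [e, smul_smul, mul_inv_cancel₀ (D.norm_alpha_pos hs).ne', one_smul]

theorem e_self {s : D.W} (hs : s ∈ D.S) : ⟪D.e s, D.e s⟫ = 1 := by
  rw [e, real_inner_smul_left, real_inner_smul_right, real_inner_self_eq_norm_sq]
  have := (D.norm_alpha_pos hs).ne'
  field_simp

theorem e_ne_zero {s : D.W} (hs : s ∈ D.S) : D.e s ≠ 0 := by
  intro h
  have := D.e_self hs
  rw [h, inner_zero_left] at this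
  norm_num at this

theorem rho_gen_e {s : D.W} (hs : s ∈ D.S) : D.ρ s (D.e s) = -(D.e s) := by
  rw [e, map_smul, D.rho_gen_alpha hs, smul_neg]

theorem rho_gen {s : D.W} (hs : s ∈ D.S) (v : V) :
    D.ρ s v = v - (2 * ⟪D.e s, v⟫) • D.e s := by
  have h1 : D.ρ s (v - ⟪D.e s, v⟫ • D.e s) = v - ⟪D.e s, v⟫ • D.e s := by
    have := D.hsβ_fix _ (D.hα_mem s hs) (v - ⟪D.e s, v⟫ • D.e s) (by
      conv_lhs => rw [D.alpha_eq hs]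
      rw [real_inner_smul_left, inner_sub_right, real_inner_smul_right, D.e_self hs]
      ring)
    rwa [D.hsβ_simple s hs] at this
  have h2 : v = (v - ⟪D.e s, v⟫ • D.e s) + ⟪D.e s, v⟫ • D.e s := by abel
  conv_lhs => rw [h2]
  rw [map_add, h1, map_smul, D.rho_gen_e hs, two_mul, add_smul, smul_neg]
  abel

theorem rho_mul (u v : D.W) (x : V) : D.ρ (u * v) x = D.ρ u (D.ρ v x) := by
  rw [map_mul, LinearEquiv.mul_apply]

theorem rho_one (x : V) : D.ρ 1 x = x := by rw [map_one]; rfl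

theorem rho_inv_rho (u : D.W) (x : V) : D.ρ u⁻¹ (D.ρ u x) = x := by
  rw [← rho_mul, inv_mul_cancel, rho_one]

theorem rho_rho_inv (u : D.W) (x : V) : D.ρ u (D.ρ u⁻¹ x) = x := by
  rw [← rho_mul, mul_inv_cancel, rho_one]

theorem rho_gen_inner {s : D.W} (hs : s ∈ D.S) (x y : V) : ⟪D.ρ s x, D.ρ s y⟫ = ⟪x, y⟫ := by
  rw [D.rho_gen hs, D.rho_gen hs]
  simp only [inner_sub_left, inner_sub_right, real_inner_smul_left, real_inner_smul_right,
    D.e_self hs, real_inner_comm x (D.e s)]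
  ring

/-- induction on words -/
theorem W_induction {P : D.W → Prop} (h1 : P 1) (hm : ∀ s ∈ D.S, ∀ u, P u → P (s * u)) (u : D.W) :
    P u := by
  obtain ⟨l, hl, rfl⟩ := D.exists_word u
  induction l with
  | nil => simpa using h1
  | cons a l ih =>
    rw [List.prod_cons]
    exact hm a (hl a (by simp)) _ (ih (fun x hx => hl x (by simp [hx])))

theorem rho_inner (u : D.W) (x y : V) : ⟪D.ρ u x, D.ρ u y⟫ = ⟪x, y⟫ := by
  induction u using D.W_induction with
  | h1 => simp [rho_one]
  | hm s hs u ih => rw [rho_mul, rho_mul, D.rho_gen_inner hs, ih]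

theorem rho_inner_left (u : D.W) (x y : V) : ⟪D.ρ u x, y⟫ = ⟪x, D.ρ u⁻¹ y⟫ := by
  rw [← D.rho_inner u x, rho_rho_inv]

/-- unit roots -/
def Rt (γ : V) : Prop := ∃ u s : D.W, s ∈ D.S ∧ γ = D.ρ u (D.e s)

/-- unit roots of type `s` -/
def RtOf (s : D.W) (γ : V) : Prop := ∃ u : D.W, γ = D.ρ u (D.e s)

variable {D}

theorem RtOf.rt {s : D.W} (hs : s ∈ D.S) {γ : V} (h : D.RtOf s γ) : D.Rt γ := by
  obtain ⟨u, hu⟩ := h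
  exact ⟨u, s, hs, hu⟩

theorem rtOf_e (s : D.W) : D.RtOf s (D.e s) := ⟨1, by rw [rho_one]⟩

theorem RtOf.act {s : D.W} {γ : V} (h : D.RtOf s γ) (u : D.W) : D.RtOf s (D.ρ u γ) := by
  obtain ⟨v, rfl⟩ := h
  exact ⟨u * v, by rw [rho_mul]⟩

theorem RtOf.neg {s : D.W} (hs : s ∈ D.S) {γ : V} (h : D.RtOf s γ) : D.RtOf s (-γ) := by
  obtain ⟨v, rfl⟩ := h
  exact ⟨v * s, by rw [rho_mul, D.rho_gen_e hs, map_neg]⟩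

theorem rt_e {s : D.W} (hs : s ∈ D.S) : D.Rt (D.e s) := ⟨1, s, hs, by rw [rho_one]⟩

theorem Rt.act {γ : V} (h : D.Rt γ) (u : D.W) : D.Rt (D.ρ u γ) := by
  obtain ⟨v, s, hs, rfl⟩ := h
  exact ⟨u * v, s, hs, by rw [rho_mul]⟩

theorem Rt.neg {γ : V} (h : D.Rt γ) : D.Rt (-γ) := by
  obtain ⟨v, s, hs, rfl⟩ := h
  exact ⟨v * s, s, hs, by rw [rho_mul, D.rho_gen_e hs, map_neg]⟩

theorem Rt.self {γ : V} (h : D.Rt γ) : ⟪γ, γ⟫ = 1 := by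
  obtain ⟨v, s, hs, rfl⟩ := h
  rw [rho_inner, D.e_self hs]

theorem rho_conj_gen {s : D.W} (hs : s ∈ D.S) (u : D.W) (v : V) :
    D.ρ (u * s * u⁻¹) v = v - (2 * ⟪D.ρ u (D.e s), v⟫) • D.ρ u (D.e s) := by
  rw [rho_mul, rho_mul, D.rho_gen hs, map_sub, rho_rho_inv, map_smul, rho_inner_left]

/-- each unit root has a reflection in `W` -/
theorem Rt.refl {γ : V} (h : D.Rt γ) : ∃ r : D.W, ∀ v, D.ρ r v = v - (2 * ⟪γ, v⟫) • γ := by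
  obtain ⟨u, s, hs, rfl⟩ := h
  exact ⟨u * s * u⁻¹, fun v => rho_conj_gen hs u v⟩

theorem Rt.reflect {β γ : V} (hβ : D.Rt β) (hγ : D.Rt γ) : D.Rt (γ - (2 * ⟪β, γ⟫) • β) := by
  obtain ⟨r, hr⟩ := hβ.refl
  rw [← hr]
  exact hγ.act r

variable (D)

theorem rt_finite : {γ | D.Rt γ}.Finite := by
  have : {γ | D.Rt γ} ⊆ Set.range (fun p : D.W × D.W => D.ρ p.1 (D.e p.2)) := by
    rintro γ ⟨u, s, _, rfl⟩
    exact ⟨(u, s), rfl⟩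
  exact (Set.finite_range _).subset this

/-! ### Sign function -/

/-- `γ` is positive as a root of type `t` -/
def Pos (t : D.W) (γ : V) : Prop := ‖D.α t‖ • γ ∈ D.Φpos

theorem pos_iff {t : D.W} (ht : t ∈ D.S) (g : D.W) :
    D.Pos t (D.ρ g (D.e t)) ↔ D.len (g * t) = D.len g + 1 := by
  rw [D.hlen_geom g t ht, Pos, ← map_smul, ← D.alpha_eq ht]

theorem pos_neg_iff {t : D.W} (ht : t ∈ D.S) {γ : V} (h : D.RtOf t γ) :
    D.Pos t (-γ) ↔ ¬ D.Pos t γ := by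
  obtain ⟨g, rfl⟩ := h
  have : -(D.ρ g (D.e t)) = D.ρ (g * t) (D.e t) := by rw [rho_mul, D.rho_gen_e ht, map_neg]
  rw [this, pos_iff D ht, pos_iff D ht, mul_assoc, D.hS_inv t ht, mul_one]
  have := D.len_mul_gen g ht
  omega

theorem pos_e {t : D.W} (ht : t ∈ D.S) : D.Pos t (D.e t) := by
  rw [Pos, ← D.alpha_eq ht]
  exact D.hα_mem t ht

/-- The key property: `t` preserves the signs of roots of type `s` other than `± e t`. -/
def Star (s t : D.W) : Prop :=
  ∀ u : D.W, t * u ≠ u * s → D.len (u * s) = D.len u + 1 → D.len (t * u * s) = D.len (t * u) + 1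

/-- Exchange property from `Star`. -/
theorem exchange (hstar : ∀ s ∈ D.S, ∀ t ∈ D.S, D.Star s t) {s : D.W} (hs : s ∈ D.S)
    (l : List D.W) (hl : ∀ x ∈ l, x ∈ D.S) (hlt : D.len (l.prod * s) ≠ D.len l.prod + 1) :
    ∃ l₁ t l₂, l = l₁ ++ t :: l₂ ∧ t * l₂.prod = l₂.prod * s := by
  induction l with
  | nil =>
    exfalso
    apply hlt
    have := D.pos_iff hs 1
    rw [rho_one] at this
    simpa using this.1 (D.pos_e hs)
  | cons a l ih =>
    by_cases h : D.len (l.prod * s) = D.len l.prod + 1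
    · by_cases h2 : a * l.prod = l.prod * s
      · exact ⟨[], a, l, rfl, h2⟩
      · exact absurd (hstar s hs a (hl a (by simp)) _ h2 h) (by simpa using hlt)
    · obtain ⟨l₁, t, l₂, rfl, h2⟩ := ih (fun x hx => hl x (by simp [hx])) h
      exact ⟨a :: l₁, t, l₂, rfl, h2⟩

end CoxeterRootSystem
end

open Pointwise RealInnerProductSpace
noncomputable section

theorem sorted_split {α : Type*} [LinearOrder α] (k : α) (p : α → Prop) [DecidablePred p] (l : List α)
    (hl : l.Pairwise (· < ·)) :
    l.filter (fun j => decide (p j)) = l.filter (fun j => decide (j < k ∧ p j)) ++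
      l.filter (fun j => decide (j = k ∧ p j)) ++ l.filter (fun j => decide (k < j ∧ p j)) := by
  induction l with
  | nil => simp
  | cons a l ih =>
    rw [List.pairwise_cons] at hl
    have ih := ih hl.2
    by_cases hp : p a
    · rcases lt_trichotomy a k with h | h | h
      · simp [List.filter_cons, hp, h, h.ne, h.not_gt, ih]
      · subst h
        have h1 : l.filter (fun j => decide (j < a ∧ p j)) = [] := by
          rw [List.filter_eq_nil_iff]
          intro x hx
          have := hl.1 x hx
          simp [this.not_gt]
        rw [h1] at ih
        rw [List.filter_cons_of_pos (by simpa using hp), List.filter_cons_of_neg (by simp), List.filter_cons_of_pos (by simpa using hp), List.filter_cons_of_neg (by simp), ih, h1]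
        simp
      · have h1 : l.filter (fun j => decide (j < k ∧ p j)) = [] := by
          rw [List.filter_eq_nil_iff]
          intro x hx
          have := h.trans (hl.1 x hx)
          simp [this.not_gt]
        have h2 : l.filter (fun j => decide (j = k ∧ p j)) = [] := by
          rw [List.filter_eq_nil_iff]
          intro x hx
          have := h.trans (hl.1 x hx)
          simp [this.ne']
        rw [h1, h2] at ih
        rw [List.filter_cons_of_pos (by simpa using hp), List.filter_cons_of_neg (by simp [h.not_gt]), List.filter_cons_of_neg (by simp [h.ne']), List.filter_cons_of_pos (by simp [h, hp]), ih, h1, h2]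
        simp
    · simp [List.filter_cons, hp, ih]

theorem sorted_lex {α : Type*} [LinearOrder α] {i j : α} (hij : j < i) :
    ∀ (l₁ l₂ : List α), l₁.Pairwise (· < ·) → l₂.Pairwise (· < ·) → j ∈ l₂ → j ∉ l₁ → i ∈ l₁ →
      (∀ x < j, x ∈ l₁ ↔ x ∈ l₂) → List.Lex (· < ·) l₂ l₁ := by
  intro l₁
  induction l₁ with
  | nil => intro l₂ _ _ _ _ h; simp at h
  | cons a l₁ ih =>
    intro l₂ h1 h2 hj2 hj1 hi hx
    cases l₂ with
    | nil => simp at hj2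
    | cons b l₂ =>
      rw [List.pairwise_cons] at h1 h2
      have hbj : b ≤ j := by
        rcases List.mem_cons.1 hj2 with h | h
        · exact h.ge
        · exact (h2.1 _ h).le
      rcases hbj.lt_or_eq with hb | hb
      · have hbm : b ∈ a :: l₁ := (hx b hb).2 (by simp)
        have hab : a ≤ b := by
          rcases List.mem_cons.1 hbm with h | h
          · exact h.ge
          · exact (h1.1 _ h).le
        have ham : a ∈ b :: l₂ := (hx a (hab.trans_lt hb)).1 (by simp)
        have hba : b ≤ a := by
          rcases List.mem_cons.1 ham with h | h
          · exact h.ge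
          · exact (h2.1 _ h).le
        have hab := le_antisymm hab hba
        subst hab
        apply List.Lex.cons
        apply ih l₂ h1.2 h2.2
        · exact (List.mem_cons.1 hj2).resolve_left hb.ne'
        · exact fun h => hj1 (List.mem_cons_of_mem _ h)
        · exact (List.mem_cons.1 hi).resolve_left (hb.trans hij).ne'
        · intro x hxj
          have := hx x hxj
          constructor
          · intro hm
            exact (List.mem_cons.1 (this.1 (List.mem_cons_of_mem _ hm))).resolve_left (h1.1 x hm).ne'
          · intro hm
            exact (List.mem_cons.1 (this.2 (List.mem_cons_of_mem _ hm))).resolve_left (h2.1 x hm).ne'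
      · subst hb
        apply List.Lex.rel
        by_contra hcon
        rcases (not_lt.1 hcon).lt_or_eq with h | h
        · have := (hx a h).1 (by simp)
          rcases List.mem_cons.1 this with h' | h'
          · exact h.ne h'
          · exact lt_asymm h (h2.1 _ h')
        · exact hj1 (by simp [h])

theorem lex_asymm' {α : Type*} [LinearOrder α] : ∀ (l₁ l₂ : List α), List.Lex (· < ·) l₁ l₂ →
    List.Lex (· < ·) l₂ l₁ → False := by
  intro l₁ l₂ h
  induction h with
  | nil => intro h; cases h
  | cons _ ih =>
    intro h
    cases h with
    | cons h => exact ih h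
    | rel h => exact lt_irrefl _ h
  | rel h =>
    intro h'
    cases h' with
    | cons _ => exact lt_irrefl _ h
    | rel h' => exact lt_asymm h h'

namespace CoxeterRootSystem
variable {V : Type} [NormedAddCommGroup V] [InnerProductSpace ℝ V] (D : CoxeterRootSystem V)

/-- letters of `Q` before `k` outside `I` -/
def preW (Q : List D.W) (I : Finset (Fin Q.length)) (k : Fin Q.length) : List D.W :=
  ((List.finRange Q.length).filter (fun j => decide (j < k ∧ j ∉ I))).map Q.get

/-- letters of `Q` after `k` outside `I` -/
def postW (Q : List D.W) (I : Finset (Fin Q.length)) (k : Fin Q.length) : List D.W :=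
  ((List.finRange Q.length).filter (fun j => decide (k < j ∧ j ∉ I))).map Q.get

theorem filter_mid {n : ℕ} (I : Finset (Fin n)) (k : Fin n) :
    (List.finRange n).filter (fun j => decide (j = k ∧ j ∉ I)) = if k ∈ I then [] else [k] := by
  by_cases h : k ∈ I
  · rw [if_pos h, List.filter_eq_nil_iff]
    intro x _
    simp only [decide_eq_true_eq, not_and, not_not]
    rintro rfl
    exact h
  · rw [if_neg h]
    have : (fun j => decide (j = k ∧ j ∉ I)) = (fun j => decide (j = k)) := by
      funext j
      by_cases hj : j = k
      · subst hj; simp [h]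
      · simp [hj]
    rw [this]
    have h2 := List.filter_beq (l := List.finRange n) k
    rw [List.count_eq_one_of_mem (List.nodup_finRange n) (List.mem_finRange k)] at h2
    rw [← List.replicate_one, ← h2]
    congr 1

theorem cword_split (Q : List D.W) (I : Finset (Fin Q.length)) (k : Fin Q.length) :
    D.cword Q I = D.preW Q I k ++ (if k ∈ I then [] else [Q.get k]) ++ D.postW Q I k := by
  rw [cword, sorted_split k (fun j => j ∉ I) _ (List.pairwise_lt_finRange _), filter_mid,
    List.map_append, List.map_append]
  by_cases h : k ∈ I
  · simp [h, preW, postW]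
  · simp [h, preW, postW]

theorem preW_congr {Q : List D.W} {I J : Finset (Fin Q.length)} {k : Fin Q.length}
    (h : ∀ x < k, x ∈ I ↔ x ∈ J) : D.preW Q I k = D.preW Q J k := by
  rw [preW, preW]
  congr 2
  funext j
  by_cases hj : j < k
  · simp [hj, h j hj]
  · simp [hj]

theorem postW_congr {Q : List D.W} {I J : Finset (Fin Q.length)} {k : Fin Q.length}
    (h : ∀ x, k < x → (x ∈ I ↔ x ∈ J)) : D.postW Q I k = D.postW Q J k := by
  rw [postW, postW]
  congr 2
  funext j
  by_cases hj : k < j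
  · simp [hj, h j hj]
  · simp [hj]

theorem erase_mid {α : Type*} [DecidableEq α] {A B : List α} {j : α} (h : (A ++ j :: B).Nodup) :
    (A ++ j :: B).filter (fun x => decide (x ≠ j)) = A ++ B := by
  rw [List.nodup_append] at h
  obtain ⟨_, h2, h3⟩ := h
  rw [List.nodup_cons] at h2
  rw [List.filter_append, List.filter_cons]
  simp only [ne_eq, not_true_eq_false, decide_false, Bool.false_eq_true, if_false]
  congr 1
  · rw [List.filter_eq_self]
    intro a ha
    simpa using h3 a ha j (by simp)
  · rw [List.filter_eq_self]
    intro a ha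
    simp only [decide_eq_true_eq]
    rintro rfl
    exact h2.1 ha

/-- removing a letter before `i` -/
theorem preW_swap {Q : List D.W} {I : Finset (Fin Q.length)} {i : Fin Q.length} {l₁ l₂ : List D.W}
    {t : D.W} (h : D.preW Q I i = l₁ ++ t :: l₂) :
    ∃ j, j < i ∧ j ∉ I ∧ D.preW Q (insert j (I.erase i)) i = l₁ ++ l₂ := by
  rw [preW] at h
  obtain ⟨P1, P2, hP, h1, h2⟩ := List.map_eq_append_iff.1 h
  obtain ⟨j, P3, rfl, hj, h3⟩ := List.map_eq_cons_iff.1 h2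
  have hmem : j ∈ (List.finRange Q.length).filter (fun j => decide (j < i ∧ j ∉ I)) := by
    rw [hP]; simp
  simp only [List.mem_filter, List.mem_finRange, true_and, decide_eq_true_eq] at hmem
  refine ⟨j, hmem.1, hmem.2, ?_⟩
  have hnd : (P1 ++ j :: P3).Nodup := by
    rw [← hP]; exact (List.nodup_finRange _).filter _
  have := erase_mid hnd
  rw [← hP, List.filter_filter] at this
  rw [preW, ← h1, ← h3, ← List.map_append, ← this]
  congr 2
  funext x
  by_cases hx : x < i
  · simp [hx, hx.ne]
  · simp [hx]

theorem postW_swap {Q : List D.W} {I : Finset (Fin Q.length)} {i : Fin Q.length} {l₁ l₂ : List D.W}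
    {t : D.W} (h : D.postW Q I i = l₁ ++ t :: l₂) :
    ∃ j, i < j ∧ j ∉ I ∧ D.postW Q (insert j (I.erase i)) i = l₁ ++ l₂ := by
  rw [postW] at h
  obtain ⟨P1, P2, hP, h1, h2⟩ := List.map_eq_append_iff.1 h
  obtain ⟨j, P3, rfl, hj, h3⟩ := List.map_eq_cons_iff.1 h2
  have hmem : j ∈ (List.finRange Q.length).filter (fun j => decide (i < j ∧ j ∉ I)) := by
    rw [hP]; simp
  simp only [List.mem_filter, List.mem_finRange, true_and, decide_eq_true_eq] at hmem
  refine ⟨j, hmem.1, hmem.2, ?_⟩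
  have hnd : (P1 ++ j :: P3).Nodup := by
    rw [← hP]; exact (List.nodup_finRange _).filter _
  have := erase_mid hnd
  rw [← hP, List.filter_filter] at this
  rw [postW, ← h1, ← h3, ← List.map_append, ← this]
  congr 2
  funext x
  by_cases hx : i < x
  · simp [hx, hx.ne']
  · simp [hx]

theorem preW_mem {Q : List D.W} (hQ : ∀ x ∈ Q, x ∈ D.S) (I : Finset (Fin Q.length))
    (k : Fin Q.length) : ∀ x ∈ D.preW Q I k, x ∈ D.S := by
  intro x hx
  rw [preW, List.mem_map] at hx
  obtain ⟨j, _, rfl⟩ := hx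
  exact hQ _ (List.get_mem _ _)

theorem postW_mem {Q : List D.W} (hQ : ∀ x ∈ Q, x ∈ D.S) (I : Finset (Fin Q.length))
    (k : Fin Q.length) : ∀ x ∈ D.postW Q I k, x ∈ D.S := by
  intro x hx
  rw [postW, List.mem_map] at hx
  obtain ⟨j, _, rfl⟩ := hx
  exact hQ _ (List.get_mem _ _)

theorem len_mul_word_le (u : D.W) (l : List D.W) (hl : ∀ x ∈ l, x ∈ D.S) :
    D.len (u * l.prod) ≤ D.len u + l.length := by
  induction l generalizing u with
  | nil => simp
  | cons a l ih =>
    have h1 := ih (u * a) (fun x hx => hl x (by simp [hx]))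
    have h2 := D.len_mul_gen u (hl a (by simp))
    rw [List.prod_cons, ← mul_assoc, List.length_cons]
    omega

theorem len_word_mul_le (u : D.W) (l : List D.W) (hl : ∀ x ∈ l, x ∈ D.S) :
    D.len (l.prod * u) ≤ l.length + D.len u := by
  induction l with
  | nil => simp
  | cons a l ih =>
    have h1 := ih (fun x hx => hl x (by simp [hx]))
    have h2 := D.len_gen_mul (l.prod * u) (hl a (by simp))
    rw [List.prod_cons, mul_assoc, List.length_cons]
    omega

theorem sort_pw {n : ℕ} (I : Finset (Fin n)) : (I.sort (· ≤ ·)).Pairwise (· < ·) :=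
  I.sortedLT_sort.pairwise

/-- existence part, greedy -/
theorem greedy_pos (hstar : ∀ s ∈ D.S, ∀ t ∈ D.S, D.Star s t)
    {Q : List D.W} (hQ : ∀ x ∈ Q, x ∈ D.S) {w : D.W} {I : Finset (Fin Q.length)}
    (hI : D.IsFacet Q w I) (hg : ∀ J, D.IsFacet Q w J → J ≠ I →
      List.Lex (· < ·) (I.sort (· ≤ ·)) (J.sort (· ≤ ·))) :
    D.rootConf Q I ⊆ D.Φpos := by
  rintro _ ⟨i, hi, rfl⟩
  by_contra hneg
  have hs := hQ _ (List.get_mem Q i)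
  change D.ρ (D.preW Q I i).prod (D.α (Q.get i)) ∉ D.Φpos at hneg
  rw [← D.hlen_geom _ _ hs] at hneg
  obtain ⟨l₁, t, l₂, hl, ht⟩ := D.exchange hstar hs _ (D.preW_mem hQ I i) hneg
  obtain ⟨j, hji, hjI, hJ⟩ := D.preW_swap hl
  set J := insert j (I.erase i) with hJdef
  have hiJ : i ∉ J := by simp [hJdef, hji.ne']
  have hpost : D.postW Q J i = D.postW Q I i := by
    apply D.postW_congr
    intro x hx
    simp [hJdef, hx.ne', (hji.trans hx).ne']
  have hcI := D.cword_split Q I i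
  have hcJ := D.cword_split Q J i
  rw [if_pos hi, hl, List.append_nil] at hcI
  rw [if_neg hiJ, hJ, hpost] at hcJ
  have hf : D.IsFacet Q w J := by
    refine ⟨?_, ?_⟩
    · rw [← hI.1, hcJ, hcI]
      simp only [List.prod_append, List.prod_cons, List.prod_nil, mul_one, mul_assoc]
      rw [← mul_assoc t, ht]
      simp only [mul_assoc]
    · rw [← hI.2, hcJ, hcI]
      simp
      omega
  have hne : J ≠ I := fun h => hiJ (h ▸ hi)
  refine lex_asymm' _ _ (hg J hf hne) (sorted_lex hji _ _ (sort_pw _) (sort_pw _) ?_ ?_ ?_ ?_)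
  · simp [hJdef]
  · simpa using hjI
  · simpa using hi
  · intro x hx
    simp [hJdef, hx.ne, (hx.trans hji).ne]

/-- existence part, antigreedy -/
theorem antigreedy_pos (hstar : ∀ s ∈ D.S, ∀ t ∈ D.S, D.Star s t)
    {Q : List D.W} (hQ : ∀ x ∈ Q, x ∈ D.S) {w : D.W} {I : Finset (Fin Q.length)}
    (hI : D.IsFacet Q w I) (hg : ∀ J, D.IsFacet Q w J → J ≠ I →
      List.Lex (· < ·) (J.sort (· ≤ ·)) (I.sort (· ≤ ·))) :
    D.rootConf Q I ⊆ ⇑(D.ρ w) '' D.Φpos := by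
  rintro _ ⟨i, hi, rfl⟩
  by_contra hneg
  have hs := hQ _ (List.get_mem Q i)
  change D.ρ (D.preW Q I i).prod (D.α (Q.get i)) ∉ _ at hneg
  have hcI := D.cword_split Q I i
  rw [if_pos hi, List.append_nil] at hcI
  have hw : w = (D.preW Q I i).prod * (D.postW Q I i).prod := by
    rw [← hI.1, hcI, List.prod_append]
  have hneg2 : D.ρ (D.postW Q I i).reverse.prod (D.α (Q.get i)) ∉ D.Φpos := by
    intro h
    apply hneg
    refine ⟨_, h, ?_⟩
    rw [D.word_inv (D.postW_mem hQ I i), hw, D.rho_mul, D.rho_rho_inv]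
  rw [← D.hlen_geom _ _ hs] at hneg2
  obtain ⟨l₁, t, l₂, hl, ht⟩ := D.exchange hstar hs _
    (fun x hx => D.postW_mem hQ I i x (List.mem_reverse.1 hx)) hneg2
  have hl' : D.postW Q I i = l₂.reverse ++ t :: l₁.reverse := by
    have := congrArg List.reverse hl
    simpa using this
  have hl2S : ∀ x ∈ l₂, x ∈ D.S := by
    intro x hx
    apply D.postW_mem hQ I i
    rw [hl']; simp [hx]
  obtain ⟨j, hji, hjI, hJ⟩ := D.postW_swap hl'
  set J := insert j (I.erase i) with hJdef
  have hiJ : i ∉ J := by simp [hJdef, hji.ne]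
  have hpre : D.preW Q J i = D.preW Q I i := by
    apply D.preW_congr
    intro x hx
    simp [hJdef, hx.ne, (hx.trans hji).ne]
  have hcJ := D.cword_split Q J i
  rw [hl'] at hcI
  rw [if_neg hiJ, hJ, hpre] at hcJ
  have hf : D.IsFacet Q w J := by
    refine ⟨?_, ?_⟩
    · rw [← hI.1, hcJ, hcI]
      simp only [List.prod_append, List.prod_cons, List.prod_nil, mul_one, mul_assoc]
      have h3 : Q.get i * l₂.reverse.prod = l₂.reverse.prod * t := by
        rw [D.word_inv hl2S]
        rw [eq_inv_mul_iff_mul_eq, ← mul_assoc, ← ht, mul_assoc, mul_inv_cancel, mul_one]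
      rw [← mul_assoc (Q.get i), h3]
      simp only [mul_assoc]
    · rw [← hI.2, hcJ, hcI]
      simp
      omega
  have hne : J ≠ I := fun h => hiJ (h ▸ hi)
  refine lex_asymm' _ _ (hg J hf hne) (sorted_lex hji _ _ (sort_pw _) (sort_pw _) ?_ ?_ ?_ ?_)
  · simpa using hi
  · simpa using hiJ
  · simp [hJdef]
  · intro x hx
    simp [hJdef, hx.ne, (hx.trans hji).ne]

theorem greedy_uniq_aux {Q : List D.W} (hQ : ∀ x ∈ Q, x ∈ D.S) {w : D.W} {I J : Finset (Fin Q.length)}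
    (hI : D.IsFacet Q w I) (hJ : D.IsFacet Q w J) (hIp : D.rootConf Q I ⊆ D.Φpos) (k : Fin Q.length)
    (hkI : k ∈ I) (hkJ : k ∉ J) (hlt : ∀ x, k < x → (x ∈ I ↔ x ∈ J)) : False := by
  have hs := hQ _ (List.get_mem Q k)
  have hcI := D.cword_split Q I k
  have hcJ := D.cword_split Q J k
  rw [if_pos hkI, List.append_nil, D.postW_congr hlt] at hcI
  rw [if_neg hkJ] at hcJ
  have hr : D.ρ (D.preW Q I k).prod (D.α (Q.get k)) ∈ D.Φpos := hIp ⟨k, hkI, rfl⟩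
  rw [← D.hlen_geom _ _ hs] at hr
  have e1 := hI.1
  have e2 := hJ.1
  rw [hcI, List.prod_append] at e1
  rw [hcJ, List.prod_append, List.prod_append, List.prod_singleton] at e2
  rw [← e2, mul_left_inj] at e1
  rw [e1, mul_assoc, D.hS_inv _ hs, mul_one] at hr
  have h1 := D.len_mul_word_le ((D.preW Q J k).prod * Q.get k) _ (D.postW_mem hQ J k)
  rw [e2, ← hJ.2, hcJ] at h1
  simp only [List.length_append, List.length_singleton] at h1
  have h2 := D.len_le (D.preW_mem hQ J k) rfl
  omega

theorem antigreedy_uniq_aux {Q : List D.W} (hQ : ∀ x ∈ Q, x ∈ D.S) {w : D.W}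
    {I J : Finset (Fin Q.length)}
    (hI : D.IsFacet Q w I) (hJ : D.IsFacet Q w J) (hIp : D.rootConf Q I ⊆ ⇑(D.ρ w) '' D.Φpos)
    (k : Fin Q.length)
    (hkI : k ∈ I) (hkJ : k ∉ J) (hlt : ∀ x, x < k → (x ∈ I ↔ x ∈ J)) : False := by
  have hs := hQ _ (List.get_mem Q k)
  have hcI := D.cword_split Q I k
  have hcJ := D.cword_split Q J k
  rw [if_pos hkI, List.append_nil] at hcI
  rw [if_neg hkJ] at hcJ
  have hr : D.ρ (D.preW Q I k).prod (D.α (Q.get k)) ∈ ⇑(D.ρ w) '' D.Φpos := hIp ⟨k, hkI, rfl⟩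
  have e1 := hI.1
  have e2 := hJ.1
  rw [hcI, List.prod_append] at e1
  have hr2 : D.ρ (D.postW Q I k).prod⁻¹ (D.α (Q.get k)) ∈ D.Φpos := by
    obtain ⟨b, hb, hb2⟩ := hr
    rw [← e1, D.rho_mul] at hb2
    have hb3 := (D.ρ (D.preW Q I k).prod).injective hb2
    rw [← hb3, D.rho_inv_rho]
    exact hb
  rw [← D.hlen_geom _ _ hs] at hr2
  have e4 : (D.postW Q I k).prod⁻¹ * Q.get k = (Q.get k * (D.postW Q I k).prod)⁻¹ := by
    rw [mul_inv_rev, D.gen_inv hs]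
  rw [e4, D.len_inv, D.len_inv] at hr2
  rw [hcJ, List.prod_append, List.prod_append, List.prod_singleton] at e2
  rw [← e2, D.preW_congr hlt, mul_assoc, mul_right_inj] at e1
  rw [e1, ← mul_assoc, D.hS_inv _ hs, one_mul] at hr2
  have h1 := D.len_word_mul_le (Q.get k * (D.postW Q J k).prod) _ (D.preW_mem hQ J k)
  rw [← mul_assoc, e2, ← hJ.2, hcJ] at h1
  simp only [List.length_append, List.length_singleton] at h1
  have h2 := D.len_le (D.postW_mem hQ J k) rfl
  omega

theorem greedy_uniq {Q : List D.W} (hQ : ∀ x ∈ Q, x ∈ D.S) {w : D.W} {I J : Finset (Fin Q.length)}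
    (hI : D.IsFacet Q w I) (hJ : D.IsFacet Q w J) (hIp : D.rootConf Q I ⊆ D.Φpos)
    (hJp : D.rootConf Q J ⊆ D.Φpos) : J = I := by
  by_contra hne
  have hn : (symmDiff I J).Nonempty := by
    rw [Finset.nonempty_iff_ne_empty]
    intro h
    exact hne (symmDiff_eq_bot.1 h).symm
  set k := (symmDiff I J).max' hn with hk
  have hkm := (symmDiff I J).max'_mem hn
  rw [← hk] at hkm
  have hlt : ∀ x, k < x → (x ∈ I ↔ x ∈ J) := by
    intro x hx
    by_contra hcon
    have : x ∈ symmDiff I J := by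
      rw [Finset.mem_symmDiff]; tauto
    exact absurd ((symmDiff I J).le_max' x this) (not_le.2 hx)
  rw [Finset.mem_symmDiff] at hkm
  rcases hkm with ⟨h1, h2⟩ | ⟨h1, h2⟩
  · exact D.greedy_uniq_aux hQ hI hJ hIp k h1 h2 hlt
  · exact D.greedy_uniq_aux hQ hJ hI hJp k h1 h2 (fun x hx => (hlt x hx).symm)

theorem antigreedy_uniq {Q : List D.W} (hQ : ∀ x ∈ Q, x ∈ D.S) {w : D.W}
    {I J : Finset (Fin Q.length)}
    (hI : D.IsFacet Q w I) (hJ : D.IsFacet Q w J) (hIp : D.rootConf Q I ⊆ ⇑(D.ρ w) '' D.Φpos)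
    (hJp : D.rootConf Q J ⊆ ⇑(D.ρ w) '' D.Φpos) : J = I := by
  by_contra hne
  have hn : (symmDiff I J).Nonempty := by
    rw [Finset.nonempty_iff_ne_empty]
    intro h
    exact hne (symmDiff_eq_bot.1 h).symm
  set k := (symmDiff I J).min' hn with hk
  have hkm := (symmDiff I J).min'_mem hn
  rw [← hk] at hkm
  have hlt : ∀ x, x < k → (x ∈ I ↔ x ∈ J) := by
    intro x hx
    by_contra hcon
    have : x ∈ symmDiff I J := by
      rw [Finset.mem_symmDiff]; tauto
    exact absurd ((symmDiff I J).min'_le x this) (not_le.2 hx)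
  rw [Finset.mem_symmDiff] at hkm
  rcases hkm with ⟨h1, h2⟩ | ⟨h1, h2⟩
  · exact D.antigreedy_uniq_aux hQ hI hJ hIp k h1 h2 hlt
  · exact D.antigreedy_uniq_aux hQ hJ hI hJp k h1 h2 (fun x hx => (hlt x hx).symm)

theorem main_of_star (hstar : ∀ s ∈ D.S, ∀ t ∈ D.S, D.Star s t)
    (Q : List D.W) (hQ : ∀ x ∈ Q, x ∈ D.S) (w : D.W)
    (Ig Iag : Finset (Fin Q.length))
    (hg : D.IsFacet Q w Ig ∧ ∀ J, D.IsFacet Q w J → J ≠ Ig →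
      List.Lex (· < ·) (Ig.sort (· ≤ ·)) (J.sort (· ≤ ·)))
    (hag : D.IsFacet Q w Iag ∧ ∀ J, D.IsFacet Q w J → J ≠ Iag →
      List.Lex (· < ·) (J.sort (· ≤ ·)) (Iag.sort (· ≤ ·))) :
    (D.rootConf Q Ig ⊆ D.Φpos ∧
      ∀ J, D.IsFacet Q w J → D.rootConf Q J ⊆ D.Φpos → J = Ig) ∧
    (D.rootConf Q Iag ⊆ ⇑(D.ρ w) '' D.Φpos ∧
      ∀ J, D.IsFacet Q w J → D.rootConf Q J ⊆ ⇑(D.ρ w) '' D.Φpos → J = Iag) := by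
  have h1 := D.greedy_pos hstar hQ hg.1 hg.2
  have h2 := D.antigreedy_pos hstar hQ hag.1 hag.2
  exact ⟨⟨h1, fun J hJ hJp => D.greedy_uniq hQ hg.1 hJ h1 hJp⟩,
    ⟨h2, fun J hJ hJp => D.antigreedy_uniq hQ hag.1 hJ h2 hJp⟩⟩

end CoxeterRootSystem
end

open Pointwise RealInnerProductSpace
noncomputable section
namespace CoxeterRootSystem

/-- cosines of multiples of `π/3, π/4, π/5` -/
def Alw (c : ℝ) : Prop :=
  c = 0 ∨ c = 1 ∨ c = -1 ∨ 2 * c = 1 ∨ 2 * c = -1 ∨ 2 * c ^ 2 = 1 ∨ 4 * c ^ 2 = 2 * c + 1 ∨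
    4 * c ^ 2 = -2 * c + 1

theorem alw_of_cos {x : ℝ} {q : ℕ} (hq : 0 < q) (hq5 : q ≤ 5)
    (h : Real.cos (q * x) = 1 ∨ Real.cos (q * x) = -1) : Alw (Real.cos x) := by
  have h2 : Real.cos (2 * x) = 2 * Real.cos x ^ 2 - 1 := Real.cos_two_mul x
  have h3 : Real.cos (3 * x) = 4 * Real.cos x ^ 3 - 3 * Real.cos x := Real.cos_three_mul x
  have h4 : Real.cos (4 * x) = 2 * (2 * Real.cos x ^ 2 - 1) ^ 2 - 1 := by
    rw [← h2, ← Real.cos_two_mul]; ring_nf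
  have h5 : Real.cos (5 * x) = 16 * Real.cos x ^ 5 - 20 * Real.cos x ^ 3 + 5 * Real.cos x := by
    have e1 := Real.cos_add (3 * x) (2 * x)
    have e2 := Real.cos_sub (3 * x) (2 * x)
    have : 3 * x + 2 * x = 5 * x := by ring
    rw [this] at e1
    have : 3 * x - 2 * x = x := by ring
    rw [this] at e2
    have : Real.cos (5 * x) = 2 * (Real.cos (3 * x) * Real.cos (2 * x)) - Real.cos x := by linarith
    rw [this, h3, h2]; ring
  set c := Real.cos x
  unfold Alw
  interval_cases q
  · norm_num at h; rcases h with h | h <;> simp [c, h]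
  · norm_num at h
    rw [h2] at h
    rcases h with h | h
    · have : (c - 1) * (c + 1) = 0 := by linarith
      rcases mul_eq_zero.1 this with h | h
      · right; left; linarith
      · right; right; left; linarith
    · left; nlinarith
  · norm_num at h
    rw [h3] at h
    rcases h with h | h
    · have : (c - 1) * (2 * c + 1) ^ 2 = 0 := by linarith
      rcases mul_eq_zero.1 this with h | h
      · right; left; linarith
      · have := pow_eq_zero_iff (two_ne_zero) |>.1 h
        right; right; right; right; left; linarith
    · have : (c + 1) * (2 * c - 1) ^ 2 = 0 := by linarith
      rcases mul_eq_zero.1 this with h | h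
      · right; right; left; linarith
      · have := pow_eq_zero_iff (two_ne_zero) |>.1 h
        right; right; right; left; linarith
  · norm_num at h
    rw [h4] at h
    rcases h with h | h
    · have : c ^ 2 * ((c - 1) * (c + 1)) = 0 := by linarith
      rcases mul_eq_zero.1 this with h | h
      · left; exact pow_eq_zero_iff (two_ne_zero) |>.1 h
      · rcases mul_eq_zero.1 h with h | h
        · right; left; linarith
        · right; right; left; linarith
    · have : (2 * c ^ 2 - 1) ^ 2 = 0 := by linarith
      have := pow_eq_zero_iff (two_ne_zero) |>.1 this
      right; right; right; right; right; left; linarith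
  · norm_num at h
    rw [h5] at h
    rcases h with h | h
    · have : (c - 1) * (4 * c ^ 2 + 2 * c - 1) ^ 2 = 0 := by linarith
      rcases mul_eq_zero.1 this with h | h
      · right; left; linarith
      · have := pow_eq_zero_iff (two_ne_zero) |>.1 h
        right; right; right; right; right; right; right; linarith
    · have : (c + 1) * (4 * c ^ 2 - 2 * c - 1) ^ 2 = 0 := by linarith
      rcases mul_eq_zero.1 this with h | h
      · right; right; left; linarith
      · have := pow_eq_zero_iff (two_ne_zero) |>.1 h
        right; right; right; right; right; right; left; linarith

/-- arithmetic of rational angles -/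
theorem cos_dichotomy {x : ℝ} {m : ℕ} (hm : 0 < m) (n : ℤ) (h : (m : ℝ) * x = n * (2 * Real.pi)) :
    Alw (Real.cos x) ∨ ∃ k : ℕ, ∃ σ : ℝ, (σ = 1 ∨ σ = -1) ∧
      √3 / 2 ≤ σ * Real.cos (k * x) ∧ σ * Real.cos (k * x) < 1 := by
  have hm' : (m : ℝ) ≠ 0 := by positivity
  set r : ℚ := (2 * n : ℚ) / m with hr
  have hx : x = Real.pi * ((r : ℚ) : ℝ) := by
    rw [hr]; push_cast; field_simp; linarith
  have hq0 : (0 : ℝ) < r.den := by exact_mod_cast r.pos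
  have hrr : ((r : ℚ) : ℝ) = (r.num : ℝ) / r.den := by
    conv_lhs => rw [← Rat.num_div_den r]
    push_cast; rfl
  by_cases hq5 : r.den ≤ 5
  · left
    apply alw_of_cos r.pos hq5
    have : (r.den : ℝ) * x = r.num * Real.pi := by
      rw [hx, hrr]; field_simp
    rw [this]
    rcases Int.even_or_odd r.num with hp | hp
    · left; obtain ⟨j, hj⟩ := hp
      rw [hj]
      have : ((j + j : ℤ) : ℝ) * Real.pi = j * (2 * Real.pi) := by push_cast; ring
      rw [this]; exact Real.cos_int_mul_two_pi j
    · right; obtain ⟨j, hj⟩ := hp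
      rw [hj]
      have : ((2 * j + 1 : ℤ) : ℝ) * Real.pi = j * (2 * Real.pi) + Real.pi := by push_cast; ring
      rw [this]; exact Real.cos_int_mul_two_pi_add_pi j
  · right
    have hcop : IsCoprime (r.num) (r.den : ℤ) := by
      rw [Int.isCoprime_iff_gcd_eq_one]
      have := r.reduced
      simpa [Int.gcd, Nat.Coprime] using this
    obtain ⟨a, b, hab⟩ := hcop
    have hab' : (a : ℝ) * r.num + b * r.den = 1 := by exact_mod_cast hab
    refine ⟨a.natAbs, if Even b then 1 else -1, by split_ifs <;> simp, ?_⟩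
    have hc : Real.cos ((a.natAbs : ℝ) * x) = Real.cos ((a : ℝ) * x) := by
      have : (a.natAbs : ℝ) = |(a : ℝ)| := by
        rw [Nat.cast_natAbs, Int.cast_abs]
      rw [this]
      rcases abs_choice (a : ℝ) with h | h
      · rw [h]
      · rw [h, neg_mul, Real.cos_neg]
    have h1 : (a : ℝ) * x = Real.pi / r.den - b * Real.pi := by
      rw [hx, hrr]; field_simp; linear_combination hab'
    have h2 : (if Even b then (1:ℝ) else -1) * Real.cos ((a.natAbs : ℝ) * x) = Real.cos (Real.pi / r.den) := by
      rw [hc, h1]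
      split_ifs with hb
      · obtain ⟨j, rfl⟩ := hb
        have : Real.pi / r.den - ((j + j : ℤ) : ℝ) * Real.pi = Real.pi / r.den - j * (2 * Real.pi) := by
          push_cast; ring
        rw [this, Real.cos_sub_int_mul_two_pi, one_mul]
      · obtain ⟨j, rfl⟩ := Int.not_even_iff_odd.1 hb
        have : Real.pi / r.den - ((2 * j + 1 : ℤ) : ℝ) * Real.pi
            = (Real.pi / r.den - Real.pi) - j * (2 * Real.pi) := by
          push_cast; ring
        rw [this, Real.cos_sub_int_mul_two_pi, Real.cos_sub_pi]; ring
    rw [h2]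
    have h6 : (6 : ℝ) ≤ r.den := by exact_mod_cast (not_le.1 hq5)
    have hpos : 0 < Real.pi / r.den := div_pos Real.pi_pos hq0
    constructor
    · rw [← Real.cos_pi_div_six]
      apply Real.cos_le_cos_of_nonneg_of_le_pi hpos.le
      · linarith [Real.pi_pos]
      · apply div_le_div_of_nonneg_left Real.pi_pos.le (by norm_num) h6
    · rw [← Real.cos_zero]
      apply Real.cos_lt_cos_of_nonneg_of_le_pi le_rfl _ hpos
      rw [div_le_iff₀ hq0]
      nlinarith [Real.pi_pos]

variable {V : Type} [NormedAddCommGroup V] [InnerProductSpace ℝ V] {D : CoxeterRootSystem V}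

/-- dihedral sequence -/
def dseq (β γ : V) : ℕ → V
  | 0 => β
  | 1 => γ
  | (k + 2) => (2 * ⟪β, γ⟫) • dseq β γ (k + 1) - dseq β γ k

theorem dseq_rt {β γ : V} (hβ : D.Rt β) (hγ : D.Rt γ) (k : ℕ) :
    D.Rt (dseq β γ k) ∧ D.Rt (dseq β γ (k + 1)) ∧ ⟪dseq β γ (k + 1), dseq β γ k⟫ = ⟪β, γ⟫ := by
  induction k with
  | zero => exact ⟨hβ, hγ, real_inner_comm _ _⟩
  | succ k ih =>
    refine ⟨ih.2.1, ?_, ?_⟩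
    · have := (Rt.reflect ih.2.1 ih.1).neg
      rw [ih.2.2, neg_sub] at this
      exact this
    · rw [dseq, inner_sub_left, real_inner_smul_left, ih.2.1.self, real_inner_comm (dseq β γ (k + 1)) (dseq β γ k), ih.2.2]
      ring

theorem dseq_inner {β γ : V} (hβ : D.Rt β) (hγ : D.Rt γ) {x : ℝ} (hx : Real.cos x = ⟪β, γ⟫)
    (i k : ℕ) :
    ⟪dseq β γ i, dseq β γ (i + k)⟫ = Real.cos (k * x) ∧
    ⟪dseq β γ i, dseq β γ (i + k + 1)⟫ = Real.cos ((k + 1) * x) := by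
  induction k with
  | zero =>
    constructor
    · simpa using (dseq_rt hβ hγ i).1.self
    · have := (dseq_rt hβ hγ i).2.2
      rw [real_inner_comm] at this
      simpa [hx] using this
  | succ k ih =>
    refine ⟨by rw [← add_assoc, ih.2]; push_cast; rfl, ?_⟩
    have : i + (k + 1) + 1 = (i + k) + 2 := by ring
    rw [this, dseq, inner_sub_right, real_inner_smul_right, ih.1, ih.2, ← hx]
    have e1 := Real.cos_add ((k + 1) * x) x
    have e2 := Real.cos_sub ((k + 1) * x) x
    have : ((k:ℝ) + 1) * x - x = k * x := by ring
    rw [this] at e2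
    push_cast
    have : ((k:ℝ) + 1 + 1) * x = (k + 1) * x + x := by ring
    rw [this]
    linarith

theorem num_aux {x c : ℝ} (hx1 : |x| < 1) (hc34 : 3 / 4 ≤ c ^ 2) (hc1 : c ^ 2 < 1) :
    x ^ 2 + (1 - x ^ 2) * (2 * c ^ 2 - 1) < 1 ∧ |x| < x ^ 2 + (1 - x ^ 2) * (2 * c ^ 2 - 1) := by
  have h : x ^ 2 = |x| ^ 2 := (sq_abs x).symm
  have hx2 : x ^ 2 < 1 := by
    rw [h]; nlinarith [abs_nonneg x]
  have hy2 : (1 + x ^ 2) / 2 ≤ x ^ 2 + (1 - x ^ 2) * (2 * c ^ 2 - 1) := by nlinarith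
  constructor
  · nlinarith
  · refine lt_of_lt_of_le ?_ hy2
    nlinarith [pow_pos (sub_pos.2 hx1) 2]

set_option maxHeartbeats 1000000 in
/-- P2 -/
theorem plane_of_close {β γ : V} (hβ : D.Rt β) (hγ : D.Rt γ) (h1 : √3 / 2 ≤ ⟪β, γ⟫)
    (h2 : ⟪β, γ⟫ < 1) {δ : V} (hδ : D.Rt δ) :
    δ ∈ Submodule.span ℝ {β, γ} ∨ (⟪δ, β⟫ = 0 ∧ ⟪δ, γ⟫ = 0) := by
  set c := ⟪β, γ⟫ with hc
  have hc34 : 3 / 4 ≤ c ^ 2 := by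
    have : (√3 / 2) ^ 2 = 3 / 4 := by rw [div_pow, Real.sq_sqrt (by norm_num)]; norm_num
    rw [← this]
    exact pow_le_pow_left₀ (by positivity) h1 2
  have hcpos : 0 < c := lt_of_lt_of_le (by positivity) h1
  have hc1 : c ^ 2 < 1 := by nlinarith
  have hd : 1 - c ^ 2 ≠ 0 := by linarith
  set b1 := ⟪β, δ⟫ with hb1
  set g1 := ⟪γ, δ⟫ with hg1
  set a := (b1 - c * g1) / (1 - c ^ 2) with ha
  set b := (g1 - c * b1) / (1 - c ^ 2) with hb
  set p := a • β + b • γ with hp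
  set n := δ - p with hn
  have hββ := hβ.self
  have hγγ := hγ.self
  have hδδ := hδ.self
  have hγβ : ⟪γ, β⟫ = c := real_inner_comm _ _
  have hnβ : ⟪n, β⟫ = 0 := by
    rw [hn, hp, inner_sub_left, inner_add_left, real_inner_smul_left, real_inner_smul_left, hββ, hγβ,
      real_inner_comm, ← hb1, ha, hb]
    field_simp; ring
  have hnγ : ⟪n, γ⟫ = 0 := by
    rw [hn, hp, inner_sub_left, inner_add_left, real_inner_smul_left, real_inner_smul_left, hγγ, ← hc,
      real_inner_comm, ← hg1, ha, hb]
    field_simp; ring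
  have hnp : ⟪n, p⟫ = 0 := by
    rw [hp, inner_add_right, real_inner_smul_right, real_inner_smul_right, hnβ, hnγ]; ring
  have hδnp : δ = n + p := by rw [hn]; abel
  have hnδ : ⟪n, δ⟫ = ⟪n, n⟫ := by rw [hδnp, inner_add_right, hnp, add_zero]
  have hpn : ⟪p, n⟫ = 0 := by rw [real_inner_comm]; exact hnp
  have hN1 : ⟪n, n⟫ + ⟪p, p⟫ = 1 := by
    have h := inner_add_add_self (𝕜 := ℝ) n p
    rw [← hδnp, hδδ, hnp, hpn] at h
    linarith
  by_cases hn0 : n = 0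
  · left
    rw [hδnp, hn0, zero_add, hp]
    exact Submodule.add_mem _ (Submodule.smul_mem _ _ (Submodule.subset_span (by simp)))
      (Submodule.smul_mem _ _ (Submodule.subset_span (by simp)))
  by_cases hp0 : p = 0
  · right
    rw [hδnp, hp0, add_zero]; exact ⟨hnβ, hnγ⟩
  exfalso
  set N := ⟪n, n⟫ with hNdef
  have hN0 : 0 < N := real_inner_self_pos.2 hn0
  have hP0 : 0 < ⟪p, p⟫ := real_inner_self_pos.2 hp0
  obtain ⟨rβ, hrβ⟩ := hβ.refl
  obtain ⟨rγ, hrγ⟩ := hγ.refl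
  obtain ⟨rδ, hrδ⟩ := hδ.refl
  set E : Submodule ℝ V := Submodule.span ℝ {β, γ, n} with hE
  have hβE : β ∈ E := Submodule.subset_span (by simp)
  have hγE : γ ∈ E := Submodule.subset_span (by simp)
  have hnE : n ∈ E := Submodule.subset_span (by simp)
  have hδE : δ ∈ E := by
    rw [hδnp, hp]
    exact Submodule.add_mem _ hnE (Submodule.add_mem _ (Submodule.smul_mem _ _ hβE) (Submodule.smul_mem _ _ hγE))
  let H : D.W → Prop := fun g => ∀ v, D.ρ g v - v ∈ E
  have Hrefl : ∀ r : D.W, ∀ ε ∈ E, (∀ v, D.ρ r v = v - (2 * ⟪ε, v⟫) • ε) → H r := by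
    intro r ε hε hr v
    rw [hr]
    have : v - (2 * ⟪ε, v⟫) • ε - v = (-(2 * ⟪ε, v⟫)) • ε := by rw [neg_smul]; abel
    rw [this]
    exact Submodule.smul_mem _ _ hε
  have Hmul : ∀ g h, H g → H h → H (g * h) := by
    intro g h hg hh v
    have : D.ρ (g * h) v - v = (D.ρ g (D.ρ h v) - D.ρ h v) + (D.ρ h v - v) := by
      rw [rho_mul]; abel
    rw [this]
    exact Submodule.add_mem _ (hg _) (hh _)
  have Hinv : ∀ g, H g → H g⁻¹ := by
    intro g hg v
    have h := hg (D.ρ g⁻¹ v)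
    rw [rho_rho_inv] at h
    have := Submodule.neg_mem _ h
    rwa [neg_sub] at this
  let F : Finset D.W := by
    classical
    exact Finset.univ.filter (fun g => H g ∧ |⟪n, D.ρ g n⟫| < N)
  have hF : ∀ g, g ∈ F ↔ (H g ∧ |⟪n, D.ρ g n⟫| < N) := by intro g; simp [F]
  have hFne : F.Nonempty := by
    refine ⟨rδ, (hF _).2 ⟨Hrefl rδ δ hδE hrδ, ?_⟩⟩
    have hδn : ⟪δ, n⟫ = N := by rw [real_inner_comm]; exact hnδ
    rw [hrδ, inner_sub_right, real_inner_smul_right, hnδ, hδn, ← hNdef, abs_lt]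
    constructor <;> nlinarith
  obtain ⟨g, hgF, hmax⟩ := F.exists_max_image (fun g => |⟪n, D.ρ g n⟫|) hFne
  obtain ⟨hgH, hglt⟩ := (hF g).1 hgF
  set m := D.ρ g n with hm
  have hmE : m ∈ E := by
    have := Submodule.add_mem _ (hgH n) hnE
    rwa [sub_add_cancel] at this
  obtain ⟨a', b', x, hm'⟩ := Submodule.mem_span_triple.1 hmE
  have hβn : ⟪β, n⟫ = 0 := by rw [real_inner_comm]; exact hnβ
  have hγn : ⟪γ, n⟫ = 0 := by rw [real_inner_comm]; exact hnγ
  have hx : ⟪n, m⟫ = x * N := by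
    rw [← hm', inner_add_right, inner_add_right, real_inner_smul_right, real_inner_smul_right,
      real_inner_smul_right, hnβ, hnγ]; ring
  have hmm : ⟪m, m⟫ = N := by rw [hm, rho_inner]
  have hmm2 : ⟪m, m⟫ = a' ^ 2 + b' ^ 2 + 2 * a' * b' * c + x ^ 2 * N := by
    rw [← hm']
    simp only [inner_add_left, inner_add_right, real_inner_smul_left, real_inner_smul_right, hββ, hγγ,
      hγβ, ← hc, hnβ, hnγ, hβn, hγn, ← hNdef]
    ring
  have hβm : ⟪β, m⟫ = a' + b' * c := by
    rw [← hm']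
    simp only [inner_add_left, inner_add_right, real_inner_smul_left, real_inner_smul_right, hββ, hγγ,
      hγβ, ← hc, hnβ, hnγ, hβn, hγn, ← hNdef]
    ring
  have hγm : ⟪γ, m⟫ = a' * c + b' := by
    rw [← hm']
    simp only [inner_add_left, inner_add_right, real_inner_smul_left, real_inner_smul_right, hββ, hγγ,
      hγβ, ← hc, hnβ, hnγ, hβn, hγn, ← hNdef]
    ring
  have hmβ : ⟪m, β⟫ = a' + b' * c := by rw [real_inner_comm]; exact hβm
  have hmγ : ⟪m, γ⟫ = a' * c + b' := by rw [real_inner_comm]; exact hγm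
  set g' := g⁻¹ * (rβ * rγ) * g with hg'
  have hg'H : H g' := Hmul _ _ (Hmul _ _ (Hinv _ hgH) (Hmul _ _ (Hrefl rβ β hβE hrβ) (Hrefl rγ γ hγE hrγ))) hgH
  have hval : ⟪n, D.ρ g' n⟫ = (x ^ 2 + (1 - x ^ 2) * (2 * c ^ 2 - 1)) * N := by
    rw [hg', rho_mul, rho_mul, ← hm]
    have : ⟪n, D.ρ g⁻¹ (D.ρ (rβ * rγ) m)⟫ = ⟪m, D.ρ (rβ * rγ) m⟫ := by
      rw [← D.rho_inner g n, rho_rho_inv]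
    rw [this, rho_mul, hrγ, hrβ]
    simp only [inner_sub_left, inner_sub_right, real_inner_smul_left, real_inner_smul_right, hββ, hγγ,
      hγβ, ← hc, hmβ, hmγ, hβm, hγm, hmm]
    have : N = a' ^ 2 + b' ^ 2 + 2 * a' * b' * c + x ^ 2 * N := by rw [← hmm2, hmm]
    linear_combination (2 - 2 * c ^ 2) * this
  have hx1 : |x| < 1 := by
    rw [hx, abs_mul, abs_of_pos hN0] at hglt
    exact (mul_lt_iff_lt_one_left hN0).1 hglt
  obtain ⟨hy1, hy3⟩ := num_aux hx1 hc34 hc1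
  have hy0 := lt_of_le_of_lt (abs_nonneg x) hy3
  have hg'F : g' ∈ F := by
    rw [hF, hval, abs_mul, abs_of_pos hN0, abs_of_pos hy0]
    exact ⟨hg'H, (mul_lt_iff_lt_one_left hN0).2 hy1⟩
  have := hmax g' hg'F
  simp only [hval, hx, abs_mul, abs_of_pos hN0, abs_of_pos hy0] at this
  exact absurd (le_of_mul_le_mul_right this hN0) (not_le.2 hy3)

theorem rt_inner_abs_le {β γ : V} (hβ : D.Rt β) (hγ : D.Rt γ) : |⟪β, γ⟫| ≤ 1 := by
  have h1 : ‖β‖ = 1 := by rw [norm_eq_sqrt_real_inner, hβ.self, Real.sqrt_one]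
  have h2 : ‖γ‖ = 1 := by rw [norm_eq_sqrt_real_inner, hγ.self, Real.sqrt_one]
  have := abs_real_inner_le_norm β γ
  rwa [h1, h2, one_mul] at this

theorem alw_or_plane {β γ : V} (hβ : D.Rt β) (hγ : D.Rt γ) :
    Alw ⟪β, γ⟫ ∨ ∃ γ' : V, ∀ δ, D.Rt δ →
      δ ∈ Submodule.span ℝ {β, γ'} ∨ (⟪δ, β⟫ = 0 ∧ ⟪δ, γ'⟫ = 0) := by
  have hab := abs_le.1 (rt_inner_abs_le hβ hγ)
  set x := Real.arccos ⟪β, γ⟫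
  have hx : Real.cos x = ⟪β, γ⟫ := Real.cos_arccos hab.1 hab.2
  have hfin : Finite {γ | D.Rt γ} := D.rt_finite
  obtain ⟨i, j, hij, he⟩ := Finite.exists_ne_map_eq_of_infinite
    (fun k : ℕ => (⟨dseq β γ k, (dseq_rt hβ hγ k).1⟩ : {γ | D.Rt γ}))
  have he : dseq β γ i = dseq β γ j := congrArg Subtype.val he
  have key : ∃ m : ℕ, 0 < m ∧ Real.cos (m * x) = 1 := by
    rcases lt_or_gt_of_ne hij with h | h
    · refine ⟨j - i, by omega, ?_⟩
      have := (dseq_inner hβ hγ hx i (j - i)).1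
      rw [← this, Nat.add_sub_cancel' h.le, ← he, (dseq_rt hβ hγ i).1.self]
    · refine ⟨i - j, by omega, ?_⟩
      have := (dseq_inner hβ hγ hx j (i - j)).1
      rw [← this, Nat.add_sub_cancel' h.le, ← he, (dseq_rt hβ hγ i).1.self]
  obtain ⟨m, hm, hcos⟩ := key
  obtain ⟨n, hn⟩ := (Real.cos_eq_one_iff _).1 hcos
  rcases cos_dichotomy hm n hn.symm with h | ⟨k, σ, hσ, h1, h2⟩
  · left; rwa [hx] at h
  · right
    have hk := (dseq_inner hβ hγ hx 0 k).1
    rw [zero_add] at hk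
    have hr : D.Rt (σ • dseq β γ k) := by
      rcases hσ with rfl | rfl
      · rw [one_smul]; exact (dseq_rt hβ hγ k).1
      · rw [neg_one_smul]; exact (dseq_rt hβ hγ k).1.neg
    have hin : ⟪β, σ • dseq β γ k⟫ = σ * Real.cos (k * x) := by
      rw [real_inner_smul_right, ← hk]; rfl
    exact ⟨_, fun δ hδ => plane_of_close hβ hr (by rw [hin]; exact h1) (by rw [hin]; exact h2) hδ⟩

end CoxeterRootSystem
end

open Pointwise RealInnerProductSpace
noncomputable section
namespace CoxeterRootSystem
variable {V : Type} [NormedAddCommGroup V] [InnerProductSpace ℝ V] {D : CoxeterRootSystem V}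

/-! ### weights and support -/

theorem om_e_ne {s t : D.W} (hs : s ∈ D.S) (ht : t ∈ D.S) (h : s ≠ t) : ⟪D.ω s, D.e t⟫ = 0 := by
  rw [e, real_inner_smul_right, D.hω_dual s hs t ht, if_neg h, mul_zero]

theorem om_e_self {s : D.W} (hs : s ∈ D.S) : ⟪D.ω s, D.e s⟫ ≠ 0 := by
  rw [e, real_inner_smul_right, D.hω_dual s hs s hs, if_pos rfl, real_inner_self_eq_norm_sq]
  have := D.norm_alpha_pos hs
  positivity

theorem rho_om_ne {s t : D.W} (hs : s ∈ D.S) (ht : t ∈ D.S) (h : s ≠ t) :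
    D.ρ t (D.ω s) = D.ω s := by
  rw [D.rho_gen ht, real_inner_comm, om_e_ne hs ht h]; simp

theorem word_om {j : D.W} (hj : j ∈ D.S) {l : List D.W} (hl : ∀ x ∈ l, x ∈ D.S) (h : j ∉ l) :
    D.ρ l.prod (D.ω j) = D.ω j := by
  induction l with
  | nil => rw [List.prod_nil, rho_one]
  | cons a l ih =>
    rw [List.mem_cons, not_or] at h
    rw [List.prod_cons, rho_mul, ih (fun x hx => hl x (by simp [hx])) h.2,
      rho_om_ne hj (hl a (by simp)) h.1]

/-- if the coefficient of `e j` in `w v - v` is nonzero, every word of `w` uses `j` -/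
theorem mem_of_coeff {j : D.W} (hj : j ∈ D.S) {l : List D.W} (hl : ∀ x ∈ l, x ∈ D.S) (v : V)
    (h : ⟪D.ω j, D.ρ l.prod v⟫ ≠ ⟪D.ω j, v⟫) : j ∈ l := by
  by_contra hn
  apply h
  have := word_om hj hl hn
  conv_lhs => rw [← this]
  rw [rho_inner]

theorem e_span : Submodule.span ℝ (D.e '' D.S) = ⊤ := by
  rw [eq_top_iff, ← D.hα_span, Submodule.span_le]
  rintro _ ⟨s, hs, rfl⟩
  rw [D.alpha_eq hs]
  exact Submodule.smul_mem _ _ (Submodule.subset_span ⟨s, hs, rfl⟩)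

theorem W_ext {g h : D.W} (H : ∀ x ∈ D.S, D.ρ g (D.e x) = D.ρ h (D.e x)) : g = h := by
  apply D.hρ_inj
  have : (D.ρ g : V →ₗ[ℝ] V) = (D.ρ h : V →ₗ[ℝ] V) := by
    apply LinearMap.ext_on e_span
    rintro _ ⟨s, hs, rfl⟩
    exact H s hs
  ext v
  exact LinearMap.congr_fun this v

theorem star_of_pos {s t : D.W} (hs : s ∈ D.S) (ht : t ∈ D.S)
    (H : ∀ γ, D.RtOf s γ → γ ≠ D.e t → γ ≠ -D.e t → D.Pos s γ → D.Pos s (D.ρ t γ)) : D.Star s t := by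
  intro u hu hlen
  rw [← D.pos_iff hs, rho_mul]
  have key : ∀ σ : ℝ, σ ^ 2 = 1 → D.ρ u (D.e s) ≠ σ • D.e t := by
    intro σ hσ h
    apply hu
    have : t = u * s * u⁻¹ := by
      apply W_ext
      intro x _
      rw [rho_conj_gen hs, h, D.rho_gen ht, real_inner_smul_left, smul_smul]
      congr 2
      linear_combination (-2 * ⟪D.e t, D.e x⟫) * hσ
    rw [this]; group
  refine H _ ⟨u, rfl⟩ ?_ ?_ ((D.pos_iff hs u).2 hlen)
  · have := key 1 (by norm_num); rwa [one_smul] at this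
  · have := key (-1) (by norm_num); rwa [neg_one_smul] at this

/-! ### Components -/

/-- connectedness in the Coxeter graph -/
def Cmp (s t : D.W) : Prop :=
  Relation.ReflTransGen (fun x y => x ∈ D.S ∧ y ∈ D.S ∧ ⟪D.e x, D.e y⟫ ≠ 0) s t

theorem Cmp.step {s x y : D.W} (h : D.Cmp s x) (hx : x ∈ D.S) (hy : y ∈ D.S)
    (hxy : ⟪D.e x, D.e y⟫ ≠ 0) : D.Cmp s y :=
  Relation.ReflTransGen.tail h ⟨hx, hy, hxy⟩

theorem Cmp.symm {s x : D.W} (h : D.Cmp s x) : D.Cmp x s := by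
  induction h with
  | refl => exact Relation.ReflTransGen.refl
  | tail _ h ih => exact Relation.ReflTransGen.head ⟨h.2.1, h.1, by rw [real_inner_comm]; exact h.2.2⟩ ih

theorem orth_of_not_cmp {s x y : D.W} (h : D.Cmp s x) (hx : x ∈ D.S) (hy : y ∈ D.S)
    (hn : ¬ D.Cmp s y) : ⟪D.e x, D.e y⟫ = 0 := by
  by_contra h'
  exact hn (h.step hx hy h')

/-- vectors orthogonal to all simple roots outside the component -/
def InC (D : CoxeterRootSystem V) (s : D.W) (v : V) : Prop :=
  ∀ t ∈ D.S, ¬ D.Cmp s t → ⟪v, D.e t⟫ = 0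

theorem inC_e {s x : D.W} (hx : x ∈ D.S) (h : D.Cmp s x) : D.InC s (D.e x) :=
  fun _ ht hn => orth_of_not_cmp h hx ht hn

theorem InC.gen {s x : D.W} {v : V} (hv : D.InC s v) (hx : x ∈ D.S) : D.InC s (D.ρ x v) := by
  intro t ht hn
  rw [D.rho_gen hx, inner_sub_left, real_inner_smul_left, hv t ht hn]
  by_cases h : D.Cmp s x
  · rw [orth_of_not_cmp h hx ht hn]; ring
  · rw [real_inner_comm, hv x hx h]; ring

theorem InC.fix {s x : D.W} {v : V} (hv : D.InC s v) (hx : x ∈ D.S) (h : ¬ D.Cmp s x) :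
    D.ρ x v = v := by
  rw [D.rho_gen hx, real_inner_comm, hv x hx h]; simp

theorem InC.act {s : D.W} {v : V} (hv : D.InC s v) (u : D.W) : D.InC s (D.ρ u v) := by
  induction u using D.W_induction with
  | h1 => rwa [rho_one]
  | hm x hx u ih => rw [rho_mul]; exact ih.gen hx

theorem RtOf.inC {s x : D.W} {γ : V} (h : D.RtOf x γ) (hx : x ∈ D.S) (hc : D.Cmp s x) : D.InC s γ := by
  obtain ⟨u, rfl⟩ := h
  exact (inC_e hx hc).act u

open Classical in
theorem filter_act {s : D.W} {l : List D.W} (hl : ∀ x ∈ l, x ∈ D.S) {v : V} (hv : D.InC s v) :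
    D.ρ (l.filter (fun x => D.Cmp s x)).prod v = D.ρ l.prod v := by
  induction l with
  | nil => simp
  | cons a l ih =>
    have ha := hl a (by simp)
    have ih := ih (fun x hx => hl x (by simp [hx]))
    by_cases h : D.Cmp s a
    · rw [List.filter_cons_of_pos (by simpa using h), List.prod_cons, List.prod_cons, rho_mul, rho_mul, ih]
    · rw [List.filter_cons_of_neg (by simpa using h), List.prod_cons, rho_mul, ih, (hv.act _).fix ha h]

theorem jword_fix {s x : D.W} (hx : x ∈ D.S) (hn : ¬ D.Cmp s x) {l : List D.W}
    (hl : ∀ x ∈ l, x ∈ D.S ∧ D.Cmp s x) : D.ρ l.prod (D.e x) = D.e x := by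
  induction l with
  | nil => simp
  | cons a l ih =>
    have ha := hl a (by simp)
    rw [List.prod_cons, rho_mul, ih (fun x hx => hl x (by simp [hx])), D.rho_gen ha.1,
      orth_of_not_cmp ha.2 ha.1 hx hn]
    simp

theorem jword_reduced {s : D.W} {l : List D.W} (hl : ∀ x ∈ l, x ∈ D.S ∧ D.Cmp s x) :
    ∃ l' : List D.W, (∀ x ∈ l', x ∈ D.S ∧ D.Cmp s x) ∧ l'.prod = l.prod ∧ l'.length = D.len l.prod := by
  classical
  obtain ⟨m, hm, hn, hp⟩ := D.exists_reduced l.prod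
  have h1 : ∀ x ∈ m.filter (fun x => D.Cmp s x), x ∈ D.S ∧ D.Cmp s x := by
    intro x hx
    rw [List.mem_filter] at hx
    exact ⟨hm x hx.1, by simpa using hx.2⟩
  have h2 : (m.filter (fun x => D.Cmp s x)).prod = l.prod := by
    apply W_ext
    intro x hx
    by_cases h : D.Cmp s x
    · rw [filter_act hm (inC_e hx h), hp]
    · rw [jword_fix hx h h1, jword_fix hx h hl]
  refine ⟨_, h1, h2, le_antisymm ?_ ?_⟩
  · rw [← hn]; exact List.length_filter_le _ _
  · exact D.len_le (fun x hx => (h1 x hx).1) h2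

theorem rtOf_jword {s : D.W} (hs : s ∈ D.S) {γ : V} (h : D.RtOf s γ) :
    ∃ l : List D.W, (∀ x ∈ l, x ∈ D.S ∧ D.Cmp s x) ∧ γ = D.ρ l.prod (D.e s) := by
  classical
  obtain ⟨u, rfl⟩ := h
  obtain ⟨m, hm, rfl⟩ := D.exists_word u
  refine ⟨m.filter (fun x => D.Cmp s x), ?_, (filter_act hm (inC_e hs Relation.ReflTransGen.refl)).symm⟩
  intro x hx
  rw [List.mem_filter] at hx
  exact ⟨hm x hx.1, by simpa using hx.2⟩

theorem star_of_not_cmp {s t : D.W} (hs : s ∈ D.S) (ht : t ∈ D.S) (h : ¬ D.Cmp s t) : D.Star s t := by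
  apply star_of_pos hs ht
  intro γ hγ _ _ hp
  rwa [(hγ.inC hs Relation.ReflTransGen.refl).fix ht h]

/-! ### Dihedral components -/

theorem chain_of_reduced {l : List D.W} (hl : ∀ x ∈ l, x ∈ D.S) (h : l.length ≤ D.len l.prod) :
    l.IsChain (· ≠ ·) := by
  induction l with
  | nil => exact List.isChain_nil
  | cons a l ih =>
    have hl' : ∀ x ∈ l, x ∈ D.S := fun x hx => hl x (by simp [hx])
    have h1 := D.len_gen_mul l.prod (hl a (by simp))
    rw [List.prod_cons, List.length_cons] at h
    have h2 := D.len_le hl' rfl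
    have ih := ih hl' (by omega)
    cases l with
    | nil => exact List.isChain_singleton _
    | cons b l =>
      rw [List.isChain_cons_cons]
      refine ⟨?_, ih⟩
      rintro rfl
      rw [List.prod_cons, ← mul_assoc, D.hS_inv a (hl a (by simp)), one_mul] at h
      have := D.len_le (u := l.prod) (fun x hx => hl' x (by simp [hx])) rfl
      rw [List.length_cons] at h
      omega

theorem alt_unique {α : Type*} {a b : α} : ∀ (l l' : List α) (t : α), (t = a ∨ t = b) →
    (∀ x ∈ l, x = a ∨ x = b) → (∀ x ∈ l', x = a ∨ x = b) → l.length = l'.length →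
    (t :: l).IsChain (· ≠ ·) → (t :: l').IsChain (· ≠ ·) → l = l' := by
  intro l
  induction l with
  | nil => intro l' _ _ _ _ h; cases l' with
    | nil => simp
    | cons _ _ => simp at h
  | cons x l ih =>
    intro l' t ht h1 h2 hlen c1 c2
    cases l' with
    | nil => simp at hlen
    | cons y l' =>
      rw [List.isChain_cons_cons] at c1 c2
      have hx := h1 x (by simp)
      have hy := h2 y (by simp)
      have hxy : x = y := by
        have := c1.1
        have := c2.1
        rcases ht with rfl | rfl <;> rcases hx with rfl | rfl <;> rcases hy with rfl | rfl <;>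
          first | rfl | (exfalso; simp_all)
      subst hxy
      rw [ih l' x hx (fun z hz => h1 z (by simp [hz])) (fun z hz => h2 z (by simp [hz]))
        (by simpa using hlen) c1.2 c2.2]

theorem star_dih {s t a b : D.W} (hs : s ∈ D.S) (ht : t ∈ D.S)
    (hab : ∀ x ∈ D.S, D.Cmp s x → x = a ∨ x = b) : D.Star s t := by
  by_cases hst : D.Cmp s t
  swap
  · exact star_of_not_cmp hs ht hst
  apply star_of_pos hs ht
  intro γ hγ h1 h2 hp
  obtain ⟨l, hl, rfl⟩ := rtOf_jword hs hγ
  by_contra hn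
  obtain ⟨m, hm, hmp, hmn⟩ := jword_reduced hl
  rw [← hmp] at hp hn h1 h2 hγ hmn
  set g := m.prod with hg
  rw [D.pos_iff hs] at hp
  rw [← rho_mul, D.pos_iff hs] at hn
  have e1 := D.len_mul_gen (t * g) hs
  have e2 := D.len_gen_mul g ht
  have e3 := D.len_gen_mul (g * s) ht
  rw [← mul_assoc] at e3
  have f1 : D.len (t * g) = D.len g + 1 := by omega
  have f2 : D.len (t * g * s) = D.len g := by omega
  obtain ⟨m', hm', hmp', hmn'⟩ := jword_reduced (s := s) (l := t :: (m ++ [s])) (by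
    intro x hx
    simp only [List.mem_cons, List.mem_append, List.not_mem_nil, or_false] at hx
    rcases hx with rfl | hx | rfl
    · exact ⟨ht, hst⟩
    · exact hm x hx
    · exact ⟨hs, Relation.ReflTransGen.refl⟩)
  have hprod : (t :: (m ++ [s])).prod = t * g * s := by simp [hg, mul_assoc]
  rw [hprod] at hmp' hmn'
  have c1 : (t :: m).IsChain (· ≠ ·) := by
    apply chain_of_reduced (D := D)
    · intro x hx
      rcases List.mem_cons.1 hx with rfl | hx
      · exact ht
      · exact (hm x hx).1
    · rw [List.prod_cons, ← hg, f1, List.length_cons, hmn]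
  have c2 : (t :: m').IsChain (· ≠ ·) := by
    apply chain_of_reduced (D := D)
    · intro x hx
      rcases List.mem_cons.1 hx with rfl | hx
      · exact ht
      · exact (hm' x hx).1
    · rw [List.prod_cons, hmp', ← mul_assoc, ← mul_assoc, D.hS_inv t ht, one_mul, hp, List.length_cons,
        hmn', f2]
  have := alt_unique m m' t (hab t ht hst) (fun x hx => hab x (hm x hx).1 (hm x hx).2)
    (fun x hx => hab x (hm' x hx).1 (hm' x hx).2) (by omega) c1 c2
  have hgg : g = t * g * s := by rw [← hmp', ← this]
  have h3 : D.ρ g (D.e s) = -D.ρ t (D.ρ g (D.e s)) := by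
    conv_lhs => rw [hgg]
    rw [rho_mul, rho_mul, D.rho_gen_e hs, map_neg, map_neg]
  rw [D.rho_gen ht] at h3
  have hself : ⟪D.ρ g (D.e s), D.ρ g (D.e s)⟫ = 1 := by rw [rho_inner, D.e_self hs]
  generalize D.ρ g (D.e s) = γ at *
  have h4 : γ = ⟪D.e t, γ⟫ • D.e t := by
    have : (2:ℝ) • γ = (2:ℝ) • (⟪D.e t, γ⟫ • D.e t) := by
      rw [smul_smul, two_smul]
      nth_rw 1 [h3]
      abel
    exact smul_right_injective V (two_ne_zero' ℝ) this
  set c := ⟪D.e t, γ⟫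
  rw [h4, real_inner_smul_left, real_inner_smul_right, D.e_self ht] at hself
  have : (c - 1) * (c + 1) = 0 := by linarith
  rcases mul_eq_zero.1 this with h | h
  · apply h1; rw [h4, sub_eq_zero.1 h, one_smul]
  · apply h2; rw [h4, eq_neg_of_add_eq_zero_left h, neg_one_smul]

/-! ### Dichotomy for components -/

theorem small_or_alw {s : D.W} (hs : s ∈ D.S) :
    (∃ a b, ∀ x ∈ D.S, D.Cmp s x → x = a ∨ x = b) ∨
    (∀ x ∈ D.S, D.Cmp s x → ∀ β γ, D.RtOf x β → D.Rt γ → Alw ⟪β, γ⟫) := by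
  by_cases H : ∀ x ∈ D.S, D.Cmp s x → ∀ β γ, D.RtOf x β → D.Rt γ → Alw ⟪β, γ⟫
  · exact Or.inr H
  left
  classical
  push Not at H
  obtain ⟨x, hx, hsx, β, γ, ⟨u, rfl⟩, hγ, hn⟩ := H
  obtain ⟨γ', hγ'⟩ := (alw_or_plane (RtOf.rt hx ⟨u, rfl⟩) hγ).resolve_left hn
  have h1 : ∀ y ∈ D.S, D.Cmp x y → D.ρ u (D.e y) ∈ Submodule.span ℝ {D.ρ u (D.e x), γ'} := by
    intro y hy hxy
    induction hxy with
    | refl => exact Submodule.subset_span (by simp)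
    | tail _ hyz ih =>
      have ih := ih hyz.1
      rcases hγ' _ (Rt.act (rt_e hy) u) with h | h
      · exact h
      · exfalso
        apply hyz.2.2
        obtain ⟨p, q, hpq⟩ := Submodule.mem_span_pair.1 ih
        rw [← D.rho_inner u, ← hpq, inner_add_left, real_inner_smul_left, real_inner_smul_left,
          real_inner_comm, h.1, real_inner_comm, h.2]
        ring
  by_contra hcon
  push Not at hcon
  obtain ⟨y, hy, hsy, hyx, -⟩ := hcon x x
  obtain ⟨z, hz, hsz, hzx, hzy⟩ := hcon x y
  have hxy : D.Cmp x y := hsx.symm.trans hsy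
  have hxz : D.Cmp x z := hsx.symm.trans hsz
  let f : Fin 3 → D.S := ![⟨x, hx⟩, ⟨y, hy⟩, ⟨z, hz⟩]
  have hf : Function.Injective f := by
    intro i j hij
    fin_cases i <;> fin_cases j <;> simp_all [f]
  have hli := D.hα_indep.comp f hf
  have hli2 : LinearIndependent ℝ (fun i : Fin 3 => D.ρ u (D.α (f i).1)) :=
    hli.map' (D.ρ u : V →ₗ[ℝ] V) (D.ρ u).ker
  have hle := linearIndependent_le_span' _ hli2 ({D.ρ u (D.e x), γ'} : Set V) (by
    rintro _ ⟨i, rfl⟩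
    have : (f i).1 ∈ D.S ∧ D.Cmp x (f i).1 := by
      fin_cases i
      · exact ⟨hx, Relation.ReflTransGen.refl⟩
      · exact ⟨hy, hxy⟩
      · exact ⟨hz, hxz⟩
    simp only
    rw [D.alpha_eq this.1, map_smul]
    exact Submodule.smul_mem _ _ (h1 _ this.1 this.2))
  have hcard : Fintype.card ({D.ρ u (D.e x), γ'} : Set V) ≤ 2 := by
    rw [← Set.toFinset_card]
    have : ({D.ρ u (D.e x), γ'} : Set V).toFinset = {D.ρ u (D.e x), γ'} := by ext; simp
    rw [this]
    exact Finset.card_le_two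
  have hle2 := hle.trans (Nat.cast_le.2 hcard)
  rw [Cardinal.mk_fin] at hle2
  have := Nat.cast_le.1 hle2
  omega

end CoxeterRootSystem
end

open Pointwise RealInnerProductSpace
noncomputable section
namespace CoxeterRootSystem
variable {V : Type} [NormedAddCommGroup V] [InnerProductSpace ℝ V] {D : CoxeterRootSystem V}

/-- `t` preserves the sign of `γ` -/
def GoodAt (D : CoxeterRootSystem V) (s t : D.W) (γ : V) : Prop := D.Pos s γ ↔ D.Pos s (D.ρ t γ)

theorem GoodAt.neg {s t : D.W} (hs : s ∈ D.S) {γ : V} (hγ : D.RtOf s γ) (h : D.GoodAt s t γ) :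
    D.GoodAt s t (-γ) := by
  unfold GoodAt at *
  rw [map_neg, D.pos_neg_iff hs hγ, D.pos_neg_iff hs (hγ.act t), h]

theorem GoodAt.gen {s t : D.W} (ht : t ∈ D.S) {γ : V} (h : D.GoodAt s t γ) :
    D.GoodAt s t (D.ρ t γ) := by
  unfold GoodAt at *
  rw [← rho_mul, D.hS_inv t ht, rho_one, h]

theorem goodAt_iff {s t : D.W} (hs : s ∈ D.S) (u : D.W) :
    D.GoodAt s t (D.ρ u (D.e s)) ↔
      (D.len (u * s) = D.len u + 1 ↔ D.len (t * u * s) = D.len (t * u) + 1) := by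
  unfold GoodAt
  rw [← rho_mul, D.pos_iff hs, D.pos_iff hs]

theorem goodAt_symm {s t : D.W} (hs : s ∈ D.S) (ht : t ∈ D.S) (u : D.W) :
    D.GoodAt s t (D.ρ u (D.e s)) ↔ D.GoodAt t s (D.ρ u⁻¹ (D.e t)) := by
  rw [goodAt_iff hs, goodAt_iff ht]
  have e1 : u⁻¹ * t = (t * u)⁻¹ := by rw [mul_inv_rev, D.gen_inv ht]
  have e2 : s * u⁻¹ * t = (t * u * s)⁻¹ := by
    rw [mul_inv_rev, mul_inv_rev, D.gen_inv ht, D.gen_inv hs, mul_assoc]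
  have e3 : s * u⁻¹ = (u * s)⁻¹ := by rw [mul_inv_rev, D.gen_inv hs]
  rw [e2, e1, e3, D.len_inv, D.len_inv, D.len_inv, D.len_inv]
  have f1 := D.len_mul_gen u hs
  have f2 := D.len_gen_mul u ht
  have f3 := D.len_mul_gen (t * u) hs
  have f4 := D.len_gen_mul (u * s) ht
  rw [← mul_assoc] at f4
  omega

theorem GoodAt.fix {s t : D.W} (hs : s ∈ D.S) (ht : t ∈ D.S) {γ : V} (hγ : D.RtOf s γ)
    (h : D.GoodAt s t γ) {r : D.W} (hr : D.ρ r (D.e t) = D.e t) : D.GoodAt s t (D.ρ r γ) := by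
  obtain ⟨u, rfl⟩ := hγ
  rw [← rho_mul, goodAt_symm hs ht, mul_inv_rev, rho_mul]
  have : D.ρ r⁻¹ (D.e t) = D.e t := by
    conv_lhs => rw [← hr]
    rw [rho_inv_rho]
  rw [this, ← goodAt_symm hs ht]
  exact h

theorem goodAt_orth {s t : D.W} (ht : t ∈ D.S) {γ : V} (h : ⟪γ, D.e t⟫ = 0) : D.GoodAt s t γ := by
  unfold GoodAt
  rw [D.rho_gen ht, real_inner_comm, h]; simp

theorem star_of_good {s t : D.W} (hs : s ∈ D.S) (ht : t ∈ D.S)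
    (H : ∀ γ, D.RtOf s γ → γ ≠ D.e t → γ ≠ -D.e t → D.GoodAt s t γ) : D.Star s t :=
  star_of_pos hs ht (fun γ h1 h2 h3 h4 => (H γ h1 h2 h3).1 h4)

theorem rt_eq_of_inner {β γ : V} (hβ : D.Rt β) (hγ : D.Rt γ) (h : ⟪β, γ⟫ = 1) : β = γ := by
  have h1 : ‖β‖ = 1 := by rw [norm_eq_sqrt_real_inner, hβ.self, Real.sqrt_one]
  have h2 : ‖γ‖ = 1 := by rw [norm_eq_sqrt_real_inner, hγ.self, Real.sqrt_one]
  exact (inner_eq_one_iff_of_norm_eq_one h1 h2).1 h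

/-- swap lemma -/
theorem GoodAt.swap {s t : D.W} (hs : s ∈ D.S) (ht : t ∈ D.S) {γ γ' : V} (hγ : D.RtOf s γ)
    (hγ' : D.RtOf s γ') (heq : ⟪γ, D.e t⟫ = ⟪γ', D.e t⟫)
    (hK : ⟪γ, γ'⟫ = 1 ∨ 2 * ⟪γ, γ'⟫ = 1 ∨ 4 * ⟪γ, γ'⟫ ^ 2 = 2 * ⟪γ, γ'⟫ + 1)
    (h : D.GoodAt s t γ) : D.GoodAt s t γ' := by
  have r1 := hγ.rt hs
  have r2 := hγ'.rt hs
  rcases hK with hK | hK | hK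
  · rwa [← rt_eq_of_inner r1 r2 hK]
  · have hr := (dseq_rt r1 r2 1).2.1
    have he : dseq γ γ' 2 = γ' - γ := by simp [dseq, hK]
    rw [he] at hr
    obtain ⟨r, hr⟩ := hr.refl
    have h1 : D.ρ r (D.e t) = D.e t := by
      rw [hr, inner_sub_left, heq]; simp
    have h2 : D.ρ r γ = γ' := by
      rw [hr, inner_sub_left, r1.self, real_inner_comm]
      have : 2 * (⟪γ, γ'⟫ - 1) = -1 := by linarith
      rw [this]; simp
    rw [← h2]
    exact h.fix hs ht hγ h1
  · have hr := (dseq_rt r1 r2 2).2.1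
    set c := ⟪γ, γ'⟫ with hc
    have he : dseq γ γ' 3 = (2 * c) • (γ' - γ) := by
      simp only [dseq, ← hc]
      have : (2 * c) • ((2 * c) • γ' - γ) - γ' = (4 * c ^ 2 - 1) • γ' - (2 * c) • γ := by module
      rw [this, hK]
      module
    rw [he] at hr
    obtain ⟨r, hr⟩ := hr.refl
    have h1 : D.ρ r (D.e t) = D.e t := by
      rw [hr, real_inner_smul_left, inner_sub_left, heq]; simp
    have h2 : D.ρ r γ = γ' := by
      rw [hr, real_inner_smul_left, inner_sub_left, r1.self, real_inner_comm, ← hc, smul_smul]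
      have : 2 * (2 * c * (c - 1)) * (2 * c) = -1 := by linear_combination (2 * c - 1) * hK
      rw [this]; simp
    rw [← h2]
    exact h.fix hs ht hγ h1

/-! ### numeric facts -/

theorem gold_bounds : (1.618 : ℝ) < Real.goldenRatio ∧ Real.goldenRatio < 1.6181 := by
  have h0 := Real.goldenRatio_pos
  have h := Real.goldenRatio_sq
  constructor <;> nlinarith

theorem rhalf_bounds : (0.7071 : ℝ) < √(1/2) ∧ √(1/2) < 0.70711 := by
  have h0 : 0 ≤ √(1/2 : ℝ) := Real.sqrt_nonneg _
  have h : √(1/2 : ℝ) ^ 2 = 1/2 := Real.sq_sqrt (by norm_num)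
  constructor <;> nlinarith

/-- explicit list of values -/
def AlwE (φ r c : ℝ) : Prop :=
  c = 0 ∨ c = 1 ∨ c = -1 ∨ c = 1/2 ∨ c = -1/2 ∨ c = r ∨ c = -r ∨ c = φ / 2 ∨ c = -φ / 2 ∨
    c = (φ - 1) / 2 ∨ c = (1 - φ) / 2

theorem gold_root {c φ : ℝ} (hφ : φ ^ 2 = φ + 1) (h : 4 * c ^ 2 = 2 * c + 1) :
    c = φ / 2 ∨ c = (1 - φ) / 2 := by
  have : (2 * c - φ) * (2 * c - (1 - φ)) = 0 := by linear_combination h - hφ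
  rcases mul_eq_zero.1 this with h | h
  · left; linarith
  · right; linarith

theorem Alw.explicit {c φ r : ℝ} (hφ : φ ^ 2 = φ + 1) (hr : r ^ 2 = 1/2) (h : Alw c) : AlwE φ r c := by
  unfold AlwE
  rcases h with h | h | h | h | h | h | h | h
  · simp [h]
  · simp [h]
  · simp [h]
  · right; right; right; left; linarith
  · right; right; right; right; left; linarith
  · have : (c - r) * (c + r) = 0 := by linear_combination (h - 2 * hr) / 2
    rcases mul_eq_zero.1 this with h | h
    · have : c = r := by linarith
      simp [this]
    · have : c = -r := by linarith
      simp [this]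
  · rcases gold_root hφ h with h | h <;> simp [h]
  · rcases gold_root (c := -c) hφ (by linarith) with h | h
    · have : c = -φ/2 := by linarith
      simp [this]
    · have : c = (φ-1)/2 := by linarith
      simp [this]

set_option maxHeartbeats 4000000 in
theorem alw_pair {φ r l2 c c' : ℝ} (h1 : 1.618 < φ) (h2 : φ < 1.6181) (h3 : 0.7071 < r) (h4 : r < 0.70711)
    (hl : l2 = 1/2 ∨ l2 = 1 ∨ l2 = (φ + 1) / 2 ∨ l2 = (2 - φ) / 2)
    (hc : AlwE φ r c) (hc' : AlwE φ r c') (hsum : c + c' = l2) :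
    (c = 1 ∨ c = 1/2 ∨ c = φ / 2 ∨ c = (1 - φ) / 2) ∨
    (c' = 1 ∨ c' = 1/2 ∨ c' = φ / 2 ∨ c' = (1 - φ) / 2) := by
  have main : ∀ c, (c = 1 ∨ c = 1/2 ∨ c = φ / 2 ∨ c = (1 - φ) / 2) ∨
      (AlwE φ r c → (c = 0 ∨ c = -1 ∨ c = -1/2 ∨ c = r ∨ c = -r ∨ c = -φ / 2 ∨ c = (φ - 1) / 2)) := by
    intro c
    unfold AlwE
    tauto
  rcases main c with h | hc2
  · exact Or.inl h
  rcases main c' with h | hc2'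
  · exact Or.inr h
  exfalso
  have hc := hc2 hc
  have hc' := hc2' hc'
  clear hc2 hc2' main
  rcases hl with h | h | h | h <;> rcases hc with g | g | g | g | g | g | g <;>
    rcases hc' with k | k | k | k | k | k | k <;> linarith

theorem Alw.lam {l φ : ℝ} (hφ : φ ^ 2 = φ + 1) (h : Alw l) (h0 : l ≠ 0) (h1 : l ≠ 1) (hm1 : l ≠ -1) :
    2 * l ^ 2 = 1/2 ∨ 2 * l ^ 2 = 1 ∨ 2 * l ^ 2 = (φ + 1) / 2 ∨ 2 * l ^ 2 = (2 - φ) / 2 := by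
  rcases h with h | h | h | h | h | h | h | h
  · exact absurd h h0
  · exact absurd h h1
  · exact absurd h hm1
  · left; have : l = 1/2 := by linarith
    rw [this]; norm_num
  · left; have : l = -1/2 := by linarith
    rw [this]; norm_num
  · right; left; linarith
  · rcases gold_root hφ h with h' | h'
    · right; right; left; rw [h'] at *; linarith
    · right; right; right; rw [h'] at *; linarith
  · rcases gold_root (c := -l) hφ (by linarith) with h' | h'
    · right; right; left; have : l = -φ/2 := by linarith
      rw [this] at *; linarith
    · right; right; right; have : l = (φ-1)/2 := by linarith
      rw [this] at *; linarith

/-- Lemma O -/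
theorem GoodAt.transfer {s t : D.W} (hs : s ∈ D.S) (ht : t ∈ D.S)
    (HA : ∀ β γ, D.RtOf s β → D.Rt γ → Alw ⟪β, γ⟫) {γ γ' : V} (hγ : D.RtOf s γ)
    (hγ' : D.RtOf s γ') (heq : ⟪γ, D.e t⟫ = ⟪γ', D.e t⟫) (h : D.GoodAt s t γ) : D.GoodAt s t γ' := by
  have hl := HA γ _ hγ (rt_e ht)
  set l := ⟪γ, D.e t⟫ with hldef
  have tγ' : ⟪D.e t, γ'⟫ = l := by rw [real_inner_comm, heq]
  have tγ : ⟪D.e t, γ⟫ = l := by rw [real_inner_comm]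
  by_cases l0 : l = 0
  · exact goodAt_orth ht (by rw [← heq, l0])
  by_cases l1 : l = 1
  · have e1 := rt_eq_of_inner (hγ.rt hs) (rt_e ht) (by rw [← hldef, l1])
    have e2 := rt_eq_of_inner (hγ'.rt hs) (rt_e ht) (by rw [← heq, l1])
    rwa [e2, ← e1]
  by_cases lm1 : l = -1
  · have e1 := rt_eq_of_inner (hγ.rt hs).neg (rt_e ht) (by rw [inner_neg_left, ← hldef, lm1, neg_neg])
    have e2 := rt_eq_of_inner (hγ'.rt hs).neg (rt_e ht) (by rw [inner_neg_left, ← heq, lm1, neg_neg])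
    rw [← e2, neg_inj] at e1
    rwa [← e1]
  have hφ := Real.goldenRatio_sq
  have hr : √(1/2 : ℝ) ^ 2 = 1/2 := Real.sq_sqrt (by norm_num)
  have hl2 := hl.lam hφ l0 l1 lm1
  set δ := -(D.ρ t γ') with hδ
  have rδ : D.RtOf s δ := (hγ'.act t).neg hs
  have hsum : ⟪γ, γ'⟫ + ⟪γ, δ⟫ = 2 * l ^ 2 := by
    rw [hδ, inner_neg_right, D.rho_gen ht, inner_sub_right, real_inner_smul_right, ← hldef, tγ']
    ring
  have hδt : l = ⟪δ, D.e t⟫ := by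
    rw [hδ, inner_neg_left, D.rho_gen ht, inner_sub_left, real_inner_smul_left, ← heq, tγ', D.e_self ht]
    ring
  have hcases := alw_pair gold_bounds.1 gold_bounds.2 rhalf_bounds.1 rhalf_bounds.2 hl2
    ((HA γ γ' hγ (hγ'.rt hs)).explicit hφ hr) ((HA γ δ hγ (rδ.rt hs)).explicit hφ hr) hsum
  have conv : ∀ c : ℝ, (c = 1 ∨ c = 1/2 ∨ c = Real.goldenRatio / 2 ∨ c = (1 - Real.goldenRatio) / 2) →
      (c = 1 ∨ 2 * c = 1 ∨ 4 * c ^ 2 = 2 * c + 1) := by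
    intro c hc
    rcases hc with h | h | h | h
    · exact Or.inl h
    · right; left; linarith
    · right; right; rw [h]; linear_combination hφ
    · right; right; rw [h]; linear_combination hφ
  rcases hcases with hc | hc
  · exact h.swap hs ht hγ hγ' heq (conv _ hc)
  · have h2 := (h.swap hs ht hγ rδ hδt (conv _ hc)).neg hs rδ
    rw [hδ, neg_neg] at h2
    have h3 := h2.gen ht
    rwa [← rho_mul, D.hS_inv t ht, rho_one] at h3

theorem GoodAt.transfer_abs {s t : D.W} (hs : s ∈ D.S) (ht : t ∈ D.S)
    (HA : ∀ β γ, D.RtOf s β → D.Rt γ → Alw ⟪β, γ⟫) {γ γ' : V} (hγ : D.RtOf s γ)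
    (hγ' : D.RtOf s γ') (heq : ⟪γ, D.e t⟫ ^ 2 = ⟪γ', D.e t⟫ ^ 2) (h : D.GoodAt s t γ) :
    D.GoodAt s t γ' := by
  rcases sq_eq_sq_iff_eq_or_eq_neg.1 heq with h1 | h1
  · exact h.transfer hs ht HA hγ hγ' h1
  · exact (h.neg hs hγ).transfer hs ht HA (hγ.neg hs) hγ' (by rw [inner_neg_left, h1, neg_neg])

/-! ### reduced words with distinct letters -/

theorem mem_of_count_one {j : D.W} {l₁ l₂ l : List D.W} (h1 : ∀ x ∈ l₁ ++ j :: l₂, x ∈ D.S)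
    (n1 : j ∉ l₁) (n2 : j ∉ l₂) (hl : ∀ x ∈ l, x ∈ D.S) (hp : l.prod = (l₁ ++ j :: l₂).prod) : j ∈ l := by
  have hj : j ∈ D.S := h1 j (by simp)
  have h1' : ∀ x ∈ l₁, x ∈ D.S := fun x hx => h1 x (by simp [hx])
  have h2' : ∀ x ∈ l₂, x ∈ D.S := fun x hx => h1 x (by simp [hx])
  by_contra hn
  have e1 := word_om hj hl hn
  rw [hp, List.prod_append, List.prod_cons, rho_mul, rho_mul, word_om hj h2' n2, D.rho_gen hj, map_sub,
    word_om hj h1' n1, map_smul] at e1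
  have e2 : (2 * ⟪D.e j, D.ω j⟫) • D.ρ l₁.prod (D.e j) = 0 := by simpa using e1
  rcases smul_eq_zero.1 e2 with h | h
  · apply om_e_self hj
    rw [real_inner_comm]; linarith
  · exact D.e_ne_zero hj ((LinearEquiv.map_eq_zero_iff _).1 h)

theorem nodup_reduced {l : List D.W} (hl : ∀ x ∈ l, x ∈ D.S) (hn : l.Nodup) : D.len l.prod = l.length := by
  apply le_antisymm (D.len_le hl rfl)
  obtain ⟨m, hm, hmn, hmp⟩ := D.exists_reduced l.prod
  rw [← hmn]
  apply List.Subperm.length_le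
  apply List.Nodup.subperm hn
  intro j hj
  obtain ⟨l₁, l₂, rfl⟩ := List.append_of_mem hj
  have hn' := hn
  rw [List.nodup_append] at hn
  apply mem_of_count_one hl _ _ hm hmp
  · intro h
    exact hn.2.2 j h j (by simp) rfl
  · exact (List.nodup_cons.1 hn.2.1).1

/-! ### good pair along a shortest path -/

theorem path_exists {s t : D.W} (hs : s ∈ D.S) (h : D.Cmp s t) :
    ∃ p : List D.W, (∀ x ∈ p, x ∈ D.S) ∧ ⟪D.ρ p.prod (D.e s), D.e t⟫ ≠ 0 := by
  induction h with
  | refl => exact ⟨[], by simp, by rw [List.prod_nil, rho_one, D.e_self hs]; norm_num⟩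
  | @tail x y _ hxy ih =>
    obtain ⟨p, hp, hne⟩ := ih
    by_cases h : ⟪D.ρ p.prod (D.e s), D.e y⟫ = 0
    · refine ⟨x :: p, ?_, ?_⟩
      · intro z hz
        rcases List.mem_cons.1 hz with rfl | hz
        · exact hxy.1
        · exact hp z hz
      · rw [List.prod_cons, rho_mul, D.rho_gen hxy.1, inner_sub_left, real_inner_smul_left, h, real_inner_comm]
        have := hxy.2.2
        simp [hne, this]
    · exact ⟨p, hp, h⟩

theorem path_minimal {s : D.W} (hs : s ∈ D.S) : ∀ (p : List D.W) (t : D.W), t ∈ D.S →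
    (∀ x ∈ p, x ∈ D.S) → ⟪D.ρ p.prod (D.e s), D.e t⟫ ≠ 0 →
    (∀ q : List D.W, (∀ x ∈ q, x ∈ D.S) → q.length < p.length → ⟪D.ρ q.prod (D.e s), D.e t⟫ = 0) →
    p.Nodup ∧ s ∉ p ∧ ∀ y ∈ p, ∃ q : List D.W, (∀ x ∈ q, x ∈ D.S) ∧ q.length < p.length ∧
      ⟪D.ρ q.prod (D.e s), D.e y⟫ ≠ 0 := by
  intro p
  induction p with
  | nil => intro t _ _ _ _; simp
  | cons y p ih =>
    intro t ht hp hne hmin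
    have hy := hp y (by simp)
    have hp' : ∀ x ∈ p, x ∈ D.S := fun x hx => hp x (by simp [hx])
    have h0 := hmin p hp' (by simp)
    have hstep : ∀ q : List D.W, ⟪D.ρ (y :: q).prod (D.e s), D.e t⟫ = ⟪D.ρ q.prod (D.e s), D.e t⟫ -
        2 * ⟪D.ρ q.prod (D.e s), D.e y⟫ * ⟪D.e y, D.e t⟫ := by
      intro q
      rw [List.prod_cons, rho_mul, D.rho_gen hy, inner_sub_left, real_inner_smul_left, real_inner_comm (D.e y)]
    rw [hstep, h0] at hne
    have hyp : ⟪D.ρ p.prod (D.e s), D.e y⟫ ≠ 0 := by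
      intro h; rw [h] at hne; simp at hne
    have hyt : ⟪D.e y, D.e t⟫ ≠ 0 := by
      intro h; rw [h] at hne; simp at hne
    have hminy : ∀ q : List D.W, (∀ x ∈ q, x ∈ D.S) → q.length < p.length →
        ⟪D.ρ q.prod (D.e s), D.e y⟫ = 0 := by
      intro q hq hlt
      have h1 := hmin q hq (by simp; omega)
      have h2 := hmin (y :: q) (by
        intro z hz
        rcases List.mem_cons.1 hz with rfl | hz
        · exact hy
        · exact hq z hz) (by simpa using hlt)
      rw [hstep, h1] at h2
      by_contra h
      have : 2 * ⟪D.ρ q.prod (D.e s), D.e y⟫ * ⟪D.e y, D.e t⟫ ≠ 0 := by positivity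
      apply this; linarith
    obtain ⟨i1, i2, i3⟩ := ih y hy hp' hyp hminy
    have hyp2 : y ∉ p := by
      intro h
      obtain ⟨q, hq, hlt, hqn⟩ := i3 y h
      exact hqn (hminy q hq hlt)
    have hys : s ≠ y := by
      rintro rfl
      have : p = [] := by
        by_contra hpn
        have := hminy [] (by simp) (List.length_pos_iff.2 hpn)
        rw [List.prod_nil, rho_one, D.e_self hs] at this
        norm_num at this
      subst this
      rw [List.prod_nil, rho_one] at h0
      exact hyt h0
    refine ⟨List.nodup_cons.2 ⟨hyp2, i1⟩, by simp [hys, i2], ?_⟩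
    intro z hz
    rcases List.mem_cons.1 hz with rfl | hz
    · exact ⟨p, hp', by simp, hyp⟩
    · obtain ⟨q, hq, hlt, hqn⟩ := i3 z hz
      exact ⟨q, hq, by simp; omega, hqn⟩

theorem good_path {s t : D.W} (hs : s ∈ D.S) (ht : t ∈ D.S) (h : D.Cmp s t) (hst : s ≠ t) :
    ∃ γ, D.RtOf s γ ∧ D.GoodAt s t γ ∧ ⟪γ, D.e t⟫ ≠ 0 ∧ γ ≠ D.e t ∧ γ ≠ -D.e t := by
  classical
  obtain ⟨p0, hp0, hne0⟩ := path_exists hs h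
  have hex : ∃ n, ∃ p : List D.W, p.length = n ∧ (∀ x ∈ p, x ∈ D.S) ∧ ⟪D.ρ p.prod (D.e s), D.e t⟫ ≠ 0 :=
    ⟨_, p0, rfl, hp0, hne0⟩
  obtain ⟨p, hpl, hp, hne⟩ := Nat.find_spec hex
  have hmin : ∀ q : List D.W, (∀ x ∈ q, x ∈ D.S) → q.length < p.length → ⟪D.ρ q.prod (D.e s), D.e t⟫ = 0 := by
    intro q hq hlt
    by_contra hqn
    exact Nat.find_min hex (by rw [hpl] at hlt; exact hlt) ⟨q, rfl, hq, hqn⟩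
  obtain ⟨i1, i2, i3⟩ := path_minimal hs p t ht hp hne hmin
  have htp : t ∉ p := by
    intro h
    obtain ⟨q, hq, hlt, hqn⟩ := i3 t h
    exact hqn (hmin q hq hlt)
  have hom : ⟪D.ω t, D.ρ p.prod (D.e s)⟫ = 0 := by
    have := word_om ht hp htp
    rw [← this, rho_inner, om_e_ne ht hs hst.symm]
  have n1 : (p ++ [s]).Nodup := by
    rw [List.nodup_append]
    refine ⟨i1, by simp, ?_⟩
    intro a ha b hb
    rw [List.mem_singleton] at hb
    subst hb
    rintro rfl
    exact i2 ha
  have n2 : (t :: (p ++ [s])).Nodup := by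
    rw [List.nodup_cons]
    refine ⟨?_, n1⟩
    simp [htp, hst.symm]
  have n3 : (t :: p).Nodup := List.nodup_cons.2 ⟨htp, i1⟩
  have m1 : ∀ x ∈ p ++ [s], x ∈ D.S := by
    intro x hx
    rcases List.mem_append.1 hx with hx | hx
    · exact hp x hx
    · rw [List.mem_singleton.1 hx]; exact hs
  have m2 : ∀ x ∈ t :: (p ++ [s]), x ∈ D.S := by
    intro x hx
    rcases List.mem_cons.1 hx with rfl | hx
    · exact ht
    · exact m1 x hx
  have m3 : ∀ x ∈ t :: p, x ∈ D.S := by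
    intro x hx
    rcases List.mem_cons.1 hx with rfl | hx
    · exact ht
    · exact hp x hx
  have l1 := nodup_reduced m1 n1
  have l2 := nodup_reduced m2 n2
  have l3 := nodup_reduced m3 n3
  have l4 := nodup_reduced hp i1
  refine ⟨D.ρ p.prod (D.e s), ⟨_, rfl⟩, ?_, hne, ?_, ?_⟩
  · rw [goodAt_iff hs]
    simp only [List.prod_append, List.prod_cons, List.prod_nil, mul_one, List.length_append,
      List.length_cons, List.length_nil, ← mul_assoc] at l1 l2 l3 l4
    omega
  · intro h
    rw [h] at hom
    exact om_e_self ht hom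
  · intro h
    rw [h, inner_neg_right, neg_eq_zero] at hom
    exact om_e_self ht hom

end CoxeterRootSystem
end

open Pointwise RealInnerProductSpace
noncomputable section
namespace CoxeterRootSystem
variable {V : Type} [NormedAddCommGroup V] [InnerProductSpace ℝ V] {D : CoxeterRootSystem V}

/-- crystallographic-like cosines -/
def Nv (c : ℝ) : Prop := c = 0 ∨ c = 1 ∨ c = -1 ∨ 2 * c = 1 ∨ 2 * c = -1 ∨ 2 * c ^ 2 = 1

/-- parity class of a nonzero cosine -/
def Kv (c : ℝ) (b : Bool) : Prop := ∃ q : ℚ, q ≠ 0 ∧ c = if b then (q : ℝ) * √(1/2) else q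

theorem sq_eq_one_cases (c : ℝ) : c ^ 2 = 1 ↔ c = 1 ∨ c = -1 := by
  rw [← sq_eq_sq_iff_eq_or_eq_neg, one_pow]

theorem rhalf_sq : √(1/2 : ℝ) * √(1/2) = 1/2 := Real.mul_self_sqrt (by norm_num)

theorem rhalf_irr (q : ℚ) : √(1/2 : ℝ) ≠ q := by
  intro h
  have h1 : Irrational (√2) := irrational_sqrt_two
  apply h1
  have : √2 = 2 * √(1/2 : ℝ) := by
    have h4 : (2:ℝ) = 4 * (1/2) := by norm_num
    rw [h4, Real.sqrt_mul (by norm_num)]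
    have : √(4:ℝ) = 2 := by
      rw [show (4:ℝ) = 2 ^ 2 by norm_num]; exact Real.sqrt_sq (by norm_num)
    rw [this]; norm_num
  exact ⟨2 * q, by rw [this, h]; push_cast; ring⟩

theorem Kv.ne {c : ℝ} {b : Bool} (h : Kv c b) : c ≠ 0 := by
  obtain ⟨q, hq, rfl⟩ := h
  have h1 : (q : ℝ) ≠ 0 := by exact_mod_cast hq
  have h2 := rhalf_bounds.1
  cases b
  · simpa using hq
  · simp only [if_true]; exact mul_ne_zero h1 (by linarith)

theorem Kv.unique {c : ℝ} {a b : Bool} (h : Kv c a) (h' : Kv c b) : a = b := by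
  obtain ⟨q, hq, rfl⟩ := h
  obtain ⟨p, hp, h2⟩ := h'
  have h1 : (q : ℝ) ≠ 0 := by exact_mod_cast hq
  have h1p : (p : ℝ) ≠ 0 := by exact_mod_cast hp
  cases a <;> cases b <;> simp at h2 ⊢
  · apply rhalf_irr (q / p); push_cast; rw [h2]; simp; field_simp
  · apply rhalf_irr (p / q); push_cast; rw [← h2]; simp; field_simp

theorem Kv.neg {c : ℝ} {b : Bool} (h : Kv c b) : Kv (-c) b := by
  obtain ⟨q, hq, rfl⟩ := h
  exact ⟨-q, neg_ne_zero.2 hq, by cases b <;> simp⟩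

theorem Kv.mul {c d : ℝ} {a b : Bool} (h : Kv c a) (h' : Kv d b) : Kv (2 * c * d) (xor a b) := by
  obtain ⟨q, hq, rfl⟩ := h
  obtain ⟨p, hp, rfl⟩ := h'
  have hr := rhalf_sq
  cases a <;> cases b
  · exact ⟨2 * q * p, by positivity, by simp⟩
  · exact ⟨2 * q * p, by positivity, by simp; ring⟩
  · exact ⟨2 * q * p, by positivity, by simp; ring⟩
  · refine ⟨q * p, by positivity, ?_⟩
    simp only [if_true, Bool.xor_self, Bool.false_eq_true, if_false]
    push_cast
    linear_combination (2 * (q:ℝ) * p) * hr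

theorem Nv.kv {c : ℝ} (h : Nv c) (h0 : c ≠ 0) : ∃ b, Kv c b := by
  rcases h with h | h | h | h | h | h
  · exact absurd h h0
  · exact ⟨false, 1, by norm_num, by simp [h]⟩
  · exact ⟨false, -1, by norm_num, by simp [h]⟩
  · exact ⟨false, 1/2, by norm_num, by simp; linarith⟩
  · exact ⟨false, -1/2, by norm_num, by simp; linarith⟩
  · have : (c - √(1/2)) * (c + √(1/2)) = 0 := by linear_combination h / 2 - rhalf_sq
    rcases mul_eq_zero.1 this with h | h
    · exact ⟨true, 1, by norm_num, by simp at h ⊢; linarith⟩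
    · exact ⟨true, -1, by norm_num, by simp at h ⊢; linarith⟩

theorem Nv.sq {c : ℝ} (h : Nv c) : ∃ q : ℚ, c ^ 2 = q := by
  rcases h with h | h | h | h | h | h
  · exact ⟨0, by simp [h]⟩
  · exact ⟨1, by simp [h]⟩
  · exact ⟨1, by simp [h]⟩
  · exact ⟨1/4, by rw [show c = 1/2 by linarith]; norm_num⟩
  · exact ⟨1/4, by rw [show c = -1/2 by linarith]; norm_num⟩
  · exact ⟨1/2, by push_cast; linarith⟩

theorem kv_mix {c d : ℝ} (hc : Kv c false) (hd : Kv d true) (h : ∃ q : ℚ, (c + d) ^ 2 = q) : False := by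
  obtain ⟨q, hq, rfl⟩ := hc
  obtain ⟨p, hp, rfl⟩ := hd
  obtain ⟨m, hm⟩ := h
  have h1 : (q : ℝ) ≠ 0 := by exact_mod_cast hq
  have h1p : (p : ℝ) ≠ 0 := by exact_mod_cast hp
  simp only [if_true, Bool.false_eq_true, if_false] at hm
  apply rhalf_irr ((m - q ^ 2 - p ^ 2 / 2) / (2 * q * p))
  push_cast
  rw [← hm]
  field_simp
  have := rhalf_sq
  rw [← sub_eq_zero]
  have key := rhalf_sq
  ring_nf at key ⊢
  rw [key]; ring

theorem kv_tri {x y z : ℝ} {a b c : Bool} (hx : Kv x a) (hy : Kv y b) (hz : Kv z c)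
    (h : Nv (z - 2 * x * y)) : c = xor a b := by
  have hm := (hx.mul hy).neg
  obtain ⟨q, hq⟩ := h.sq
  by_contra hne
  cases hab : xor a b <;> rw [hab] at hm hne <;> cases c
  · exact hne rfl
  · exact kv_mix hm hz ⟨q, by rw [← hq]; ring⟩
  · exact kv_mix hz hm ⟨q, by rw [← hq]; ring⟩
  · exact hne rfl

/-- roots of the component of `s` -/
def CRt (D : CoxeterRootSystem V) (s : D.W) (γ : V) : Prop := ∃ x ∈ D.S, D.Cmp s x ∧ D.RtOf x γ

theorem CRt.rt {s : D.W} {γ : V} (h : D.CRt s γ) : D.Rt γ := by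
  obtain ⟨x, hx, _, h⟩ := h
  exact h.rt hx

theorem CRt.act {s : D.W} {γ : V} (h : D.CRt s γ) (u : D.W) : D.CRt s (D.ρ u γ) := by
  obtain ⟨x, hx, hc, h⟩ := h
  exact ⟨x, hx, hc, h.act u⟩

theorem CRt.inC {s : D.W} {γ : V} (h : D.CRt s γ) : D.InC s γ := by
  obtain ⟨x, hx, hc, h⟩ := h
  exact h.inC hx hc

theorem crt_e {s x : D.W} (hx : x ∈ D.S) (h : D.Cmp s x) : D.CRt s (D.e x) := ⟨x, hx, h, rtOf_e x⟩

theorem CRt.reflect {s : D.W} {β γ : V} (hβ : D.CRt s β) (hγ : D.CRt s γ) :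
    D.CRt s (γ - (2 * ⟪β, γ⟫) • β) := by
  obtain ⟨r, hr⟩ := hβ.rt.refl
  rw [← hr]
  exact hγ.act r

/-- chain predicate -/
def Pc (D : CoxeterRootSystem V) (s : D.W) (β0 : V) (b : Bool) (β : V) : Prop :=
  Kv ⟪β0, β⟫ b ∨ (⟪β0, β⟫ = 0 ∧ ∃ δ, D.CRt s δ ∧ ∃ b1 b2, Kv ⟪β0, δ⟫ b1 ∧ Kv ⟪δ, β⟫ b2 ∧ b = xor b1 b2)

section

theorem tri {s : D.W} (HN : ∀ β γ, D.CRt s β → D.CRt s γ → Nv ⟪β, γ⟫)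
    {α β γ : V} (hα : D.CRt s α) (hβ : D.CRt s β) (hγ : D.CRt s γ) {a b : Bool}
    (h1 : Kv ⟪α, β⟫ a) (h2 : Kv ⟪β, γ⟫ b) (h0 : ⟪α, γ⟫ ≠ 0) : Kv ⟪α, γ⟫ (xor a b) := by
  obtain ⟨c, hc⟩ := (HN α γ hα hγ).kv h0
  have h := HN _ _ hα (hβ.reflect hγ)
  rw [inner_sub_right, real_inner_smul_right] at h
  have e := kv_tri h2 h1 hc h
  rw [Bool.xor_comm, ← e]; exact hc

theorem Pc.step {s : D.W} (HN : ∀ β γ, D.CRt s β → D.CRt s γ → Nv ⟪β, γ⟫)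
    {β0 β γ : V} (h0 : D.CRt s β0) (hβ : D.CRt s β) (hγ : D.CRt s γ) {b c : Bool}
    (h : D.Pc s β0 b β) (hk : Kv ⟪β, γ⟫ c) : D.Pc s β0 (xor b c) γ := by
  rcases h with h | ⟨hz, δ, hδ, b1, b2, k1, k2, rfl⟩
  · by_cases hg : ⟪β0, γ⟫ = 0
    · exact Or.inr ⟨hg, β, hβ, b, c, h, hk, rfl⟩
    · exact Or.inl (tri HN h0 hβ hγ h hk hg)
  · have key : ∃ δ, D.CRt s δ ∧ Kv ⟪β0, δ⟫ b1 ∧ Kv ⟪δ, γ⟫ (xor b2 c) := by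
      by_cases hd : ⟪δ, γ⟫ = 0
      · refine ⟨_, hβ.reflect hδ, ?_, ?_⟩
        · rw [inner_sub_right, real_inner_smul_right, hz]; simpa using k1
        · rw [inner_sub_left, real_inner_smul_left, hd, real_inner_comm δ β]
          have := (k2.mul hk).neg
          convert this using 1; first | done | ring
      · exact ⟨δ, hδ, k1, tri HN hδ hβ hγ k2 hk hd⟩
    obtain ⟨δ, hδ, k1, k3⟩ := key
    rw [Bool.xor_assoc]
    by_cases hg : ⟪β0, γ⟫ = 0
    · exact Or.inr ⟨hg, δ, hδ, b1, _, k1, k3, rfl⟩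
    · exact Or.inl (tri HN h0 hδ hγ k1 k3 hg)

theorem pc_same {s : D.W} (HN : ∀ β γ, D.CRt s β → D.CRt s γ → Nv ⟪β, γ⟫)
    {γ0 : V} (h0 : D.CRt s γ0) (w : D.W) : D.Pc s γ0 false (D.ρ w γ0) := by
  induction w using D.W_induction with
  | h1 =>
    left; rw [rho_one, h0.rt.self]; exact ⟨1, by norm_num, by simp⟩
  | hm y hy u ih =>
    rw [rho_mul]
    set γ := D.ρ u γ0 with hγd
    have hγ : D.CRt s γ := h0.act u
    by_cases hz : ⟪γ, D.e y⟫ = 0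
    · have : D.ρ y γ = γ := by rw [D.rho_gen hy, real_inner_comm, hz]; simp
      rw [this]; exact ih
    · have hc : D.Cmp s y := by
        by_contra hn; exact hz (hγ.inC y hy hn)
      have hey := crt_e hy hc
      obtain ⟨c, hk⟩ := (HN _ _ hγ hey).kv hz
      have st := Pc.step HN h0 hγ hey ih hk
      have hk2 : Kv ⟪D.e y, D.ρ y γ⟫ c := by
        rw [D.rho_gen hy, inner_sub_right, real_inner_smul_right, D.e_self hy, real_inner_comm]
        convert hk.neg using 1; ring
      have := Pc.step HN h0 hey (hγ.act y) st hk2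
      simpa using this

theorem single {s : D.W} (HN : ∀ β γ, D.CRt s β → D.CRt s γ → Nv ⟪β, γ⟫)
    {x : D.W} (hx : x ∈ D.S) (hc : D.Cmp s x) {γ γ' β : V} (hγ : D.RtOf x γ) (hγ' : D.RtOf x γ')
    (hβ : D.CRt s β) {a b : Bool} (h1 : Kv ⟪γ, β⟫ a) (h2 : Kv ⟪γ', β⟫ b) : a = b := by
  obtain ⟨u, rfl⟩ := hγ
  obtain ⟨v, rfl⟩ := hγ'
  have hu : D.CRt s (D.ρ u (D.e x)) := (crt_e hx hc).act u
  have h := pc_same HN hu (v * u⁻¹)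
  rw [rho_mul, rho_inv_rho] at h
  have := Pc.step HN hu ((crt_e hx hc).act v) hβ h h2
  simp only [Bool.false_xor] at this
  rcases this with h | h
  · exact h1.unique h
  · exact absurd h.1 h1.ne

theorem single_sq {s : D.W} (HN : ∀ β γ, D.CRt s β → D.CRt s γ → Nv ⟪β, γ⟫)
    {x : D.W} (hx : x ∈ D.S) (hc : D.Cmp s x) {γ γ' β : V} (hγ : D.RtOf x γ) (hγ' : D.RtOf x γ')
    (hβ : D.CRt s β) (h1 : ⟪γ, β⟫ ≠ 0) (h2 : ⟪γ', β⟫ ≠ 0) (n1 : γ ≠ β) (n1' : γ ≠ -β) (n2 : γ' ≠ β)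
    (n2' : γ' ≠ -β) : ⟪γ, β⟫ ^ 2 = ⟪γ', β⟫ ^ 2 := by
  have H : ∀ γ, D.RtOf x γ → ⟪γ, β⟫ ≠ 0 → γ ≠ β → γ ≠ -β → 
      ∃ a, Kv ⟪γ, β⟫ a ∧ ⟪γ, β⟫ ^ 2 = if a then 1/2 else 1/4 := by
    intro γ hγ h0 hn hn'
    have hr : D.CRt s γ := ⟨x, hx, hc, hγ⟩
    have hN := HN _ _ hr hβ
    rcases hN with h | h | h | h | h | h
    · exact absurd h h0
    · exact absurd (rt_eq_of_inner hr.rt hβ.rt h) hn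
    · exact absurd (rt_eq_of_inner hr.rt hβ.rt.neg (by rw [inner_neg_right, h]; norm_num)) hn'
    · exact ⟨false, ⟨1/2, by norm_num, by simp; linarith⟩, by rw [show ⟪γ, β⟫ = 1/2 by linarith]; norm_num⟩
    · exact ⟨false, ⟨-1/2, by norm_num, by simp; linarith⟩, by rw [show ⟪γ, β⟫ = -1/2 by linarith]; norm_num⟩
    · have h' : ⟪γ, β⟫ ^ 2 = 1/2 := by linarith
      have : Nv ⟪γ, β⟫ := by unfold Nv; tauto
      obtain ⟨a, ha⟩ := this.kv h0
      refine ⟨a, ha, ?_⟩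
      cases a
      · exfalso
        obtain ⟨q, hq, e⟩ := ha
        simp only [Bool.false_eq_true, if_false] at e
        have : (⟪γ, β⟫ - √(1/2)) * (⟪γ, β⟫ + √(1/2)) = 0 := by linear_combination h' - rhalf_sq
        rcases mul_eq_zero.1 this with h | h
        · exact rhalf_irr q (by rw [← e]; linarith)
        · exact rhalf_irr (-q) (by push_cast; rw [← e]; linarith)
      · simpa using h'
  obtain ⟨a, ka, ea⟩ := H γ hγ h1 n1 n1'
  obtain ⟨b, kb, eb⟩ := H γ' hγ' h2 n2 n2'
  rw [ea, eb, single HN hx hc hγ hγ' hβ ka kb]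

end

theorem e_ne_e {s a : D.W} (hs : s ∈ D.S) (ha : a ∈ D.S) (hne : a ≠ s) :
    D.e s ≠ D.e a ∧ D.e s ≠ - D.e a := by
  constructor <;> intro h <;> apply om_e_self hs <;> rw [h]
  · exact om_e_ne hs ha hne.symm
  · rw [inner_neg_right, om_e_ne hs ha hne.symm, neg_zero]

theorem Nv.kv_true {c : ℝ} (h : Nv c) (hk : Kv c true) : c ^ 2 = 1/2 := by
  have hf : ∀ q : ℚ, c = q → False := by
    intro q hq
    have hne := hk.ne
    have : Kv c false := ⟨q, by rintro rfl; simp at hq; exact hne hq, by simpa using hq⟩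
    exact absurd (this.unique hk) (by simp)
  rcases h with h | h | h | h | h | h
  · exact (hf 0 (by simp [h])).elim
  · exact (hf 1 (by simp [h])).elim
  · exact (hf (-1) (by simp [h])).elim
  · exact (hf (1/2) (by push_cast; linarith)).elim
  · exact (hf (-1/2) (by push_cast; linarith)).elim
  · linarith

/-- a path of length two -/
theorem good_self {s a : D.W} (hs : s ∈ D.S) (ha : a ∈ D.S) (h : ⟪D.e a, D.e s⟫ ≠ 0) (hne : a ≠ s) :
    D.GoodAt s s (D.ρ a (D.e s)) := by
  have l2 : D.len (a * s) = 2 := by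
    have := nodup_reduced (D := D) (l := [a, s]) (by simp [ha, hs]) (by simp [hne])
    simpa using this
  have l1 : D.len a = 1 := by
    have := nodup_reduced (D := D) (l := [a]) (by simp [ha]) (by simp)
    simpa using this
  have l2' : D.len (s * a) = 2 := by
    have := nodup_reduced (D := D) (l := [s, a]) (by simp [ha, hs]) (by simp [hne.symm])
    simpa using this
  rw [goodAt_iff hs, l2, l1, l2']
  simp only [true_iff, Nat.reduceAdd]
  rcases D.len_mul_gen (s * a) hs with h' | h'
  · rw [h', l2']
  · exfalso
    have h1 : D.len (s * a * s) = 1 := by omega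
    obtain ⟨m, hm, hmn, hmp⟩ := D.exists_reduced (s * a * s)
    rw [h1] at hmn
    have hmem : a ∈ m := by
      apply mem_of_count_one (l₁ := [s]) (l₂ := [s]) (l := m) (by simp [ha, hs]) (by simp [hne]) (by simp [hne]) hm
      rw [hmp]; simp [mul_assoc]
    obtain ⟨x, rfl⟩ := List.length_eq_one_iff.1 hmn
    simp only [List.mem_singleton] at hmem
    subst hmem
    have e1 : a = s * a * s := by simpa using hmp
    have e2 : s * a = a * s := by
      calc s * a = s * (s * a * s) := by rw [← e1]
        _ = a * s := by rw [← mul_assoc, ← mul_assoc, D.hS_inv s hs, one_mul]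
    have e3 : D.ρ s (D.ρ a (D.e s)) = D.ρ a (D.ρ s (D.e s)) := by rw [← rho_mul, ← rho_mul, e2]
    rw [D.rho_gen_e hs, map_neg, D.rho_gen ha, D.rho_gen hs] at e3
    have e4 := congrArg (fun v => ⟪D.e a, v⟫) e3
    simp only [inner_sub_right, inner_neg_right, real_inner_smul_right, D.e_self hs, D.e_self ha] at e4
    rw [real_inner_comm (D.e a) (D.e s)] at e4
    set c := ⟪D.e a, D.e s⟫
    have hc2 : c ≠ 0 := h
    have : c * (c ^ 2 - 1) = 0 := by ring_nf at e4 ⊢; linarith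
    have h1 : c ^ 2 = 1 := by
      rcases mul_eq_zero.1 this with h | h
      · exact absurd h hc2
      · linarith
    rcases (sq_eq_one_cases _).1 h1 with h | h
    · exact (e_ne_e hs ha hne).1 (rt_eq_of_inner (rt_e ha) (rt_e hs) h).symm
    · exact (e_ne_e hs ha hne).2 (rt_eq_of_inner (rt_e hs) (rt_e ha).neg
        (by rw [inner_neg_right, real_inner_comm]; linarith))

theorem star_no5 {s t : D.W} (hs : s ∈ D.S) (ht : t ∈ D.S) (hst : D.Cmp s t)
    (HA : ∀ β γ, D.RtOf s β → D.Rt γ → Alw ⟪β, γ⟫)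
    (HN : ∀ β γ, D.CRt s β → D.CRt s γ → Nv ⟪β, γ⟫) : D.Star s t := by
  have hrefl : D.Cmp s s := Relation.ReflTransGen.refl
  have fin : ∀ γ0, D.RtOf s γ0 → D.GoodAt s t γ0 → ⟪γ0, D.e t⟫ ≠ 0 → γ0 ≠ D.e t → γ0 ≠ -D.e t → D.Star s t := by
    intro γ0 hγ0 hg h0 hn hn'
    apply star_of_good hs ht
    intro γ hγ h1 h2
    by_cases hz : ⟪γ, D.e t⟫ = 0
    · exact goodAt_orth ht hz
    · exact hg.transfer_abs hs ht HA hγ0 hγ (single_sq HN hs hrefl hγ0 hγ (crt_e ht hst) h0 hz hn hn' h1 h2)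
  by_cases he : s = t
  · subst he
    by_cases hq : ∃ a ∈ D.S, a ≠ s ∧ ⟪D.e a, D.e s⟫ ≠ 0 ∧ Kv ⟪D.e a, D.e s⟫ false
    · obtain ⟨a, ha, hne, h0, hk⟩ := hq
      have hN := HN _ _ (crt_e ha (hrefl.step hs ha (by rwa [real_inner_comm]))) (crt_e hs hrefl)
      have hval : ⟪D.e a, D.e s⟫ ^ 2 = 1/4 := by
        rcases hN with h | h | h | h | h | h
        · exact absurd h h0
        · exact absurd (rt_eq_of_inner (rt_e ha) (rt_e hs) h).symm (e_ne_e hs ha hne).1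
        · exact absurd (rt_eq_of_inner (rt_e hs) (rt_e ha).neg
            (by rw [inner_neg_right, real_inner_comm]; linarith)) (e_ne_e hs ha hne).2
        · rw [show ⟪D.e a, D.e s⟫ = 1/2 by linarith]; norm_num
        · rw [show ⟪D.e a, D.e s⟫ = -1/2 by linarith]; norm_num
        · exfalso
          have : (⟪D.e a, D.e s⟫ - √(1/2)) * (⟪D.e a, D.e s⟫ + √(1/2)) = 0 := by
            linear_combination h / 2 - rhalf_sq
          obtain ⟨q, hq, e⟩ := hk
          simp only [Bool.false_eq_true, if_false] at e
          rcases mul_eq_zero.1 this with h | h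
          · exact rhalf_irr q (by rw [← e]; linarith)
          · exact rhalf_irr (-q) (by push_cast; rw [← e]; linarith)
      have hin : ⟪D.ρ a (D.e s), D.e s⟫ = 1/2 := by
        rw [D.rho_gen ha, inner_sub_left, real_inner_smul_left, D.e_self hs]
        linear_combination -2 * hval
      apply fin _ ((rtOf_e s).act a) (good_self hs ha h0 hne) (by rw [hin]; norm_num)
      · intro h; rw [h, D.e_self hs] at hin; norm_num at hin
      · intro h; rw [h, inner_neg_left, D.e_self hs] at hin; norm_num at hin
    · push Not at hq
      have key : ∀ u : D.W, ∃ n : ℤ, ⟪D.ρ u (D.e s), D.e s⟫ = n := by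
        intro u
        -- prove by expanding with reflections on the left
        have : ∀ u : D.W, ∃ n : ℤ, ⟪D.e s, D.ρ u (D.e s)⟫ = n := by
          intro u
          induction u using D.W_induction with
          | h1 => exact ⟨1, by rw [rho_one, D.e_self hs]; simp⟩
          | hm y hy u ih =>
            obtain ⟨n, hn⟩ := ih
            rw [rho_mul, D.rho_gen hy, inner_sub_right, real_inner_smul_right, hn]
            by_cases hys : y = s
            · subst hys
              rw [hn, D.e_self hs]
              exact ⟨n - 2 * n, by push_cast; ring⟩
            by_cases h0 : ⟪D.e y, D.e s⟫ = 0
            · rw [real_inner_comm] at h0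
              rw [h0]; exact ⟨n, by ring⟩
            have h0' : ⟪D.e s, D.e y⟫ ≠ 0 := by rwa [real_inner_comm]
            have hcy : D.Cmp s y := hrefl.step hs hy h0'
            have hk := hq y hy hys h0
            have hky : Kv ⟪D.e s, D.e y⟫ true := by
              obtain ⟨b, hb⟩ := (HN _ _ (crt_e hs hrefl) (crt_e hy hcy)).kv h0'
              cases b
              · exact absurd (by rwa [real_inner_comm] at hb) hk
              · exact hb
            by_cases hg : ⟪D.e y, D.ρ u (D.e s)⟫ = 0
            · rw [hg]; exact ⟨n, by ring⟩
            have hg' : ⟪D.ρ u (D.e s), D.e y⟫ ≠ 0 := by rwa [real_inner_comm]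
            obtain ⟨b, hb⟩ := (HN _ _ ((crt_e hs hrefl).act u) (crt_e hy hcy)).kv hg'
            have hbt := single HN hs hrefl (rtOf_e s) ((rtOf_e s).act u) (crt_e hy hcy) hky hb
            subst hbt
            have v1 := (HN _ _ (crt_e hs hrefl) (crt_e hy hcy)).kv_true hky
            have v2 := (HN _ _ ((crt_e hs hrefl).act u) (crt_e hy hcy)).kv_true hb
            rw [real_inner_comm] at v2
            have : (2 * ⟪D.e y, D.ρ u (D.e s)⟫ * ⟪D.e s, D.e y⟫) ^ 2 = 1 := by
              rw [mul_pow, mul_pow, v1, v2]; norm_num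
            rcases (sq_eq_one_cases _).1 this with h | h
            · exact ⟨n - 1, by rw [h]; push_cast; ring⟩
            · exact ⟨n + 1, by rw [h]; push_cast; ring⟩
        obtain ⟨n, hn⟩ := this u
        exact ⟨n, by rw [real_inner_comm, hn]⟩
      apply star_of_good hs hs
      intro γ hγ h1 h2
      obtain ⟨u, rfl⟩ := hγ
      obtain ⟨n, hn⟩ := key u
      have hcr : D.CRt s (D.ρ u (D.e s)) := (crt_e hs hrefl).act u
      rcases HN _ _ hcr (crt_e hs hrefl) with h | h | h | h | h | h
      · exact goodAt_orth hs h
      · exact absurd (rt_eq_of_inner hcr.rt (rt_e hs) h) h1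
      · exact absurd (rt_eq_of_inner hcr.rt (rt_e hs).neg (by rw [inner_neg_right, h]; norm_num)) h2
      · exfalso; rw [hn] at h
        have : 2 * n = 1 := by exact_mod_cast h
        omega
      · exfalso; rw [hn] at h
        have : 2 * n = -1 := by exact_mod_cast h
        omega
      · exfalso; rw [hn] at h
        have : 2 * n ^ 2 = 1 := by exact_mod_cast h
        omega
  · obtain ⟨γ0, h1, h2, h3, h4, h5⟩ := good_path hs ht hst he
    exact fin γ0 h1 h2 h3 h4 h5

/-- the ring of integers of `ℚ(√2)` -/
def Z2 (x : ℝ) : Prop := ∃ m n : ℤ, x = m + n * √2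

theorem Z2.sub {x y : ℝ} (hx : Z2 x) (hy : Z2 y) : Z2 (x - y) := by
  obtain ⟨a, b, rfl⟩ := hx
  obtain ⟨c, d, rfl⟩ := hy
  exact ⟨a - c, b - d, by push_cast; ring⟩

theorem Z2.mul {x y : ℝ} (hx : Z2 x) (hy : Z2 y) : Z2 (x * y) := by
  obtain ⟨a, b, rfl⟩ := hx
  obtain ⟨c, d, rfl⟩ := hy
  have h : √(2:ℝ) * √2 = 2 := Real.mul_self_sqrt (by norm_num)
  exact ⟨a * c + 2 * (b * d), a * d + b * c, by push_cast; linear_combination ((b:ℝ) * d) * h⟩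

theorem Z2.not_gold {x : ℝ} (hx : Z2 x) (h : x ^ 2 = x + 1) : False := by
  obtain ⟨a, b, rfl⟩ := hx
  have hs : √(2:ℝ) * √2 = 2 := Real.mul_self_sqrt (by norm_num)
  have e : ((a:ℝ) ^ 2 + 2 * b ^ 2 - a - 1) + (2 * a * b - b) * √2 = 0 := by
    linear_combination h - (b:ℝ) ^ 2 * hs
  have hz : 2 * a * b - b = 0 := by
    by_contra hne
    have hne' : (2 * a * b - b : ℝ) ≠ 0 := by exact_mod_cast hne
    apply irrational_sqrt_two
    refine ⟨-((a:ℚ) ^ 2 + 2 * b ^ 2 - a - 1) / (2 * a * b - b), ?_⟩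
    push_cast
    rw [div_eq_iff hne']; linarith
  have hz' : (2 * a * b - b : ℝ) = 0 := by exact_mod_cast hz
  rw [hz', zero_mul, add_zero] at e
  have e' : a ^ 2 + 2 * b ^ 2 - a - 1 = 0 := by exact_mod_cast e
  have hb : b = 0 := by
    have : b * (2 * a - 1) = 0 := by linarith
    rcases mul_eq_zero.1 this with h | h
    · exact h
    · omega
  subst hb
  have : a * (a - 1) = 1 := by linarith
  have h3 : IsUnit a := IsUnit.of_mul_eq_one _ this
  rcases Int.isUnit_iff.1 h3 with h | h <;> subst h <;> norm_num at this

theorem nv_of_no5 {s : D.W} 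
    (HA : ∀ x ∈ D.S, D.Cmp s x → ∀ β γ, D.RtOf x β → D.Rt γ → Alw ⟪β, γ⟫)
    (H5 : ∀ x ∈ D.S, ∀ y ∈ D.S, D.Cmp s x → D.Cmp s y → Nv ⟪D.e x, D.e y⟫) :
    ∀ β γ, D.CRt s β → D.CRt s γ → Nv ⟪β, γ⟫ := by
  have hNZ : ∀ c, Nv c → Z2 (2 * c) := by
    intro c h
    rcases h with h | h | h | h | h | h
    · exact ⟨0, 0, by simp [h]⟩
    · exact ⟨2, 0, by simp [h]⟩
    · exact ⟨-2, 0, by simp [h]⟩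
    · exact ⟨1, 0, by simp [h]⟩
    · exact ⟨-1, 0, by simp [h]⟩
    · have hs : √(2:ℝ) * √2 = 2 := Real.mul_self_sqrt (by norm_num)
      have : (2 * c - √2) * (2 * c + √2) = 0 := by linear_combination 2 * h - hs
      rcases mul_eq_zero.1 this with h | h
      · exact ⟨0, 1, by push_cast; linarith⟩
      · exact ⟨0, -1, by push_cast; linarith⟩
  have key : ∀ x ∈ D.S, D.Cmp s x → ∀ u : D.W, ∀ y ∈ D.S, D.Cmp s y → Z2 (2 * ⟪D.e y, D.ρ u (D.e x)⟫) := by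
    intro x hx hcx u
    induction u using D.W_induction with
    | h1 => intro y hy hcy; rw [rho_one]; exact hNZ _ (H5 y hy x hx hcy hcx)
    | hm z hz u ih =>
      intro y hy hcy
      rw [rho_mul]
      by_cases hcz : D.Cmp s z
      · rw [D.rho_gen hz, inner_sub_right, real_inner_smul_right]
        have := (ih y hy hcy).sub ((ih z hz hcz).mul (hNZ _ (H5 y hy z hz hcy hcz)))
        convert this using 1; ring
      · rw [((crt_e hx hcx).act u).inC.fix hz hcz]
        exact ih y hy hcy
  intro β γ hβ hγ
  obtain ⟨y, hy, hcy, v, rfl⟩ := hβ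
  obtain ⟨x, hx, hcx, u, rfl⟩ := hγ
  have hZ := key x hx hcx (v⁻¹ * u) y hy hcy
  rw [rho_mul, ← D.rho_inner v, rho_rho_inv] at hZ
  have hA := HA y hy hcy _ _ ⟨v, rfl⟩ (RtOf.rt hx ⟨u, rfl⟩)
  rcases hA with h | h | h | h | h | h | h | h
  · exact Or.inl h
  · exact Or.inr (Or.inl h)
  · exact Or.inr (Or.inr (Or.inl h))
  · exact Or.inr (Or.inr (Or.inr (Or.inl h)))
  · exact Or.inr (Or.inr (Or.inr (Or.inr (Or.inl h))))
  · exact Or.inr (Or.inr (Or.inr (Or.inr (Or.inr h))))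
  · exact (hZ.not_gold (by linarith)).elim
  · exfalso
    have h0 : Z2 0 := ⟨0, 0, by simp⟩
    exact (h0.sub hZ).not_gold (by ring_nf at h ⊢; linarith)

end CoxeterRootSystem
end

open Pointwise RealInnerProductSpace
noncomputable section
namespace CoxeterRootSystem
variable {V : Type} [NormedAddCommGroup V] [InnerProductSpace ℝ V] {D : CoxeterRootSystem V}

/-! formal integers `p + q X`, `X ^ 2 = X + 1` -/

abbrev Zp := ℤ × ℤ

def zadd (a b : Zp) : Zp := (a.1 + b.1, a.2 + b.2)
def zneg (a : Zp) : Zp := (-a.1, -a.2)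
def zmul (a b : Zp) : Zp := (a.1 * b.1 + a.2 * b.2, a.1 * b.2 + a.2 * b.1 + a.2 * b.2)

def ev (x : ℝ) (z : Zp) : ℝ := z.1 + z.2 * x

theorem ev_add (x : ℝ) (a b : Zp) : ev x (zadd a b) = ev x a + ev x b := by
  simp only [ev, zadd]; push_cast; ring

theorem ev_neg (x : ℝ) (a : Zp) : ev x (zneg a) = - ev x a := by
  simp only [ev, zneg]; push_cast; ring

theorem ev_mul {x : ℝ} (hx : x ^ 2 = x + 1) (a b : Zp) : ev x (zmul a b) = ev x a * ev x b := by
  simp only [ev, zmul]; push_cast; linear_combination (-(a.2 : ℝ) * b.2) * hx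

theorem ev_zero (x : ℝ) : ev x (0, 0) = 0 := by simp [ev]
theorem ev_one (x : ℝ) : ev x (1, 0) = 1 := by simp [ev]
theorem ev_two (x : ℝ) : ev x (2, 0) = 2 := by simp [ev]

theorem gold_irr {x : ℝ} (hx : x ^ 2 = x + 1) (q : ℚ) : x ≠ q := by
  intro h
  have h5 : Irrational (√(5:ℕ)) := Nat.Prime.irrational_sqrt (by norm_num)
  have hs : √((5:ℕ):ℝ) * √((5:ℕ):ℝ) = 5 := by rw [Real.mul_self_sqrt] <;> norm_num
  have : ((2 * x - 1) - √((5:ℕ):ℝ)) * ((2 * x - 1) + √((5:ℕ):ℝ)) = 0 := by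
    linear_combination 4 * hx - hs
  apply h5
  rcases mul_eq_zero.1 this with h' | h'
  · exact ⟨2 * q - 1, by push_cast; rw [← h]; push_cast at h'; linarith⟩
  · exact ⟨-(2 * q - 1), by push_cast; rw [← h]; push_cast at h'; linarith⟩

theorem ev_inj {x : ℝ} (hx : x ^ 2 = x + 1) {a b : Zp} (h : ev x a = ev x b) : a = b := by
  unfold ev at h
  by_cases hq : a.2 = b.2
  · rw [hq] at h
    have : (a.1 : ℝ) = b.1 := by linarith
    exact Prod.ext (by exact_mod_cast this) hq
  · exfalso
    have h1 : ((b.2 : ℝ) - a.2) ≠ 0 := by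
      intro h0; apply hq
      have : (a.2 : ℝ) = b.2 := by linarith
      exact_mod_cast this
    apply gold_irr hx ((a.1 - b.1) / (b.2 - a.2))
    push_cast
    rw [eq_div_iff h1]; linarith

/-- formal Gram entry (doubled) -/
def bent (E : List Zp) (i j : ℕ) : Zp :=
  if i = j then (2, 0) else E.getD (max i j * (max i j - 1) / 2 + min i j) (0, 0)

def pr (E : List Zp) (i : ℕ) : ℕ → List Zp → Zp
  | _, [] => (0, 0)
  | k, c :: l => zadd (zmul (bent E i k) c) (pr E i (k + 1) l)

def addAt : List Zp → ℕ → Zp → List Zp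
  | [], _, _ => []
  | a :: l, 0, c => zadd a c :: l
  | a :: l, i + 1, c => a :: addAt l i c

def rf (E : List Zp) (i : ℕ) (v : List Zp) : List Zp := addAt v i (zneg (pr E i 0 v))

def actw (E : List Zp) (w : List ℕ) (v : List Zp) : List Zp := w.foldr (rf E) v

def bas (n i : ℕ) : List Zp := (List.range n).map (fun j => if j = i then (1, 0) else (0, 0))

/-- gauged simple roots -/
def fv (D : CoxeterRootSystem V) (p : D.W × Bool) : V := if p.2 then D.e p.1 else -D.e p.1

/-- real vector of a formal vector -/
def vec (D : CoxeterRootSystem V) (x : ℝ) : List (D.W × Bool) → List Zp → V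
  | p :: L, c :: l => ev x c • D.fv p + D.vec x L l
  | _, _ => 0

def nth (L : List (D.W × Bool)) (i : ℕ) : D.W × Bool := L.getD i (1, true)

/-- interpretation of a formal Gram matrix -/
structure Itp (D : CoxeterRootSystem V) (s0 : D.W) (x : ℝ) (L : List (D.W × Bool)) (E : List Zp) : Prop where
  hx : x ^ 2 = x + 1
  hL : ∀ p ∈ L, p.1 ∈ D.S ∧ D.Cmp s0 p.1
  nd : (L.map Prod.fst).Nodup
  gram : ∀ i < L.length, ∀ j < L.length, 2 * ⟪D.fv (nth L i), D.fv (nth L j)⟫ = ev x (bent E i j)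

theorem addAt_length (l : List Zp) (i : ℕ) (c : Zp) : (addAt l i c).length = l.length := by
  induction l generalizing i with
  | nil => simp [addAt]
  | cons a l ih => cases i <;> simp [addAt, ih]

theorem rf_length (E : List Zp) (i : ℕ) (v : List Zp) : (rf E i v).length = v.length := addAt_length _ _ _

theorem actw_length (E : List Zp) (w : List ℕ) (v : List Zp) : (actw E w v).length = v.length := by
  induction w with
  | nil => rfl
  | cons a w ih => simp only [actw, List.foldr_cons, rf_length]; exact ih

theorem bas_length (n i : ℕ) : (bas n i).length = n := by simp [bas]

theorem vec_addAt (x : ℝ) (L : List (D.W × Bool)) (l : List Zp) (i : ℕ) (c : Zp) (hi : i < L.length)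
    (hl : l.length = L.length) :
    D.vec x L (addAt l i c) = D.vec x L l + ev x c • D.fv (nth L i) := by
  induction L generalizing l i with
  | nil => simp at hi
  | cons p L ih =>
    cases l with
    | nil => simp at hl
    | cons a l =>
      cases i with
      | zero => simp only [addAt, vec, ev_add, nth, List.getD_cons_zero, add_smul]; abel
      | succ i =>
        have := ih l i (by simpa using hi) (by simpa using hl)
        simp only [addAt, vec, this, nth, List.getD_cons_succ]; abel

theorem vec_neg (x : ℝ) (L : List (D.W × Bool)) (l : List Zp) : D.vec x L (l.map zneg) = - D.vec x L l := by
  induction L generalizing l with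
  | nil => simp [vec]
  | cons p L ih =>
    cases l with
    | nil => simp [vec]
    | cons a l => simp only [List.map_cons, vec, ev_neg, ih, neg_smul]; abel

theorem vec_bas_aux (x : ℝ) (L : List (D.W × Bool)) (k i : ℕ) :
    D.vec x L ((List.range' k L.length).map (fun j => if j = i then ((1, 0) : Zp) else (0, 0))) =
      if k ≤ i ∧ i < k + L.length then D.fv (nth L (i - k)) else 0 := by
  induction L generalizing k with
  | nil => simp [vec]; 
  | cons p L ih =>
    simp only [List.length_cons, List.range'_succ, List.map_cons, vec, ih]
    by_cases h : k = i
    · subst h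
      simp [ev_one, nth]
    · have : (k ≤ i ∧ i < k + (L.length + 1)) ↔ (k + 1 ≤ i ∧ i < k + 1 + L.length) := by omega
      rw [if_neg h, ev_zero, zero_smul, zero_add]
      simp only [this]
      split_ifs with h2
      · have : i - k = (i - (k + 1)) + 1 := by omega
        rw [this]; simp [nth]
      · rfl

theorem vec_bas (x : ℝ) (L : List (D.W × Bool)) {i : ℕ} (hi : i < L.length) :
    D.vec x L (bas L.length i) = D.fv (nth L i) := by
  have := vec_bas_aux (D := D) x L 0 i
  rw [bas, List.range_eq_range', this]; simp [hi]

section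
variable {s0 : D.W} {x : ℝ} {L : List (D.W × Bool)} {E : List Zp}

theorem nth_mem {i : ℕ} (hi : i < L.length) : nth L i ∈ L := by
  unfold nth
  rw [List.getD_eq_getElem _ _ hi]; exact List.getElem_mem _

theorem Itp.mem (I : Itp D s0 x L E) {i : ℕ} (hi : i < L.length) : (nth L i).1 ∈ D.S := (I.hL _ (nth_mem hi)).1
theorem Itp.cmp (I : Itp D s0 x L E) {i : ℕ} (hi : i < L.length) : D.Cmp s0 (nth L i).1 := (I.hL _ (nth_mem hi)).2

theorem Itp.inj (I : Itp D s0 x L E) {i j : ℕ} (hi : i < L.length) (hj : j < L.length)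
    (h : (nth L i).1 = (nth L j).1) : i = j := by
  have := I.nd
  unfold nth at h
  rw [List.getD_eq_getElem _ _ hi, List.getD_eq_getElem _ _ hj] at h
  have h2 := (List.Nodup.getElem_inj_iff this (i := i) (j := j) (hi := by simpa using hi) (hj := by simpa using hj)).1
    (by simpa using h)
  exact h2

theorem Itp.pr_aux (I : Itp D s0 x L E) {i : ℕ} (hi : i < L.length) (L' : List (D.W × Bool)) (l : List Zp) (k : ℕ)
    (hk : k + L'.length = L.length) (hL' : ∀ j < L'.length, nth L' j = nth L (k + j)) (hl : l.length = L'.length) :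
    2 * ⟪D.fv (nth L i), D.vec x L' l⟫ = ev x (pr E i k l) := by
  induction L' generalizing l k with
  | nil => 
    have : l = [] := by simpa using hl
    subst this
    simp [vec, pr, ev_zero]
  | cons p L' ih =>
    cases l with
    | nil => simp at hl
    | cons c l =>
      have h0 := hL' 0 (by simp)
      simp only [nth, List.getD_cons_zero, add_zero] at h0
      have h1 := ih l (k + 1) (by simp at hk; omega) (by
        intro j hj
        have := hL' (j + 1) (by simpa using hj)
        simp only [nth, List.getD_cons_succ] at this ⊢
        rw [this]; congr 1; omega) (by simpa using hl)
      have g := I.gram i hi k (by simp at hk; omega)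
      simp only [vec, pr, inner_add_right, real_inner_smul_right, ev_add, ev_mul I.hx]
      rw [← h1, ← g, show p = nth L k from h0]; ring

theorem Itp.pr_eq (I : Itp D s0 x L E) {i : ℕ} (hi : i < L.length) {l : List Zp} (hl : l.length = L.length) :
    2 * ⟪D.fv (nth L i), D.vec x L l⟫ = ev x (pr E i 0 l) :=
  I.pr_aux hi L l 0 (by simp) (by simp) hl

theorem rho_fv {p : D.W × Bool} (hp : p.1 ∈ D.S) (v : V) : D.ρ p.1 v = v - (2 * ⟪D.fv p, v⟫) • D.fv p := by
  rw [D.rho_gen hp]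
  obtain ⟨s, b⟩ := p
  cases b <;> simp [fv]

theorem Itp.rf_eq (I : Itp D s0 x L E) {i : ℕ} (hi : i < L.length) {l : List Zp} (hl : l.length = L.length) :
    D.vec x L (rf E i l) = D.ρ (nth L i).1 (D.vec x L l) := by
  rw [rf, vec_addAt x L l i _ hi hl, rho_fv (I.mem hi), I.pr_eq hi hl, ev_neg, neg_smul]; abel

/-- group element of a word -/
def wd (L : List (D.W × Bool)) (w : List ℕ) : List D.W := w.map (fun i => (nth L i).1)

theorem Itp.wd_mem (I : Itp D s0 x L E) {w : List ℕ} (hw : ∀ i ∈ w, i < L.length) : ∀ y ∈ wd L w, y ∈ D.S := by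
  intro y hy
  obtain ⟨i, hi, rfl⟩ := List.mem_map.1 hy
  exact I.mem (hw i hi)

theorem Itp.actw_eq (I : Itp D s0 x L E) {w : List ℕ} (hw : ∀ i ∈ w, i < L.length) {l : List Zp}
    (hl : l.length = L.length) : D.vec x L (actw E w l) = D.ρ (wd L w).prod (D.vec x L l) := by
  induction w with
  | nil => simp [actw, wd]
  | cons a w ih =>
    have h1 := ih (fun i hi => hw i (by simp [hi]))
    have h2 := I.rf_eq (hw a (by simp)) (l := actw E w l) (by rw [actw_length, hl])
    simp only [actw, List.foldr_cons] at h1 h2 ⊢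
    rw [h2, h1, ← rho_mul]; rfl

theorem om_fv_ne {j : D.W} {p : D.W × Bool} (hj : j ∈ D.S) (hp : p.1 ∈ D.S) (h : j ≠ p.1) :
    ⟪D.ω j, D.fv p⟫ = 0 := by
  obtain ⟨s, b⟩ := p
  cases b <;> simp [fv, om_e_ne hj hp h]

theorem om_fv_self {p : D.W × Bool} (hp : p.1 ∈ D.S) : ⟪D.ω p.1, D.fv p⟫ ≠ 0 := by
  obtain ⟨s, b⟩ := p
  cases b <;> simp [fv, om_e_self hp]

theorem om_vec_zero {j : D.W} (hj : j ∈ D.S) (L : List (D.W × Bool)) (l : List Zp) 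
    (hL : ∀ p ∈ L, p.1 ∈ D.S ∧ p.1 ≠ j) : ⟪D.ω j, D.vec x L l⟫ = 0 := by
  induction L generalizing l with
  | nil => simp [vec]
  | cons p L ih =>
    cases l with
    | nil => simp [vec]
    | cons c l =>
      have hp := hL p (by simp)
      simp only [vec, inner_add_right, real_inner_smul_right, om_fv_ne hj hp.1 hp.2.symm,
        ih l (fun q hq => hL q (by simp [hq]))]; simp

theorem om_vec (L : List (D.W × Bool)) (l : List Zp) (hL : ∀ p ∈ L, p.1 ∈ D.S) (nd : (L.map Prod.fst).Nodup)
    {i : ℕ} (hi : i < L.length) (hl : l.length = L.length) :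
    ⟪D.ω (nth L i).1, D.vec x L l⟫ = ev x (l.getD i (0, 0)) * ⟪D.ω (nth L i).1, D.fv (nth L i)⟫ := by
  induction L generalizing l i with
  | nil => simp at hi
  | cons p L ih =>
    cases l with
    | nil => simp at hl
    | cons c l =>
      simp only [List.map_cons, List.nodup_cons] at nd
      cases i with
      | zero =>
        simp only [nth, List.getD_cons_zero, vec, inner_add_right, real_inner_smul_right]
        rw [om_vec_zero (hL p (by simp)) L l, add_zero]
        intro q hq
        refine ⟨hL q (by simp [hq]), fun h => nd.1 ?_⟩
        rw [← h]; exact List.mem_map_of_mem hq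
      | succ i =>
        have hi' : i < L.length := by simpa using hi
        have h1 := ih l (fun q hq => hL q (by simp [hq])) nd.2 hi' (by simpa using hl)
        have hm : nth L i ∈ L := nth_mem hi'
        simp only [nth, List.getD_cons_succ, vec, inner_add_right, real_inner_smul_right] at h1 hm ⊢
        rw [h1, om_fv_ne (hL _ (List.mem_cons_of_mem _ hm)) (hL p (by simp)), mul_zero, zero_add]
        intro h
        exact nd.1 (by rw [← h]; exact List.mem_map_of_mem hm)

theorem Itp.om (I : Itp D s0 x L E) {i : ℕ} (hi : i < L.length) {l : List Zp} (hl : l.length = L.length) :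
    ⟪D.ω (nth L i).1, D.vec x L l⟫ = ev x (l.getD i (0, 0)) * ⟪D.ω (nth L i).1, D.fv (nth L i)⟫ :=
  om_vec L l (fun p hp => (I.hL p hp).1) I.nd hi hl

theorem Itp.vec_inj (I : Itp D s0 x L E) {l m : List Zp} (hl : l.length = L.length) (hm : m.length = L.length)
    (h : D.vec x L l = D.vec x L m) : l = m := by
  apply List.ext_getElem (hl.trans hm.symm)
  intro i h1 h2
  have hi : i < L.length := by omega
  have e1 := I.om hi hl
  rw [h, I.om hi hm] at e1
  have := ev_inj I.hx (mul_right_cancel₀ (om_fv_self (I.mem hi)) e1)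
  rw [List.getD_eq_getElem _ _ h1, List.getD_eq_getElem _ _ h2] at this
  exact this.symm

theorem rtOf_fv {p : D.W × Bool} (hp : p.1 ∈ D.S) : D.RtOf p.1 (D.fv p) := by
  obtain ⟨s, b⟩ := p
  cases b
  · simpa [fv] using (rtOf_e s).neg hp
  · simpa [fv] using rtOf_e s

end

end CoxeterRootSystem
end

open Pointwise RealInnerProductSpace
noncomputable section
namespace CoxeterRootSystem
variable {V : Type} [NormedAddCommGroup V] [InnerProductSpace ℝ V] {D : CoxeterRootSystem V}

/-- formal allowed doubled products -/
def allowed : List Zp := [(0, 0), (1, 0), (-1, 0), (0, 1), (0, -1), (-1, 1), (1, -1), (2, 0), (-2, 0)]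

def Hf (x c : ℝ) : Prop := ∃ z ∈ allowed, 2 * c = ev x z

inductive Stp where
  | base (w : List ℕ) (s : ℕ)
  | good (i j t : ℕ)
  | move (i t : ℕ)

inductive Cert where
  | dis (t : ℕ) (w : List ℕ) (i : ℕ)
  | nul (v : List Zp)
  | prp (l : List Stp)

def wordsOf (n : ℕ) : ℕ → List (List ℕ)
  | 0 => [[]]
  | k + 1 => (List.range n).flatMap (fun i => (wordsOf n k).map (fun l => i :: l))

def suppOf (E : List Zp) (n : ℕ) (w : List ℕ) : List ℕ :=
  (List.range n).filter (fun j => (List.range n).any (fun i =>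
    (actw E w (bas n i)).getD j (0, 0) != (bas n i).getD j (0, 0)))

def baseOk (E : List Zp) (n : ℕ) (w : List ℕ) (s : ℕ) : Bool :=
  (w ++ [s]).all (fun i => decide (i < n)) &&
  (decide ((w ++ [s]).length ≤ (suppOf E n (w ++ [s])).length + 1) ||
    (decide ((w ++ [s]).length ≤ (suppOf E n (w ++ [s])).length + 3) &&
     (wordsOf n ((w ++ [s]).length - 2)).all (fun l => (List.range n).any (fun i =>
      actw E l (bas n i) != actw E (w ++ [s]) (bas n i)))))

def runc (E : List Zp) (n : ℕ) : List Stp → List (ℕ × List Zp) → List (ℕ × ℕ × Zp) → Bool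
  | [], ps, _ => ps.any (fun p => ps.any (fun q => decide (q.1 = p.1) && decide (q.2 = p.2.map zneg)))
  | .base w s :: r, ps, gs => baseOk E n w s && runc E n r (ps ++ [(s, actw E w (bas n s))]) gs
  | .good i j t :: r, ps, gs =>
    match ps[i]?, ps[j]? with
    | some p, some q => decide (q.1 = p.1) && decide (q.2 = rf E t p.2) && decide (t < n) &&
        runc E n r ps ((p.1, t, pr E t 0 p.2) :: gs)
    | _, _ => false
  | .move i t :: r, ps, gs =>
    match ps[i]? with
    | some p => decide (t < n) && gs.any (fun g =>
          (decide (g.1 = p.1 ∧ g.2.1 = t) || decide (g.1 = t ∧ g.2.1 = p.1)) &&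
          (decide (g.2.2 = pr E t 0 p.2) || decide (g.2.2 = zneg (pr E t 0 p.2)))) &&
        runc E n r (ps ++ [(p.1, rf E t p.2)]) gs
    | none => false

def chk (n : ℕ) (E : List Zp) : Cert → Bool
  | .dis t w i => decide (t < n) && decide (i < n) && w.all (fun j => decide (j < n)) &&
      decide (pr E t 0 (actw E w (bas n i)) ∉ allowed)
  | .nul v => decide (v.length = n) && decide (v ≠ List.replicate n (0, 0)) &&
      (List.range n).all (fun i => decide (pr E i 0 v = (0, 0)))
  | .prp l => runc E n l [] []

section
variable {s0 : D.W} {x : ℝ} {L : List (D.W × Bool)} {E : List Zp}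

/-- gauged positivity -/
def PosF (D : CoxeterRootSystem V) (p : D.W × Bool) (γ : V) : Prop :=
  D.Pos p.1 (if p.2 then γ else -γ)

def PS (D : CoxeterRootSystem V) (x : ℝ) (L : List (D.W × Bool)) (p : ℕ × List Zp) : Prop :=
  p.1 < L.length ∧ p.2.length = L.length ∧ D.RtOf (nth L p.1).1 (D.vec x L p.2) ∧
    D.PosF (nth L p.1) (D.vec x L p.2)

def GS (D : CoxeterRootSystem V) (x : ℝ) (L : List (D.W × Bool)) (g : ℕ × ℕ × Zp) : Prop :=
  g.1 < L.length ∧ g.2.1 < L.length ∧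
  (∀ γ, D.RtOf (nth L g.1).1 γ → (2 * ⟪γ, D.e (nth L g.2.1).1⟫) ^ 2 = ev x g.2.2 ^ 2 →
    D.GoodAt (nth L g.1).1 (nth L g.2.1).1 γ) ∧
  (∀ γ, D.RtOf (nth L g.2.1).1 γ → (2 * ⟪γ, D.e (nth L g.1).1⟫) ^ 2 = ev x g.2.2 ^ 2 →
    D.GoodAt (nth L g.2.1).1 (nth L g.1).1 γ)

theorem posF_neg {p : D.W × Bool} (hp : p.1 ∈ D.S) {γ : V} (h : D.RtOf p.1 γ) :
    D.PosF p (-γ) ↔ ¬ D.PosF p γ := by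
  obtain ⟨s, b⟩ := p
  cases b
  · simp only [PosF, Bool.false_eq_true, if_false]
    rw [D.pos_neg_iff hp (h.neg hp)]
  · simp only [PosF, if_true]
    rw [D.pos_neg_iff hp h]

theorem posF_good {p : D.W × Bool} {t : D.W} (hp : p.1 ∈ D.S) {γ : V} (h : D.RtOf p.1 γ) :
    D.GoodAt p.1 t γ ↔ (D.PosF p γ ↔ D.PosF p (D.ρ t γ)) := by
  obtain ⟨s, b⟩ := p
  cases b
  · simp only [PosF, Bool.false_eq_true, if_false, GoodAt]
    rw [D.pos_neg_iff hp h, D.pos_neg_iff hp (h.act t)]; tauto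
  · simp only [PosF, if_true, GoodAt]

theorem posF_base {p : D.W × Bool} (hp : p.1 ∈ D.S) (u : D.W) (h : D.len (u * p.1) = D.len u + 1) :
    D.PosF p (D.ρ u (D.fv p)) := by
  obtain ⟨s, b⟩ := p
  have := (D.pos_iff hp u).2 h
  cases b <;> simpa [PosF, fv] using this

theorem inner_fv_sq (v : V) (p : D.W × Bool) : (2 * ⟪v, D.e p.1⟫) ^ 2 = (2 * ⟪D.fv p, v⟫) ^ 2 := by
  obtain ⟨s, b⟩ := p
  cases b <;> simp [fv, real_inner_comm]

theorem mem_wordsOf {n k : ℕ} {l : List ℕ} (hl : l.length = k) (h : ∀ i ∈ l, i < n) : l ∈ wordsOf n k := by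
  induction k generalizing l with
  | zero => simp [List.length_eq_zero_iff.1 hl, wordsOf]
  | succ k ih =>
    cases l with
    | nil => simp at hl
    | cons a l =>
      simp only [wordsOf, List.mem_flatMap, List.mem_range, List.mem_map]
      exact ⟨a, h a (by simp), l, ih (by simpa using hl) (fun i hi => h i (by simp [hi])), rfl⟩

theorem Itp.supp_mem (I : Itp D s0 x L E) {w : List ℕ} (hw : ∀ i ∈ w, i < L.length) {l : List D.W}
    (hl : ∀ y ∈ l, y ∈ D.S) (hp : l.prod = (wd L w).prod) {j : ℕ} (hj : j ∈ suppOf E L.length w) :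
    (nth L j).1 ∈ l := by
  simp only [suppOf, List.mem_filter, List.mem_range, List.any_eq_true, bne_iff_ne, ne_eq] at hj
  obtain ⟨hjn, i, hi, hne⟩ := hj
  apply mem_of_coeff (I.mem hjn) hl (D.vec x L (bas L.length i))
  rw [hp, ← I.actw_eq hw (bas_length _ _), I.om hjn (by rw [actw_length, bas_length]), I.om hjn (bas_length _ _)]
  intro h
  exact hne (ev_inj I.hx (mul_right_cancel₀ (om_fv_self (I.mem hjn)) h))

theorem supp_nodup (n : ℕ) (w : List ℕ) : (suppOf E n w).Nodup := List.nodup_range.filter _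

theorem Itp.suppw_nodup (I : Itp D s0 x L E) (w : List ℕ) : (wd L (suppOf E L.length w)).Nodup := by
  apply List.Nodup.map_on _ (supp_nodup _ _)
  intro i hi j hj h
  simp only [suppOf, List.mem_filter, List.mem_range] at hi hj
  exact I.inj hi.1 hj.1 h

theorem Itp.base_len (I : Itp D s0 x L E) {w : List ℕ} {s : ℕ} (h : baseOk E L.length w s = true) :
    (∀ i ∈ w ++ [s], i < L.length) ∧ D.len ((wd L w).prod * (nth L s).1) = D.len (wd L w).prod + 1 := by
  simp only [baseOk, Bool.and_eq_true, List.all_eq_true, decide_eq_true_eq, Bool.or_eq_true] at h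
  obtain ⟨hw, h⟩ := h
  refine ⟨hw, ?_⟩
  set W := w ++ [s] with hW
  have hWp : (wd L W).prod = (wd L w).prod * (nth L s).1 := by simp [hW, wd]
  have hWl : W.length = w.length + 1 := by simp [hW]
  have hs : s < L.length := hw s (by simp [hW])
  have hww : ∀ i ∈ w, i < L.length := fun i hi => hw i (by simp [hW, hi])
  have l1 : D.len (wd L w).prod ≤ w.length := by
    have h0 := D.len_le (I.wd_mem hww) rfl
    rwa [show (wd L w).length = w.length by simp [wd]] at h0
  suffices hge : W.length ≤ D.len (wd L W).prod + 1 by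
    have := D.len_mul_gen (wd L w).prod (I.mem hs)
    rw [hWp] at hge
    omega
  obtain ⟨l, hl, hln, hlp⟩ := D.exists_reduced (wd L W).prod
  rw [← hln]
  have hsub : (wd L (suppOf E L.length W)).Subperm l := by
    apply List.Nodup.subperm (I.suppw_nodup W)
    intro y hy
    obtain ⟨j, hj, rfl⟩ := List.mem_map.1 hy
    exact I.supp_mem hw hl hlp hj
  have hk := hsub.length_le
  rw [wd, List.length_map] at hk
  rcases h with h | ⟨h3, h4⟩
  · omega
  · by_contra hlt
    have hpar : l.length % 2 = W.length % 2 := by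
      have p1 := D.len_parity (I.wd_mem hw)
      rw [← hln] at p1
      simpa [wd] using p1
    have hl2 : l.length = W.length - 2 := by omega
    have hall : ∀ y ∈ l, ∃ i < L.length, y = (nth L i).1 := by
      intro y hy
      by_contra hno
      push Not at hno
      have hny : y ∉ wd L (suppOf E L.length W) := by
        intro hy'
        obtain ⟨j, hj, rfl⟩ := List.mem_map.1 hy'
        simp only [suppOf, List.mem_filter, List.mem_range] at hj
        exact hno j hj.1 rfl
      obtain ⟨l1, l2, rfl⟩ := List.append_of_mem hy
      have hsub2 : (wd L (suppOf E L.length W)).Subperm (l1 ++ l2) := by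
        apply List.Nodup.subperm (I.suppw_nodup W)
        intro z hz
        have := hsub.subset hz
        have hzy : z ≠ y := by rintro rfl; exact hny hz
        simp only [List.mem_append, List.mem_cons] at this ⊢
        tauto
      have hperm := hsub2.perm_of_length_le (by
        simp only [List.length_append, List.length_cons] at hl2 ⊢
        rw [wd, List.length_map]; omega)
      have hn12 : y ∉ l1 ++ l2 := fun h => hny (hperm.mem_iff.2 h)
      simp only [List.mem_append, not_or] at hn12
      have := mem_of_count_one hl hn12.1 hn12.2 (I.wd_mem hw) hlp.symm
      obtain ⟨j, hj, rfl⟩ := List.mem_map.1 this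
      exact hno j (hw j hj) rfl
    have hex : ∃ m : List ℕ, (∀ i ∈ m, i < L.length) ∧ wd L m = l := by
      clear hsub hk hl2 hpar hlt hlp hln hl
      induction l with
      | nil => exact ⟨[], by simp, rfl⟩
      | cons a l ih =>
        obtain ⟨m, hm, e⟩ := ih (fun y hy => hall y (by simp [hy]))
        obtain ⟨i, hi, e'⟩ := hall a (by simp)
        exact ⟨i :: m, by simpa [hi] using hm, by rw [e', ← e]; rfl⟩
    obtain ⟨m, hm, rfl⟩ := hex
    have := h4 m (mem_wordsOf (by rw [← hl2]; simp [wd]) hm)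
    simp only [List.any_eq_true, bne_iff_ne, ne_eq] at this
    obtain ⟨i, _, hne⟩ := this
    apply hne
    apply I.vec_inj (by rw [actw_length, bas_length]) (by rw [actw_length, bas_length])
    rw [I.actw_eq hm (bas_length _ _), I.actw_eq hw (bas_length _ _), hlp]

theorem Itp.mk_good (I : Itp D s0 x L E) (HA : ∀ y ∈ D.S, D.Cmp s0 y → ∀ β γ, D.RtOf y β → D.Rt γ → Alw ⟪β, γ⟫)
    {s t : ℕ} {v : List Zp} (h1 : D.PS x L (s, v)) (h2 : D.PS x L (s, rf E t v)) (ht : t < L.length) :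
    D.GS x L (s, t, pr E t 0 v) := by
  obtain ⟨hs, hv, hr, hp⟩ := h1
  obtain ⟨_, _, _, hp'⟩ := h2
  simp only at hs hv hr hp hp'
  rw [I.rf_eq ht hv] at hp'
  have hg : D.GoodAt (nth L s).1 (nth L t).1 (D.vec x L v) := (posF_good (I.mem hs) hr).2 (by simp [hp, hp'])
  have hA := HA _ (I.mem hs) (I.cmp hs)
  have first : ∀ γ, D.RtOf (nth L s).1 γ → (2 * ⟪γ, D.e (nth L t).1⟫) ^ 2 = ev x (pr E t 0 v) ^ 2 →
    D.GoodAt (nth L s).1 (nth L t).1 γ := by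
    intro γ hγ he
    apply hg.transfer_abs (I.mem hs) (I.mem ht) hA hr hγ
    rw [← I.pr_eq ht hv, ← inner_fv_sq] at he
    nlinarith
  refine ⟨hs, ht, first, ?_⟩
  intro γ hγ he
  simp only at hγ he ⊢
  obtain ⟨u, rfl⟩ := hγ
  have := (goodAt_symm (I.mem hs) (I.mem ht) u⁻¹).1 (first _ ⟨u⁻¹, rfl⟩ (by
    rw [← he, ← D.rho_inner u, rho_rho_inv, real_inner_comm]))
  rwa [inv_inv] at this

theorem Itp.runc_sound (I : Itp D s0 x L E)
    (HA : ∀ y ∈ D.S, D.Cmp s0 y → ∀ β γ, D.RtOf y β → D.Rt γ → Alw ⟪β, γ⟫)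
    (l : List Stp) (ps : List (ℕ × List Zp)) (gs : List (ℕ × ℕ × Zp)) (hps : ∀ p ∈ ps, D.PS x L p)
    (hgs : ∀ g ∈ gs, D.GS x L g) (h : runc E L.length l ps gs = true) : False := by
  induction l generalizing ps gs with
  | nil =>
    simp only [runc, List.any_eq_true, Bool.and_eq_true, decide_eq_true_eq] at h
    obtain ⟨p, hp, q, hq, e1, e2⟩ := h
    have h1 := hps p hp
    have h2 := hps q hq
    obtain ⟨a1, a2, a3, a4⟩ := h1
    obtain ⟨b1, b2, b3, b4⟩ := h2
    rw [e1, e2, vec_neg] at b4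
    exact (posF_neg (I.mem a1) a3).1 b4 a4
  | cons st l ih =>
    cases st with
    | base w s =>
      simp only [runc, Bool.and_eq_true] at h
      obtain ⟨h1, h2⟩ := h
      obtain ⟨hw, hl⟩ := I.base_len h1
      have hs : s < L.length := hw s (by simp)
      have hww : ∀ i ∈ w, i < L.length := fun i hi => hw i (by simp [hi])
      refine ih _ _ ?_ hgs h2
      intro p hp
      rcases List.mem_append.1 hp with hp | hp
      · exact hps p hp
      · obtain rfl := List.mem_singleton.1 hp
        have e := I.actw_eq hww (bas_length L.length s)
        rw [vec_bas x L hs] at e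
        refine ⟨hs, by rw [actw_length, bas_length], ?_, ?_⟩
        · rw [e]; exact (rtOf_fv (I.mem hs)).act _
        · rw [e]; exact posF_base (I.mem hs) _ hl
    | good i j t =>
      simp only [runc] at h
      split at h
      · rename_i p q e1 e2
        simp only [Bool.and_eq_true, decide_eq_true_eq] at h
        obtain ⟨⟨⟨c1, c2⟩, c3⟩, c4⟩ := h
        refine ih _ _ hps ?_ c4
        intro g hg
        rcases List.mem_cons.1 hg with rfl | hg
        · have h1 := hps p (List.mem_of_getElem? e1)
          have h2 := hps q (List.mem_of_getElem? e2)
          apply I.mk_good HA h1 _ c3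
          have : q = (p.1, rf E t p.2) := Prod.ext c1 c2
          rwa [← this]
        · exact hgs g hg
      · simp at h
    | move i t =>
      simp only [runc] at h
      split at h
      · rename_i p e1
        simp only [Bool.and_eq_true, decide_eq_true_eq, List.any_eq_true, Bool.or_eq_true] at h
        obtain ⟨⟨ht, g, hg, hst, hk⟩, h4⟩ := h
        refine ih _ _ ?_ hgs h4
        intro q hq
        rcases List.mem_append.1 hq with hq | hq
        · exact hps q hq
        · obtain rfl := List.mem_singleton.1 hq
          obtain ⟨a1, a2, a3, a4⟩ := hps p (List.mem_of_getElem? e1)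
          obtain ⟨b1, b2, b3, b4⟩ := hgs g hg
          have hsq : (2 * ⟪D.vec x L p.2, D.e (nth L t).1⟫) ^ 2 = ev x g.2.2 ^ 2 := by
            rw [inner_fv_sq, I.pr_eq ht a2]
            rcases hk with hk | hk <;> rw [hk]
            rw [ev_neg]; ring
          have hgood : D.GoodAt (nth L p.1).1 (nth L t).1 (D.vec x L p.2) := by
            rcases hst with ⟨r1, r2⟩ | ⟨r1, r2⟩
            · rw [← r1, ← r2]; exact b3 _ (by rw [r1]; exact a3) (by rw [r2]; exact hsq)
            · rw [← r1, ← r2]; exact b4 _ (by rw [r2]; exact a3) (by rw [r1]; exact hsq)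
          refine ⟨a1, by rw [rf_length]; exact a2, ?_, ?_⟩
          · rw [I.rf_eq ht a2]; exact a3.act _
          · rw [I.rf_eq ht a2]; exact ((posF_good (I.mem a1) a3).1 hgood).1 a4
      · simp at h

theorem Itp.chk_sound (I : Itp D s0 x L E)
    (HA : ∀ y ∈ D.S, D.Cmp s0 y → ∀ β γ, D.RtOf y β → D.Rt γ → Alw ⟪β, γ⟫)
    (HH : ∀ β γ, D.CRt s0 β → D.CRt s0 γ → Hf x ⟪β, γ⟫) {c : Cert} (h : chk L.length E c = true) : False := by
  cases c with
  | dis t w i =>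
    simp only [chk, Bool.and_eq_true, decide_eq_true_eq, List.all_eq_true] at h
    obtain ⟨⟨⟨ht, hi⟩, hw⟩, hn⟩ := h
    have c1 : ∀ j < L.length, D.CRt s0 (D.fv (nth L j)) := fun j hj => ⟨_, I.mem hj, I.cmp hj, rtOf_fv (I.mem hj)⟩
    obtain ⟨z, hz, e⟩ := HH _ _ (c1 t ht) ((c1 i hi).act (wd L w).prod)
    rw [← vec_bas x L hi, ← I.actw_eq hw (bas_length _ _), I.pr_eq ht (by rw [actw_length, bas_length])] at e
    rw [ev_inj I.hx e] at hn
    exact hn hz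
  | nul v =>
    simp only [chk, Bool.and_eq_true, decide_eq_true_eq, List.all_eq_true, List.mem_range] at h
    obtain ⟨⟨hl, hne⟩, hz⟩ := h
    apply hne
    have hz0 : D.vec x L v = 0 := by
      have key : ∀ i < L.length, ⟪D.vec x L v, D.fv (nth L i)⟫ = 0 := by
        intro i hi
        have := I.pr_eq hi hl
        rw [hz i hi, ev_zero, real_inner_comm] at this
        linarith
      have key2 : ∀ (L' : List (D.W × Bool)) (l : List Zp), (∀ p ∈ L', p ∈ L) → ⟪D.vec x L v, D.vec x L' l⟫ = 0 := by
        intro L'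
        induction L' with
        | nil => intro l _; simp [vec]
        | cons p L' ih =>
          intro l hp
          cases l with
          | nil => simp [vec]
          | cons c l =>
            obtain ⟨i, hi, e⟩ := List.getElem_of_mem (hp p (by simp))
            have hpi : p = nth L i := by unfold nth; rw [List.getD_eq_getElem _ _ hi, e]
            simp only [vec, inner_add_right, real_inner_smul_right, ih l (fun q hq => hp q (by simp [hq]))]
            rw [hpi, key i hi]; simp
      exact inner_self_eq_zero.1 (key2 L v (fun _ h => h))
    apply I.vec_inj hl (by simp)
    rw [hz0]
    have : ∀ L' : List (D.W × Bool), D.vec x L' (List.replicate L'.length (0, 0)) = 0 := by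
      intro L'
      induction L' with
      | nil => simp [vec]
      | cons p L' ih => simp only [List.length_cons, List.replicate_succ, vec, ih, ev_zero]; simp
    exact (this L).symm
  | prp l => exact I.runc_sound HA l [] [] (by simp) (by simp) h

end
end CoxeterRootSystem
end

open Pointwise RealInnerProductSpace
noncomputable section
namespace CoxeterRootSystem
variable {V : Type} [NormedAddCommGroup V] [InnerProductSpace ℝ V] {D : CoxeterRootSystem V}

def tabT : List (List Zp × Cert) := [
  ([(0, -1), (1, 0), (-1, 0)],
    .prp [.base [0, 2, 1] 2, .base [0] 1, .base [2, 0] 1, .good 1 2 2, .move 0 1, .base [1, 2, 0] 2, .base [1] 0, .base [2, 1] 0, .good 5 6 2, .move 4 0]),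
  ([(0, -1), (-1, 0), (-1, 0)],
    .dis 2 [1] 0),
  ([(0, -1), (0, 1), (-1, 0)],
    .prp [.base [0, 1, 2] 1, .base [1, 2, 0] 1, .base [0, 1, 0] 2, .base [0] 2, .base [2, 0] 2, .good 3 4 2, .move 2 2, .base [1, 2, 0] 2, .base [0, 1] 0, .base [2, 0, 1] 0, .good 7 8 2, .move 6 0, .good 5 9 1, .move 1 2]),
  ([(0, -1), (0, -1), (-1, 0)],
    .dis 2 [1] 0),
  ([(0, -1), (-1, 1), (-1, 0)],
    .prp [.base [0, 1] 0, .base [] 0, .base [2] 0, .good 1 2 2, .move 0 2, .base [0, 2] 0, .base [1] 0, .good 1 5 1, .move 4 1, .base [1, 2] 0, .base [2, 0] 2, .base [0, 1] 2, .base [0] 2, .good 10 8 2, .move 9 2, .base [] 1, .base [2] 1, .good 12 13 2, .move 11 1, .good 8 14 0, .move 7 2, .base [1, 0] 1, .base [0, 2] 1, .base [0] 1, .good 18 16 1, .move 17 1, .move 19 2, .good 16 20 0, .move 0 1, .good 2 4 0, .move 21 0, .base [2, 1] 0, .good 5 23 2, .move 22 2, .good 15 24 0, .move 6 0]),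
  ([(0, -1), (1, -1), (-1, 0)],
    .dis 2 [1] 0),
  ([(0, -1), (0, 0), (0, -1)],
    .dis 2 [1] 0),
  ([(0, -1), (1, 0), (0, -1)],
    .prp [.base [0, 2, 1] 0, .base [1, 0, 2] 0, .base [0, 2, 1] 2, .base [0, 1] 2, .base [1, 0, 1] 2, .good 3 4 1, .move 2 1, .base [1] 2, .base [2, 1] 2, .good 6 7 2, .move 4 2, .good 5 8 0, .move 1 2]),
  ([(0, -1), (-1, 0), (0, -1)],
    .dis 2 [1] 0),
  ([(0, -1), (0, 1), (0, -1)],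
    .prp [.base [0, 1, 2] 0, .base [0, 1] 0, .base [1, 0, 1] 0, .good 1 2 1, .move 0 1, .base [0, 2, 1] 0, .base [0, 2] 0, .base [2, 0, 2] 0, .good 5 6 2, .move 4 2]),
  ([(0, -1), (0, -1), (0, -1)],
    .dis 2 [1] 0),
  ([(0, -1), (-1, 1), (0, -1)],
    .prp [.base [0, 1, 0] 1, .base [0, 2] 1, .base [1, 0, 2] 1, .good 1 2 1, .move 0 1, .base [0] 1, .base [2, 0] 1, .good 4 5 2, .move 3 2, .base [0, 2, 0] 1, .move 7 1, .base [2] 0, .base [1, 2] 0, .good 9 10 1, .move 8 0, .base [1, 0] 1, .good 4 12 1, .move 11 1]),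
  ([(0, -1), (1, -1), (0, -1)],
    .dis 2 [1] 0),
  ([(0, -1), (0, 0), (1, -1)],
    .prp [.base [0, 1, 0] 1, .base [0, 1] 2, .base [1, 0, 1] 2, .good 1 2 1, .move 0 2, .base [0, 1, 2] 1, .base [1, 2] 1, .base [2, 1, 2] 1, .good 5 6 2, .move 4 2, .base [0, 2] 1, .base [1, 0, 2] 1, .good 8 9 1, .move 7 1]),
  ([(0, -1), (1, 0), (1, -1)],
    .prp [.base [1, 0] 1, .base [] 1, .base [2] 1, .good 1 2 2, .move 0 2, .base [1, 2] 1, .base [] 0, .base [1] 0, .good 5 6 1, .move 4 0, .base [0, 2] 1, .base [2, 1] 2, .base [1, 0] 2, .base [1] 2, .good 11 9 2, .move 10 2, .base [2] 0, .good 5 13 2, .move 12 0, .good 9 14 1, .move 8 2, .base [0, 1] 0, .base [1, 2] 0, .good 6 16 0, .move 17 0, .move 18 2, .good 16 19 1, .move 0 0, .good 2 4 1, .move 20 1, .base [0] 1, .base [2, 0] 1, .good 22 23 2, .move 21 2, .good 15 24 1, .move 7 1]),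
  ([(0, -1), (-1, 0), (1, -1)],
    .dis 1 [2] 0),
  ([(0, -1), (0, 1), (1, -1)],
    .prp [.base [0, 1, 0] 1, .base [] 1, .base [2] 1, .good 1 2 2, .move 0 2, .base [] 0, .base [1] 0, .good 4 5 1, .move 3 0, .base [0, 1, 2] 1, .base [1, 2] 1, .good 2 8 1, .move 7 1, .base [2] 0, .base [1, 2] 0, .good 10 11 1, .move 9 0, .base [0] 1, .base [1, 0] 1, .good 13 14 1, .move 12 1]),
  ([(0, -1), (0, -1), (1, -1)],
    .dis 2 [1] 0),
  ([(0, -1), (-1, 1), (1, -1)],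
    .dis 2 [1] 0),
  ([(0, -1), (1, -1), (1, -1)],
    .prp [.base [0, 1, 0] 2, .base [0, 1] 2, .base [2, 0, 1] 2, .good 1 2 2, .move 0 2, .base [1] 0, .base [2, 1] 0, .good 4 5 2, .move 3 0, .base [0, 2, 0] 2, .move 7 2, .base [0] 1, .base [2, 0] 1, .good 9 10 2, .move 8 1, .base [0] 2, .base [2, 0] 2, .good 12 13 2, .move 11 2])]

def tabQ : List (List Zp × Cert) := [
  ([(0, -1), (0, 0), (-1, 0), (0, 0), (0, 0), (0, -1)],
    .dis 3 [2, 1] 0),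
  ([(0, -1), (0, 0), (-1, 0), (0, 0), (0, 0), (1, -1)],
    .prp [.base [0, 1, 2, 3] 2, .base [] 1, .base [2] 1, .good 1 2 2, .move 0 1, .base [1, 0, 2, 1] 0, .base [2, 1, 0, 1] 0, .base [] 0, .base [1] 0, .good 6 7 1, .move 5 1, .good 4 8 2, .move 3 0, .base [2, 3] 2, .base [3, 2, 3] 2, .good 10 11 3, .move 9 3, .base [1, 0, 2, 1] 2, .base [3] 2, .good 14 10 2, .move 13 2, .base [1, 3, 2] 3, .base [2, 1, 3, 2] 3, .good 16 17 2, .move 15 3, .base [1] 2, .base [2, 1] 2, .good 19 20 2, .move 18 2]),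
  ([(0, -1), (0, 0), (-1, 0), (-1, 0), (0, 0), (0, 0)],
    .dis 1 [0, 3, 2, 1] 0),
  ([(0, -1), (0, 0), (-1, 0), (-1, 0), (0, 0), (1, 0)],
    .prp [.base [0, 1, 0] 1, .base [0, 2] 1, .base [1, 0, 2] 1, .good 1 2 1, .move 0 1, .base [2] 1, .base [3, 2] 1, .good 4 5 3, .move 3 3, .base [1, 3, 2] 1, .base [] 1, .good 8 4 2, .move 7 2, .base [2, 1, 3] 0, .base [1, 2, 3] 0, .base [1] 0, .base [2, 1] 0, .good 12 13 2, .move 11 2, .good 10 14 1, .move 9 0]),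
  ([(0, -1), (0, 0), (-1, 0), (-1, 0), (0, 0), (-1, 0)],
    .dis 3 [2, 1] 0),
  ([(0, -1), (0, 0), (-1, 0), (-1, 0), (0, 0), (0, 1)],
    .prp [.base [0, 1, 2] 3, .base [0] 3, .base [3, 0] 3, .good 1 2 3, .move 0 3, .base [1, 3, 0] 3, .base [] 2, .base [3] 2, .good 5 6 3, .move 4 2, .base [0, 1, 3] 0, .base [3, 0, 1] 0, .base [3] 0, .base [0, 3] 0, .good 10 11 0, .move 9 0, .good 8 12 3, .move 7 0]),
  ([(0, -1), (0, 0), (-1, 0), (-1, 0), (0, 0), (0, -1)],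
    .dis 3 [2, 1] 0),
  ([(0, -1), (0, 0), (-1, 0), (-1, 0), (0, 0), (-1, 1)],
    .nul [(1, 1), (1, 1), (1, 0), (1, 0)]),
  ([(0, -1), (0, 0), (-1, 0), (-1, 0), (0, 0), (1, -1)],
    .dis 2 [3, 1] 0),
  ([(0, -1), (0, 0), (-1, 0), (0, 0), (-1, 0), (0, 0)],
    .dis 3 [1, 2, 0] 1),
  ([(0, -1), (0, 0), (-1, 0), (0, 0), (-1, 0), (1, 0)],
    .prp [.base [1, 2] 1, .base [] 1, .base [3] 1, .good 1 2 3, .move 0 3, .base [1, 3] 1, .base [2] 1, .good 1 5 2, .move 4 2]),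
  ([(0, -1), (0, 0), (-1, 0), (0, 0), (-1, 0), (-1, 0)],
    .dis 3 [2, 1] 0),
  ([(0, -1), (0, 0), (-1, 0), (0, 0), (-1, 0), (0, 1)],
    .prp [.base [2, 1, 3] 1, .base [2] 1, .base [3, 2] 1, .good 1 2 3, .move 0 3, .base [3, 1, 2] 1, .base [3] 1, .base [2, 3] 1, .good 5 6 2, .move 4 2]),
  ([(0, -1), (0, 0), (-1, 0), (0, 0), (-1, 0), (0, -1)],
    .dis 3 [2] 1),
  ([(0, -1), (0, 0), (-1, 0), (0, 0), (-1, 0), (-1, 1)],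
    .dis 3 [2] 1),
  ([(0, -1), (0, 0), (-1, 0), (0, 0), (-1, 0), (1, -1)],
    .dis 3 [2, 1] 0)]

def tabV : List (List Zp × Cert) := [
  ([(0, -1), (0, 0), (-1, 0), (0, 0), (0, 0), (-1, 0), (0, 0), (0, 0), (0, 0), (-1, 0)],
    .dis 4 [3, 2, 1, 0, 1, 2, 3, 0, 1, 2, 0] 1),
  ([(0, -1), (0, 0), (-1, 0), (0, 0), (0, 0), (-1, 0), (0, 0), (0, 0), (0, 0), (0, -1)],
    .dis 4 [3, 2, 1] 0),
  ([(0, -1), (0, 0), (-1, 0), (0, 0), (0, 0), (-1, 0), (0, 0), (0, 0), (0, 0), (1, -1)],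
    .nul [(2, 3), (2, 4), (1, 3), (0, 2), (1, 0)]),
  ([(0, -1), (0, 0), (-1, 0), (0, 0), (0, 0), (-1, 0), (0, 0), (0, 0), (-1, 0), (0, 0)],
    .dis 4 [2, 3, 1, 2, 0] 1),
  ([(0, -1), (0, 0), (-1, 0), (0, 0), (0, 0), (-1, 0), (0, 0), (0, 0), (-1, 0), (1, 0)],
    .dis 4 [2, 1, 0, 1, 2, 3, 0, 1, 2, 0] 1),
  ([(0, -1), (0, 0), (-1, 0), (0, 0), (0, 0), (-1, 0), (0, 0), (0, 0), (-1, 0), (-1, 0)],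
    .dis 4 [3, 2, 1] 0),
  ([(0, -1), (0, 0), (-1, 0), (0, 0), (0, 0), (-1, 0), (0, 0), (0, 0), (-1, 0), (0, 1)],
    .nul [(1, 2), (2, 2), (2, 1), (1, 0), (1, 0)]),
  ([(0, -1), (0, 0), (-1, 0), (0, 0), (0, 0), (-1, 0), (0, 0), (0, 0), (-1, 0), (0, -1)],
    .dis 4 [3] 2),
  ([(0, -1), (0, 0), (-1, 0), (0, 0), (0, 0), (-1, 0), (0, 0), (0, 0), (-1, 0), (-1, 1)],
    .dis 4 [3] 2),
  ([(0, -1), (0, 0), (-1, 0), (0, 0), (0, 0), (-1, 0), (0, 0), (0, 0), (-1, 0), (1, -1)],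
    .dis 4 [3, 2, 1] 0),
  ([(0, -1), (0, 0), (-1, 0), (0, 0), (0, 0), (-1, 0), (0, 0), (-1, 0), (0, 0), (0, 0)],
    .dis 4 [1, 2, 0] 1),
  ([(0, -1), (0, 0), (-1, 0), (0, 0), (0, 0), (-1, 0), (0, 0), (-1, 0), (0, 0), (1, 0)],
    .dis 4 [1, 2, 0] 1),
  ([(0, -1), (0, 0), (-1, 0), (0, 0), (0, 0), (-1, 0), (0, 0), (-1, 0), (0, 0), (-1, 0)],
    .dis 4 [3, 2, 1] 0),
  ([(0, -1), (0, 0), (-1, 0), (0, 0), (0, 0), (-1, 0), (0, 0), (-1, 0), (0, 0), (0, 1)],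
    .dis 3 [4, 1] 0),
  ([(0, -1), (0, 0), (-1, 0), (0, 0), (0, 0), (-1, 0), (0, 0), (-1, 0), (0, 0), (0, -1)],
    .dis 3 [4, 1] 0),
  ([(0, -1), (0, 0), (-1, 0), (0, 0), (0, 0), (-1, 0), (0, 0), (-1, 0), (0, 0), (-1, 1)],
    .dis 4 [3, 2] 1),
  ([(0, -1), (0, 0), (-1, 0), (0, 0), (0, 0), (-1, 0), (0, 0), (-1, 0), (0, 0), (1, -1)],
    .dis 4 [3, 2, 1] 0),
  ([(0, -1), (0, 0), (-1, 0), (0, 0), (0, 0), (-1, 0), (-1, 0), (0, 0), (0, 0), (0, 0)],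
    .dis 1 [0, 4, 2, 1] 0),
  ([(0, -1), (0, 0), (-1, 0), (0, 0), (0, 0), (-1, 0), (-1, 0), (0, 0), (0, 0), (1, 0)],
    .dis 1 [0, 4, 2, 1] 0),
  ([(0, -1), (0, 0), (-1, 0), (0, 0), (0, 0), (-1, 0), (-1, 0), (0, 0), (0, 0), (-1, 0)],
    .dis 4 [3, 2, 1] 0),
  ([(0, -1), (0, 0), (-1, 0), (0, 0), (0, 0), (-1, 0), (-1, 0), (0, 0), (0, 0), (0, 1)],
    .dis 3 [4, 0] 1),
  ([(0, -1), (0, 0), (-1, 0), (0, 0), (0, 0), (-1, 0), (-1, 0), (0, 0), (0, 0), (0, -1)],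
    .dis 3 [4, 0] 1),
  ([(0, -1), (0, 0), (-1, 0), (0, 0), (0, 0), (-1, 0), (-1, 0), (0, 0), (0, 0), (-1, 1)],
    .dis 1 [0, 4, 2, 1] 0),
  ([(0, -1), (0, 0), (-1, 0), (0, 0), (0, 0), (-1, 0), (-1, 0), (0, 0), (0, 0), (1, -1)],
    .dis 3 [4, 2, 1] 0)]

set_option maxRecDepth 100000 in
theorem tabT_ok : tabT.all (fun p => chk 3 p.1 p.2) = true := by decide +kernel
set_option maxRecDepth 100000 in
theorem tabQ_ok : tabQ.all (fun p => chk 4 p.1 p.2) = true := by decide +kernel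
set_option maxRecDepth 100000 in
theorem tabV_ok : tabV.all (fun p => chk 5 p.1 p.2) = true := by decide +kernel

def pm7 : List Zp := [(0, 0), (1, 0), (-1, 0), (0, 1), (0, -1), (-1, 1), (1, -1)]
def neg3 : List Zp := [(-1, 0), (0, -1), (1, -1)]

theorem typT : ∀ bc ∈ neg3, ∀ ac ∈ pm7, (ac = (0, 0) ∧ bc = (-1, 0)) ∨
    tabT.any (fun p => decide (p.1 = [(0, -1), ac, bc])) = true := by decide +kernel
theorem typQ : ∀ ab ∈ [(((0, 0) : Zp), ((0, 0) : Zp)), ((-1, 0), (0, 0)), ((0, 0), (-1, 0))], ∀ cd ∈ pm7,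
    (ab = ((0, 0), (0, 0)) ∧ cd ∉ neg3) ∨ (ab = ((0, 0), (0, 0)) ∧ cd = (-1, 0)) ∨
    tabQ.any (fun p => decide (p.1 = [(0, -1), (0, 0), (-1, 0), ab.1, ab.2, cd])) = true := by decide +kernel
theorem typV : ∀ abc ∈ [(((0, 0) : Zp), ((0, 0) : Zp), ((0, 0) : Zp)), ((-1, 0), (0, 0), (0, 0)),
      ((0, 0), (-1, 0), (0, 0)), ((0, 0), (0, 0), (-1, 0))], ∀ d ∈ pm7,
    (abc = ((0, 0), (0, 0), (0, 0)) ∧ d ∉ neg3) ∨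
    tabV.any (fun p => decide (p.1 = [(0, -1), (0, 0), (-1, 0), (0, 0), (0, 0), (-1, 0), abc.1, abc.2.1, abc.2.2, d])) = true := by
  decide +kernel
end CoxeterRootSystem
end

open Pointwise RealInnerProductSpace
noncomputable section
namespace CoxeterRootSystem
variable {V : Type} [NormedAddCommGroup V] [InnerProductSpace ℝ V] {D : CoxeterRootSystem V}

/-- golden values -/
def Gol (c : ℝ) : Prop := 4 * c ^ 2 = 2 * c + 1 ∨ 4 * c ^ 2 = -2 * c + 1

theorem Gol.neg {c : ℝ} (h : Gol c) : Gol (-c) := by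
  rcases h with h | h
  · right; linarith [h, neg_sq c]
  · left; linarith [h, neg_sq c]

theorem Gol.explicit {c φ : ℝ} (hφ : φ ^ 2 = φ + 1) (h : Gol c) :
    c = φ / 2 ∨ c = -φ / 2 ∨ c = (φ - 1) / 2 ∨ c = (1 - φ) / 2 := by
  rcases h with h | h
  · rcases gold_root hφ h with h | h
    · exact Or.inl h
    · exact Or.inr (Or.inr (Or.inr h))
  · have h' : 4 * (-c) ^ 2 = 2 * (-c) + 1 := by linarith [neg_sq c]
    rcases gold_root hφ h' with h | h
    · right; left; linarith
    · right; right; left; linarith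

theorem gol_of_explicit {c φ : ℝ} (hφ : φ ^ 2 = φ + 1)
    (h : c = φ / 2 ∨ c = -φ / 2 ∨ c = (φ - 1) / 2 ∨ c = (1 - φ) / 2) : Gol c := by
  rcases h with rfl | rfl | rfl | rfl
  · left; linear_combination hφ
  · right; linear_combination hφ
  · right; linear_combination hφ
  · left; linear_combination hφ

set_option maxHeartbeats 4000000 in
theorem no_diff {φ r z1 z2 d : ℝ} (h1 : 1.618 < φ) (h2 : φ < 1.6181) (h3 : 0.7071 < r) (h4 : r < 0.70711)
    (hz1 : AlwE φ r z1) (hz2 : AlwE φ r z2) (hd : z1 - z2 = d)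
    (hb : (1.14 < d ∧ d < 1.15) ∨ (0.43 < d ∧ d < 0.44)) : False := by
  rcases hb with ⟨b1, b2⟩ | ⟨b1, b2⟩ <;>
  rcases hz1 with rfl | rfl | rfl | rfl | rfl | rfl | rfl | rfl | rfl | rfl | rfl <;>
  rcases hz2 with rfl | rfl | rfl | rfl | rfl | rfl | rfl | rfl | rfl | rfl | rfl <;> linarith

theorem no_mix_num {z1 z2 c d : ℝ} (hz1 : Alw z1) (hz2 : Alw z2) (hc : Gol c) (hd : 2 * d ^ 2 = 1)
    (h : z1 - z2 = 2 * d * c) : False := by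
  have hφ := Real.goldenRatio_sq
  have hr : √(1/2 : ℝ) ^ 2 = 1/2 := Real.sq_sqrt (by norm_num)
  obtain ⟨h1, h2⟩ := gold_bounds
  obtain ⟨h3, h4⟩ := rhalf_bounds
  have e1 := hz1.explicit hφ hr
  have e2 := hz2.explicit hφ hr
  have ec := hc.explicit hφ
  have ed : d = √(1/2 : ℝ) ∨ d = -√(1/2 : ℝ) := by
    apply sq_eq_sq_iff_eq_or_eq_neg.1; linarith
  generalize Real.goldenRatio = φ at *
  generalize √(1/2 : ℝ) = r at *
  have b1 : 1.14 < r * φ := by nlinarith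
  have b2 : r * φ < 1.15 := by nlinarith
  have b3 : 0.43 < r * (φ - 1) := by nlinarith
  have b4 : r * (φ - 1) < 0.44 := by nlinarith
  have P := fun d => no_diff (d := d) h1 h2 h3 h4 e1 e2
  have N := fun d => no_diff (d := d) h1 h2 h3 h4 e2 e1
  have h' : z2 - z1 = -(2 * d * c) := by linarith
  rcases ed with rfl | rfl <;> rcases ec with rfl | rfl | rfl | rfl
  · exact P _ h (Or.inl ⟨by linarith, by linarith⟩)
  · exact N _ h' (Or.inl ⟨by linarith, by linarith⟩)
  · exact P _ h (Or.inr ⟨by linarith, by linarith⟩)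
  · exact N _ h' (Or.inr ⟨by linarith, by linarith⟩)
  · exact N _ h' (Or.inl ⟨by linarith, by linarith⟩)
  · exact P _ h (Or.inl ⟨by linarith, by linarith⟩)
  · exact N _ h' (Or.inr ⟨by linarith, by linarith⟩)
  · exact P _ h (Or.inr ⟨by linarith, by linarith⟩)

theorem gol_step_num {z z' c : ℝ} (hz1 : Alw z) (hz2 : Alw z') (hc : Gol c)
    (h : z - z' = c) : Gol z ∨ Gol z' := by
  have hφ := Real.goldenRatio_sq
  have hr : √(1/2 : ℝ) ^ 2 = 1/2 := Real.sq_sqrt (by norm_num)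
  obtain ⟨h1, h2⟩ := gold_bounds
  obtain ⟨h3, h4⟩ := rhalf_bounds
  have e1 := hz1.explicit hφ hr
  have e2 := hz2.explicit hφ hr
  have ec := hc.explicit hφ
  have main : ∀ z : ℝ, Alw z → Gol z ∨ (z = 0 ∨ z = 1 ∨ z = -1 ∨ z = 1/2 ∨ z = -1/2 ∨ z = √(1/2 : ℝ) ∨ z = -√(1/2 : ℝ)) := by
    intro z hz
    rcases hz.explicit hφ hr with h | h | h | h | h | h | h | h | h | h | h
    iterate 7 (right; tauto)
    all_goals (left; exact gol_of_explicit hφ (by tauto))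
  rcases main z hz1 with g | g1
  · exact Or.inl g
  rcases main z' hz2 with g | g2
  · exact Or.inr g
  exfalso
  clear main e1 e2 hz1 hz2 hc
  generalize Real.goldenRatio = φ at *
  generalize √(1/2 : ℝ) = r at *
  rcases ec with rfl | rfl | rfl | rfl <;>
  rcases g1 with rfl | rfl | rfl | rfl | rfl | rfl | rfl <;>
  rcases g2 with rfl | rfl | rfl | rfl | rfl | rfl | rfl <;> linarith

section
variable {s0 : D.W}

theorem crt_alw (HA : ∀ y ∈ D.S, D.Cmp s0 y → ∀ β γ, D.RtOf y β → D.Rt γ → Alw ⟪β, γ⟫) {β γ : V}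
    (hβ : D.CRt s0 β) (hγ : D.CRt s0 γ) : Alw ⟪β, γ⟫ := by
  obtain ⟨y, hy, hc, h⟩ := hβ
  exact HA y hy hc β γ h hγ.rt

def GoldV (D : CoxeterRootSystem V) (s0 : D.W) (β : V) : Prop := D.CRt s0 β ∧ ∃ γ, D.CRt s0 γ ∧ Gol ⟪β, γ⟫

theorem GoldV.act {β : V} (h : D.GoldV s0 β) (u : D.W) : D.GoldV s0 (D.ρ u β) := by
  obtain ⟨h1, γ, h2, h3⟩ := h
  exact ⟨h1.act u, _, h2.act u, by rwa [rho_inner]⟩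

theorem GoldV.no_mix (HA : ∀ y ∈ D.S, D.Cmp s0 y → ∀ β γ, D.RtOf y β → D.Rt γ → Alw ⟪β, γ⟫) {β δ : V}
    (h : D.GoldV s0 β) (hδ : D.CRt s0 δ) : ¬ 2 * ⟪β, δ⟫ ^ 2 = 1 := by
  intro hd
  obtain ⟨h1, γ, h2, h3⟩ := h
  have a1 := crt_alw HA hδ h2
  have a2 := crt_alw HA (h1.reflect hδ) h2
  refine no_mix_num a1 a2 h3 hd ?_
  rw [inner_sub_left, real_inner_smul_left]; ring

theorem GoldV.step (HA : ∀ y ∈ D.S, D.Cmp s0 y → ∀ β γ, D.RtOf y β → D.Rt γ → Alw ⟪β, γ⟫) {β δ : V}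
    (h : D.GoldV s0 β) (hδ : D.CRt s0 δ) (hne : ⟪β, δ⟫ ≠ 0) (hne1 : β ≠ δ) (hne2 : β ≠ -δ) : D.GoldV s0 δ := by
  have hno := h.no_mix HA hδ
  obtain ⟨h1, γ, h2, h3⟩ := h
  refine ⟨hδ, ?_⟩
  have hh := crt_alw HA h1 hδ
  have key : ∀ h : ℝ, (h = 1 ∨ h = -1) → 2 * ⟪β, δ⟫ = h → ∃ γ, D.CRt s0 γ ∧ Gol ⟪δ, γ⟫ := by
    intro h hp e
    have a1 := crt_alw HA hδ h2
    have a2 := crt_alw HA hδ (h1.reflect h2)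
    have e2 : ⟪δ, γ⟫ - ⟪δ, γ - (2 * ⟪β, γ⟫) • β⟫ = h * ⟪β, γ⟫ := by
      rw [inner_sub_right, real_inner_smul_right, ← e, real_inner_comm β δ]; ring
    have g3 : Gol (h * ⟪β, γ⟫) := by
      rcases hp with rfl | rfl
      · simpa using h3
      · simpa using h3.neg
    rcases gol_step_num a1 a2 g3 e2 with g | g
    · exact ⟨_, h2, g⟩
    · exact ⟨_, h1.reflect h2, g⟩
  rcases hh with h | h | h | h | h | h | h | h
  · exact absurd h hne
  · exact absurd (rt_eq_of_inner h1.rt hδ.rt h) hne1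
  · exact absurd (rt_eq_of_inner h1.rt hδ.rt.neg (by rw [inner_neg_right, h]; norm_num)) hne2
  · exact key 1 (Or.inl rfl) h
  · exact key (-1) (Or.inr rfl) h
  · exact absurd h hno
  · exact ⟨β, h1, Or.inl (by rw [real_inner_comm]; exact h)⟩
  · exact ⟨β, h1, Or.inr (by rw [real_inner_comm]; exact h)⟩

theorem goldV_all (HA : ∀ y ∈ D.S, D.Cmp s0 y → ∀ β γ, D.RtOf y β → D.Rt γ → Alw ⟪β, γ⟫) {a : D.W}
    (hca : D.Cmp s0 a) (hg : D.GoldV s0 (D.e a)) {β : V} (hβ : D.CRt s0 β) : D.GoldV s0 β := by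
  have key : ∀ y, D.Cmp a y → D.GoldV s0 (D.e y) := by
    intro y hy
    induction hy with
    | refl => exact hg
    | @tail b c hb hc ih =>
      by_cases hbc : c = b
      · rwa [hbc]
      obtain ⟨h1, h2⟩ := e_ne_e hc.1 hc.2.1 hbc
      exact ih.step HA (crt_e hc.2.1 (Cmp.step (Relation.ReflTransGen.trans hca hb) hc.1 hc.2.1 hc.2.2)) hc.2.2 h1 h2
  obtain ⟨y, hy, hc, u, rfl⟩ := hβ
  exact (key y (Relation.ReflTransGen.trans hca.symm hc)).act u

theorem hf_of_alw {x c : ℝ} (hx : x ^ 2 = x + 1) (h : Alw c) (hn : ¬ 2 * c ^ 2 = 1) : Hf x c := by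
  have mk : ∀ z ∈ allowed, 2 * c = ev x z → Hf x c := fun z h1 h2 => ⟨z, h1, h2⟩
  have G : Gol c → Hf x c := by
    intro hg
    rcases hg.explicit hx with h | h | h | h
    · exact mk (0, 1) (by decide) (by rw [h]; simp [ev]; ring)
    · exact mk (0, -1) (by decide) (by rw [h]; simp [ev]; ring)
    · exact mk (-1, 1) (by decide) (by rw [h]; simp [ev]; ring)
    · exact mk (1, -1) (by decide) (by rw [h]; simp [ev]; ring)
  rcases h with h | h | h | h | h | h | h | h
  · exact mk (0, 0) (by decide) (by rw [h]; simp [ev])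
  · exact mk (2, 0) (by decide) (by rw [h]; simp [ev])
  · exact mk (-2, 0) (by decide) (by rw [h]; simp [ev])
  · exact mk (1, 0) (by decide) (by rw [h]; simp [ev])
  · exact mk (-1, 0) (by decide) (by rw [h]; simp [ev])
  · exact absurd h hn
  · exact G (Or.inl h)
  · exact G (Or.inr h)

theorem hf_all (HA : ∀ y ∈ D.S, D.Cmp s0 y → ∀ β γ, D.RtOf y β → D.Rt γ → Alw ⟪β, γ⟫) {a : D.W}
    (hca : D.Cmp s0 a) (hg : D.GoldV s0 (D.e a)) {x : ℝ} (hx : x ^ 2 = x + 1) (β γ : V) (hβ : D.CRt s0 β)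
    (hγ : D.CRt s0 γ) : Hf x ⟪β, γ⟫ :=
  hf_of_alw hx (crt_alw HA hβ hγ) ((goldV_all HA hca hg hβ).no_mix HA hγ)

end
end CoxeterRootSystem
end

open Pointwise RealInnerProductSpace
noncomputable section
namespace CoxeterRootSystem
variable {V : Type} [NormedAddCommGroup V] [InnerProductSpace ℝ V] {D : CoxeterRootSystem V}

theorem comm_of_root {s t : D.W} (hs : s ∈ D.S) (ht : t ∈ D.S) {u : D.W}
    (h : D.ρ u (D.e s) = D.e t ∨ D.ρ u (D.e s) = - D.e t) : t * u = u * s := by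
  have : t = u * s * u⁻¹ := by
    apply W_ext
    intro x _
    rw [rho_conj_gen hs, D.rho_gen ht]
    rcases h with h | h <;> rw [h]
    simp
  rw [this]; group

/-! ### Sets of positive roots -/

section tau
variable {p : D.W × Bool} {T : V → Prop}

theorem fv_flip (y : D.W) (b : Bool) : D.fv (y, !b) = - D.fv (y, b) := by cases b <;> simp [fv]

theorem rho_fv_eq {u t : D.W} (h : D.ρ u (D.fv p) = D.e t ∨ D.ρ u (D.fv p) = - D.e t) :
    D.ρ u (D.e p.1) = D.e t ∨ D.ρ u (D.e p.1) = - D.e t := by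
  obtain ⟨s, b⟩ := p
  cases b
  · simp only [fv, Bool.false_eq_true, if_false, map_neg, neg_inj] at h ⊢
    rcases h with h | h
    · right; rw [← h, neg_neg]
    · left; exact h
  · simpa [fv] using h

theorem tau_word (hp : p.1 ∈ D.S) (h0 : T (D.fv p))
    (hcl : ∀ γ, T γ → ∀ t ∈ D.S, T (D.ρ t γ) ∨ γ = D.e t ∨ γ = - D.e t) (l : List D.W)
    (hl : ∀ y ∈ l, y ∈ D.S) (hn : ¬ T (D.ρ l.prod (D.fv p))) :
    ∃ l' : List D.W, (∀ y ∈ l', y ∈ D.S) ∧ l'.prod = l.prod * p.1 ∧ l'.length + 1 = l.length := by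
  induction l with
  | nil => simp only [List.prod_nil, rho_one] at hn; exact absurd h0 hn
  | cons a l ih =>
    have hl' : ∀ y ∈ l, y ∈ D.S := fun y hy => hl y (by simp [hy])
    have ha : a ∈ D.S := hl a (by simp)
    by_cases h : T (D.ρ l.prod (D.fv p))
    · rw [List.prod_cons, rho_mul] at hn
      rcases hcl _ h a ha with h1 | h1
      · exact absurd h1 hn
      · have := comm_of_root hp ha (rho_fv_eq h1)
        refine ⟨l, hl', ?_, by simp⟩
        rw [List.prod_cons, this, mul_assoc, D.hS_inv _ hp, mul_one]
    · obtain ⟨l', h1, h2, h3⟩ := ih hl' h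
      refine ⟨a :: l', ?_, ?_, by simp [h3]⟩
      · intro y hy
        rcases List.mem_cons.1 hy with rfl | hy
        · exact ha
        · exact h1 y hy
      · rw [List.prod_cons, h2, List.prod_cons, mul_assoc]

theorem tau_pos (hp : p.1 ∈ D.S) (h0 : T (D.fv p))
    (hcl : ∀ γ, T γ → ∀ t ∈ D.S, T (D.ρ t γ) ∨ γ = D.e t ∨ γ = - D.e t)
    {γ : V} (hγ : D.RtOf p.1 γ) (hpos : D.PosF p γ) : T γ := by
  have hex : ∃ u, γ = D.ρ u (D.fv p) := by
    obtain ⟨u, rfl⟩ := hγ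
    obtain ⟨s, b⟩ := p
    cases b
    · exact ⟨u * s, by simp only [fv, Bool.false_eq_true, if_false]; rw [rho_mul, map_neg, D.rho_gen_e hp, neg_neg]⟩
    · exact ⟨u, by simp [fv]⟩
  obtain ⟨u, rfl⟩ := hex
  by_contra hn
  have hlen : D.len (u * p.1) = D.len u + 1 := by
    rw [← D.pos_iff hp]
    obtain ⟨s, b⟩ := p
    cases b <;> simpa [PosF, fv] using hpos
  obtain ⟨l, hl, hll, rfl⟩ := D.exists_reduced u
  obtain ⟨l', h1, h2, h3⟩ := tau_word hp h0 hcl l hl hn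
  have := D.len_le h1 h2
  omega

theorem tau_star (hp : p.1 ∈ D.S) (h0 : T (D.fv p))
    (hcl : ∀ γ, T γ → ∀ t ∈ D.S, T (D.ρ t γ) ∨ γ = D.e t ∨ γ = - D.e t)
    (hneg : ∀ γ, T γ → ¬ T (-γ)) {t : D.W} (ht : t ∈ D.S) : D.Star p.1 t := by
  have key : ∀ γ, D.RtOf p.1 γ → (D.PosF p γ ↔ T γ) := by
    intro γ hγ
    refine ⟨tau_pos hp h0 hcl hγ, fun h => ?_⟩
    by_contra hn
    exact hneg γ h (tau_pos hp h0 hcl (hγ.neg hp) ((posF_neg hp hγ).2 hn))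
  apply star_of_good hp ht
  intro γ hγ hn1 hn2
  rw [posF_good hp hγ, key γ hγ, key _ (hγ.act t)]
  have htt : D.ρ t (D.ρ t γ) = γ := by rw [← rho_mul, D.hS_inv t ht, rho_one]
  constructor
  · intro h
    rcases hcl γ h t ht with h | h | h
    · exact h
    · exact absurd h hn1
    · exact absurd h hn2
  · intro h
    rcases hcl _ h t ht with h | h | h
    · rwa [htt] at h
    · exfalso; apply hn2; rw [← htt, h, D.rho_gen_e ht]
    · exfalso; apply hn1; rw [← htt, h, map_neg, D.rho_gen_e ht, neg_neg]

end tau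

def tabH3 : List (List Zp) := [
  [(1, 0), (0, 0), (0, 0)],
  [(0, 0), (1, 0), (0, 0)],
  [(0, 0), (0, 0), (1, 0)],
  [(1, 0), (0, 1), (0, 0)],
  [(0, 1), (1, 0), (0, 0)],
  [(0, 0), (1, 0), (1, 0)],
  [(0, 1), (0, 1), (0, 0)],
  [(1, 0), (0, 1), (0, 1)],
  [(0, 1), (1, 0), (1, 0)],
  [(0, 1), (0, 1), (0, 1)],
  [(0, 1), (1, 1), (1, 0)],
  [(0, 1), (1, 1), (0, 1)],
  [(1, 1), (1, 1), (1, 0)],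
  [(1, 1), (1, 1), (0, 1)],
  [(1, 1), (0, 2), (0, 1)]]

def tabH4 : List (List Zp) := [
  [(1, 0), (0, 0), (0, 0), (0, 0)],
  [(0, 0), (1, 0), (0, 0), (0, 0)],
  [(0, 0), (0, 0), (1, 0), (0, 0)],
  [(0, 0), (0, 0), (0, 0), (1, 0)],
  [(1, 0), (0, 1), (0, 0), (0, 0)],
  [(0, 1), (1, 0), (0, 0), (0, 0)],
  [(0, 0), (1, 0), (1, 0), (0, 0)],
  [(0, 0), (0, 0), (1, 0), (1, 0)],
  [(0, 1), (0, 1), (0, 0), (0, 0)],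
  [(1, 0), (0, 1), (0, 1), (0, 0)],
  [(0, 1), (1, 0), (1, 0), (0, 0)],
  [(0, 0), (1, 0), (1, 0), (1, 0)],
  [(0, 1), (0, 1), (0, 1), (0, 0)],
  [(1, 0), (0, 1), (0, 1), (0, 1)],
  [(0, 1), (1, 1), (1, 0), (0, 0)],
  [(0, 1), (1, 0), (1, 0), (1, 0)],
  [(0, 1), (1, 1), (0, 1), (0, 0)],
  [(0, 1), (0, 1), (0, 1), (0, 1)],
  [(1, 1), (1, 1), (1, 0), (0, 0)],
  [(0, 1), (1, 1), (1, 0), (1, 0)],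
  [(1, 1), (1, 1), (0, 1), (0, 0)],
  [(0, 1), (1, 1), (0, 1), (0, 1)],
  [(1, 1), (1, 1), (1, 0), (1, 0)],
  [(0, 1), (1, 1), (1, 1), (1, 0)],
  [(1, 1), (0, 2), (0, 1), (0, 0)],
  [(1, 1), (1, 1), (0, 1), (0, 1)],
  [(0, 1), (1, 1), (1, 1), (0, 1)],
  [(1, 1), (1, 1), (1, 1), (1, 0)],
  [(1, 1), (0, 2), (0, 1), (0, 1)],
  [(1, 1), (1, 1), (1, 1), (0, 1)],
  [(1, 1), (1, 2), (1, 1), (1, 0)],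
  [(1, 1), (0, 2), (0, 2), (0, 1)],
  [(1, 1), (1, 2), (1, 1), (0, 1)],
  [(1, 2), (1, 2), (1, 1), (1, 0)],
  [(1, 1), (1, 2), (0, 2), (0, 1)],
  [(1, 2), (1, 2), (1, 1), (0, 1)],
  [(1, 2), (2, 2), (1, 1), (1, 0)],
  [(1, 2), (1, 2), (0, 2), (0, 1)],
  [(1, 2), (2, 2), (1, 1), (0, 1)],
  [(1, 2), (2, 2), (2, 1), (1, 0)],
  [(1, 2), (1, 3), (0, 2), (0, 1)],
  [(1, 2), (2, 2), (1, 2), (0, 1)],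
  [(1, 2), (2, 2), (2, 1), (1, 1)],
  [(2, 2), (1, 3), (0, 2), (0, 1)],
  [(1, 2), (1, 3), (1, 2), (0, 1)],
  [(1, 2), (2, 2), (1, 2), (1, 1)],
  [(2, 2), (1, 3), (1, 2), (0, 1)],
  [(1, 2), (1, 3), (1, 2), (1, 1)],
  [(2, 2), (2, 3), (1, 2), (0, 1)],
  [(2, 2), (1, 3), (1, 2), (1, 1)],
  [(1, 3), (2, 3), (1, 2), (0, 1)],
  [(2, 2), (2, 3), (1, 2), (1, 1)],
  [(1, 3), (2, 3), (1, 2), (1, 1)],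
  [(2, 2), (2, 3), (2, 2), (1, 1)],
  [(1, 3), (2, 3), (2, 2), (1, 1)],
  [(1, 3), (3, 3), (2, 2), (1, 1)],
  [(2, 3), (3, 3), (2, 2), (1, 1)],
  [(2, 3), (2, 4), (2, 2), (1, 1)],
  [(2, 3), (2, 4), (1, 3), (1, 1)],
  [(2, 3), (2, 4), (1, 3), (0, 2)]]

def closedTab (n : ℕ) (E : List Zp) (tab : List (List Zp)) : Bool :=
  (List.range n).all (fun i => decide (bas n i ∈ tab)) &&
  tab.all (fun v => decide (v.length = n) && decide (v.map zneg ∉ tab) &&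
    (List.range n).all (fun i => decide (v = bas n i) || decide (rf E i v ∈ tab)))

set_option maxRecDepth 100000 in
theorem tabH3_ok : closedTab 3 [(0, -1), (0, 0), (-1, 0)] tabH3 = true := by decide +kernel
set_option maxRecDepth 100000 in
theorem tabH4_ok : closedTab 4 [(0, -1), (0, 0), (-1, 0), (0, 0), (0, 0), (-1, 0)] tabH4 = true := by decide +kernel

section
variable {s0 : D.W} {x : ℝ} {L : List (D.W × Bool)} {E : List Zp}

theorem Itp.inC_vec (I : Itp D s0 x L E) (l : List Zp) : D.InC s0 (D.vec x L l) := by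
  have key : ∀ (L' : List (D.W × Bool)) (l : List Zp), (∀ p ∈ L', p ∈ L) → D.InC s0 (D.vec x L' l) := by
    intro L'
    induction L' with
    | nil => intro l _ t _ _; simp [vec]
    | cons p L' ih =>
      intro l hp t ht hn
      cases l with
      | nil => simp [vec]
      | cons c l =>
        have h1 := ih l (fun q hq => hp q (by simp [hq])) t ht hn
        obtain ⟨m1, m2⟩ := I.hL p (hp p (by simp))
        have h2 := (rtOf_fv m1).inC m1 m2 t ht hn
        simp only [vec, inner_add_left, real_inner_smul_left, h1, h2]; simp
  exact key L l (fun _ h => h)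

theorem Itp.star_tab (I : Itp D s0 x L E) (hcov : ∀ y ∈ D.S, D.Cmp s0 y → y ∈ L.map Prod.fst) (hs : s0 ∈ D.S)
    {tab : List (List Zp)} (h : closedTab L.length E tab = true) {t : D.W} (ht : t ∈ D.S) : D.Star s0 t := by
  simp only [closedTab, Bool.and_eq_true, List.all_eq_true, List.mem_range, decide_eq_true_eq, Bool.or_eq_true] at h
  obtain ⟨hb, hc⟩ := h
  have hidx : ∀ y ∈ D.S, D.Cmp s0 y → ∃ i < L.length, y = (nth L i).1 := by
    intro y hy hcy
    obtain ⟨p, hp, rfl⟩ := List.mem_map.1 (hcov y hy hcy)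
    obtain ⟨i, hi, e⟩ := List.getElem_of_mem hp
    exact ⟨i, hi, by unfold nth; rw [List.getD_eq_getElem _ _ hi, e]⟩
  obtain ⟨i, hi, ei⟩ := hidx s0 hs Relation.ReflTransGen.refl
  have hmi := I.mem hi
  have := tau_star (p := nth L i) (T := fun γ => ∃ v ∈ tab, γ = D.vec x L v) hmi
    ⟨_, hb i hi, (vec_bas x L hi).symm⟩ ?_ ?_ ht
  · rwa [← ei] at this
  · rintro γ ⟨v, hv, rfl⟩ y hy
    obtain ⟨⟨hl, _⟩, hr⟩ := hc v hv
    by_cases hcy : D.Cmp s0 y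
    · obtain ⟨j, hj, rfl⟩ := hidx y hy hcy
      rcases hr j hj with h | h
      · right
        rw [h, vec_bas x L hj]
        unfold fv
        split_ifs <;> simp
      · left
        exact ⟨_, h, (I.rf_eq hj hl).symm⟩
    · left
      exact ⟨v, hv, (I.inC_vec v).fix hy hcy⟩
  · rintro γ ⟨v, hv, rfl⟩ ⟨w, hw, e⟩
    obtain ⟨⟨hl, hn⟩, _⟩ := hc v hv
    rw [← vec_neg] at e
    have := I.vec_inj (by simpa using hl) (hc w hw).1.1 e
    rw [this] at hn
    exact hn hw

theorem idx_lt {n i j : ℕ} (hi : i < n) (hj : j < n) (hne : i ≠ j) :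
    max i j * (max i j - 1) / 2 + min i j < n * (n - 1) / 2 := by
  obtain ⟨m, hm⟩ : ∃ m, m = max i j := ⟨_, rfl⟩
  have h1 : m + 1 ≤ n := by omega
  have h2 : min i j < m := by omega
  have h3 : (m * (m - 1) + m * 2) / 2 ≤ n * (n - 1) / 2 := by
    apply Nat.div_le_div_right
    have : m * (m - 1) + m * 2 = (m + 1) * (m + 1 - 1) := by
      cases m with
      | zero => rfl
      | succ k => simp only [Nat.add_sub_cancel]; ring
    rw [this]
    exact Nat.mul_le_mul h1 (by omega)
  rw [Nat.add_mul_div_right _ _ (by norm_num)] at h3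
  rw [← hm]; omega

theorem bent_comm (E : List Zp) (i j : ℕ) : bent E i j = bent E j i := by
  simp only [bent, max_comm i j, min_comm i j, eq_comm (a := i)]

theorem Itp.extend (I : Itp D s0 x L E) (hE : E.length = L.length * (L.length - 1) / 2) {p : D.W × Bool}
    (hp : p.1 ∈ D.S) (hc : D.Cmp s0 p.1) (hn : ∀ q ∈ L, q.1 ≠ p.1) {vals : List Zp} (hv : vals.length = L.length)
    (hg : ∀ i < L.length, 2 * ⟪D.fv (nth L i), D.fv p⟫ = ev x (vals.getD i (0, 0))) :
    Itp D s0 x (L ++ [p]) (E ++ vals) := by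
  have n1 : ∀ i < L.length, nth (L ++ [p]) i = nth L i := by
    intro i hi
    simp only [nth]; rw [List.getD_append _ _ _ _ hi]
  have n2 : nth (L ++ [p]) L.length = p := by
    simp [nth, List.getD_append_right]
  have b2 : ∀ i < L.length, bent (E ++ vals) i L.length = vals.getD i (0, 0) := by
    intro i hi
    rw [bent, if_neg (by omega), max_eq_right hi.le, min_eq_left hi.le,
      List.getD_append_right _ _ _ _ (by omega), hE, Nat.add_sub_cancel_left]
  refine ⟨I.hx, ?_, ?_, ?_⟩
  · intro q hq
    rcases List.mem_append.1 hq with hq | hq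
    · exact I.hL q hq
    · obtain rfl := List.mem_singleton.1 hq; exact ⟨hp, hc⟩
  · rw [List.map_append, List.nodup_append]
    refine ⟨I.nd, by simp, ?_⟩
    intro a ha b hb
    obtain ⟨q, hq, rfl⟩ := List.mem_map.1 ha
    simp only [List.map_cons, List.map_nil, List.mem_singleton] at hb
    rw [hb]; exact hn q hq
  · have main : ∀ i j, i ≤ j → j < L.length + 1 →
        2 * ⟪D.fv (nth (L ++ [p]) i), D.fv (nth (L ++ [p]) j)⟫ = ev x (bent (E ++ vals) i j) := by
      intro i j hij hj
      by_cases hjl : j = L.length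
      · subst hjl
        by_cases hil : i = L.length
        · subst hil
          rw [n2, bent, if_pos rfl, ev_two, ((rtOf_fv hp).rt hp).self, mul_one]
        · rw [n1 i (by omega), n2, b2 i (by omega), hg i (by omega)]
      · rw [n1 i (by omega), n1 j (by omega), I.gram i (by omega) j (by omega)]
        congr 1
        simp only [bent]
        split_ifs with h
        · rfl
        · rw [List.getD_append _ _ _ _ (by rw [hE]; exact idx_lt (by omega) (by omega) h)]
    intro i hi j hj
    simp only [List.length_append, List.length_singleton] at hi hj
    rcases le_total i j with h | h
    · exact main i j h hj
    · rw [real_inner_comm, bent_comm]; exact main j i h hi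

end
end CoxeterRootSystem
end

open Pointwise RealInnerProductSpace
noncomputable section
namespace CoxeterRootSystem
variable {V : Type} [NormedAddCommGroup V] [InnerProductSpace ℝ V] {D : CoxeterRootSystem V}

/-- data of a component with a golden edge -/
structure Gctx (D : CoxeterRootSystem V) (s0 : D.W) (x : ℝ) : Prop where
  hx : x ^ 2 = x + 1
  HA : ∀ y ∈ D.S, D.Cmp s0 y → ∀ β γ, D.RtOf y β → D.Rt γ → Alw ⟪β, γ⟫
  HH : ∀ β γ, D.CRt s0 β → D.CRt s0 γ → Hf x ⟪β, γ⟫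

section
variable {s0 : D.W} {x : ℝ}

/-- a letter of the component -/
def Lt (D : CoxeterRootSystem V) (s0 : D.W) (p : D.W × Bool) : Prop := p.1 ∈ D.S ∧ D.Cmp s0 p.1

theorem fv_ne {p q : D.W × Bool} (hp : p.1 ∈ D.S) (hq : q.1 ∈ D.S) (h : p.1 ≠ q.1) :
    ⟪D.fv p, D.fv q⟫ ≠ 1 ∧ ⟪D.fv p, D.fv q⟫ ≠ -1 := by
  have key : ⟪D.e p.1, D.e q.1⟫ ≠ 1 ∧ ⟪D.e p.1, D.e q.1⟫ ≠ -1 := by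
    obtain ⟨h1, h2⟩ := e_ne_e hp hq h.symm
    exact ⟨fun e => h1 (rt_eq_of_inner (rt_e hp) (rt_e hq) e),
      fun e => h2 (rt_eq_of_inner (rt_e hp) (rt_e hq).neg (by rw [inner_neg_right, e, neg_neg]))⟩
  obtain ⟨s, b⟩ := p
  obtain ⟨t, b'⟩ := q
  obtain ⟨k1, k2⟩ := key
  cases b <;> cases b' <;> simp only [fv, Bool.false_eq_true, if_false, if_true, inner_neg_left, inner_neg_right, neg_neg]
  · exact ⟨k1, k2⟩
  · exact ⟨fun h => k2 (by linarith), fun h => k1 (by linarith)⟩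
  · exact ⟨fun h => k2 (by linarith), fun h => k1 (by linarith)⟩
  · exact ⟨k1, k2⟩

theorem Gctx.val (C : Gctx D s0 x) {p q : D.W × Bool} (hp : D.Lt s0 p) (hq : D.Lt s0 q) (h : p.1 ≠ q.1) :
    ∃ z ∈ pm7, 2 * ⟪D.fv p, D.fv q⟫ = ev x z := by
  obtain ⟨z, hz, e⟩ := C.HH _ _ ⟨_, hp.1, hp.2, rtOf_fv hp.1⟩ ⟨_, hq.1, hq.2, rtOf_fv hq.1⟩
  refine ⟨z, ?_, e⟩
  obtain ⟨k1, k2⟩ := fv_ne hp.1 hq.1 h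
  have hz2 : z ≠ (2, 0) := by rintro rfl; apply k1; rw [ev_two] at e; linarith
  have hz3 : z ≠ (-2, 0) := by
    rintro rfl; apply k2; simp only [ev] at e; push_cast at e; linarith
  have : ∀ z ∈ allowed, z ≠ (2, 0) → z ≠ (-2, 0) → z ∈ pm7 := by decide
  exact this z hz hz2 hz3

theorem neg3_cases : ∀ z ∈ pm7, z = (0, 0) ∨ z ∈ neg3 ∨ zneg z ∈ neg3 := by decide
theorem zneg_pm7 : ∀ z ∈ pm7, zneg z ∈ pm7 := by decide
theorem neg3_pm7 : ∀ z ∈ neg3, z ∈ pm7 := by decide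

theorem val_flip {p : D.W × Bool} {y : D.W} {b : Bool} {z : Zp} (h : 2 * ⟪D.fv p, D.fv (y, b)⟫ = ev x z) :
    2 * ⟪D.fv p, D.fv (y, !b)⟫ = ev x (zneg z) := by
  rw [fv_flip, inner_neg_right, ev_neg]; linarith

theorem any_sound {n : ℕ} {tab : List (List Zp × Cert)} (hok : tab.all (fun p => chk n p.1 p.2) = true)
    {E : List Zp} (h : tab.any (fun p => decide (p.1 = E)) = true) : ∃ c, chk n E c = true := by
  obtain ⟨p, hp, e⟩ := List.any_eq_true.1 h
  have e' : p.1 = E := by simpa using e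
  exact ⟨p.2, by rw [← e']; exact List.all_eq_true.1 hok p hp⟩

theorem Gctx.itp1 (C : Gctx D s0 x) {p : D.W × Bool} (hp : D.Lt s0 p) : Itp D s0 x [p] [] := by
  refine ⟨C.hx, ?_, by simp, ?_⟩
  · intro q hq; obtain rfl := List.mem_singleton.1 hq; exact hp
  · intro i hi j hj
    simp only [List.length_singleton] at hi hj
    obtain rfl : i = 0 := by omega
    obtain rfl : j = 0 := by omega
    simp only [nth, List.getD_cons_zero, bent, if_true, ev_two]
    rw [((rtOf_fv hp.1).rt hp.1).self, mul_one]

theorem Gctx.itp2 (C : Gctx D s0 x) {p q : D.W × Bool} (hp : D.Lt s0 p) (hq : D.Lt s0 q) (hpq : p.1 ≠ q.1)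
    {a : Zp} (h : 2 * ⟪D.fv p, D.fv q⟫ = ev x a) : Itp D s0 x [p, q] [a] := by
  refine (C.itp1 hp).extend (p := q) (by simp) hq.1 hq.2 (by simpa using hpq) (vals := [a]) rfl ?_
  intro i hi
  simp only [List.length_singleton] at hi
  obtain rfl : i = 0 := by omega
  simpa [nth] using h

theorem Gctx.itp3 {p q r : D.W × Bool} {a : Zp} (I : Itp D s0 x [p, q] [a])
    (hr : D.Lt s0 r) (hpr : p.1 ≠ r.1) (hqr : q.1 ≠ r.1)
    {b c : Zp} (h1 : 2 * ⟪D.fv p, D.fv r⟫ = ev x b) (h2 : 2 * ⟪D.fv q, D.fv r⟫ = ev x c) :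
    Itp D s0 x [p, q, r] [a, b, c] := by
  refine I.extend (p := r) (by simp) hr.1 hr.2 (by simpa using ⟨hpr, hqr⟩) (vals := [b, c]) rfl ?_
  intro i hi
  simp only [List.length_cons, List.length_nil] at hi
  interval_cases i
  · simpa [nth] using h1
  · simpa [nth] using h2

theorem Gctx.itp4 {p q r d : D.W × Bool} {e1 e2 e3 : Zp} (I : Itp D s0 x [p, q, r] [e1, e2, e3])
    (hd : D.Lt s0 d) (hpd : p.1 ≠ d.1) (hqd : q.1 ≠ d.1) (hrd : r.1 ≠ d.1)
    {a b c : Zp} (h1 : 2 * ⟪D.fv p, D.fv d⟫ = ev x a) (h2 : 2 * ⟪D.fv q, D.fv d⟫ = ev x b)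
    (h3 : 2 * ⟪D.fv r, D.fv d⟫ = ev x c) :
    Itp D s0 x [p, q, r, d] [e1, e2, e3, a, b, c] := by
  refine I.extend (p := d) (by simp) hd.1 hd.2 (by simpa using ⟨hpd, hqd, hrd⟩) (vals := [a, b, c]) rfl ?_
  intro i hi
  simp only [List.length_cons, List.length_nil] at hi
  interval_cases i
  · simpa [nth] using h1
  · simpa [nth] using h2
  · simpa [nth] using h3

theorem Gctx.itp5 {p q r d v : D.W × Bool} {e1 e2 e3 e4 e5 e6 : Zp}
    (I : Itp D s0 x [p, q, r, d] [e1, e2, e3, e4, e5, e6])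
    (hv : D.Lt s0 v) (hpv : p.1 ≠ v.1) (hqv : q.1 ≠ v.1) (hrv : r.1 ≠ v.1) (hdv : d.1 ≠ v.1)
    {a b c e : Zp} (h1 : 2 * ⟪D.fv p, D.fv v⟫ = ev x a) (h2 : 2 * ⟪D.fv q, D.fv v⟫ = ev x b)
    (h3 : 2 * ⟪D.fv r, D.fv v⟫ = ev x c) (h4 : 2 * ⟪D.fv d, D.fv v⟫ = ev x e) :
    Itp D s0 x [p, q, r, d, v] [e1, e2, e3, e4, e5, e6, a, b, c, e] := by
  refine I.extend (p := v) (by simp) hv.1 hv.2 (by simpa using ⟨hpv, hqv, hrv, hdv⟩) (vals := [a, b, c, e]) rfl ?_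
  intro i hi
  simp only [List.length_cons, List.length_nil] at hi
  interval_cases i
  · simpa [nth] using h1
  · simpa [nth] using h2
  · simpa [nth] using h3
  · simpa [nth] using h4

theorem Gctx.triple (C : Gctx D s0 x) {p q r : D.W × Bool} (hp : D.Lt s0 p) (hq : D.Lt s0 q) (hr : D.Lt s0 r)
    (hpq : p.1 ≠ q.1) (hpr : p.1 ≠ r.1) (hqr : q.1 ≠ r.1) (h : 2 * ⟪D.fv p, D.fv q⟫ = ev x (0, -1))
    {z : Zp} (hz : z ∈ neg3) (h2 : 2 * ⟪D.fv q, D.fv r⟫ = ev x z) :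
    z = (-1, 0) ∧ 2 * ⟪D.fv p, D.fv r⟫ = ev x (0, 0) := by
  obtain ⟨a, ha, h1⟩ := C.val hp hr hpr
  rcases typT z hz a ha with ⟨e1, e2⟩ | h3
  · exact ⟨e2, by rw [h1, e1]⟩
  · exfalso
    obtain ⟨c, hc⟩ := any_sound tabT_ok h3
    exact (Gctx.itp3 (C.itp2 hp hq hpq h) hr hpr hqr h1 h2).chk_sound C.HA C.HH hc

theorem Gctx.pair (C : Gctx D s0 x) {p q : D.W × Bool} (hp : D.Lt s0 p) (hq : D.Lt s0 q)
    (hpq : p.1 ≠ q.1) (h : 2 * ⟪D.fv p, D.fv q⟫ = ev x (0, -1)) {y : D.W} (hy : y ∈ D.S) (hcy : D.Cmp s0 y)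
    (hpy : p.1 ≠ y) (hqy : q.1 ≠ y) :
    ∃ b : Bool, ∃ ab ∈ [(((0, 0) : Zp), ((0, 0) : Zp)), ((-1, 0), (0, 0)), ((0, 0), (-1, 0))],
      2 * ⟪D.fv p, D.fv (y, b)⟫ = ev x ab.1 ∧ 2 * ⟪D.fv q, D.fv (y, b)⟫ = ev x ab.2 := by
  have hl : ∀ b, D.Lt s0 (y, b) := fun b => ⟨hy, hcy⟩
  obtain ⟨z1, m1, e1⟩ := C.val hp (hl true) hpy
  obtain ⟨z2, m2, e2⟩ := C.val hq (hl true) hqy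
  have h' : 2 * ⟪D.fv q, D.fv p⟫ = ev x (0, -1) := by rw [real_inner_comm]; exact h
  have A : ∀ b, ∀ z ∈ neg3, 2 * ⟪D.fv q, D.fv (y, b)⟫ = ev x z → 
      ∃ b : Bool, ∃ ab ∈ [(((0, 0) : Zp), ((0, 0) : Zp)), ((-1, 0), (0, 0)), ((0, 0), (-1, 0))],
      2 * ⟪D.fv p, D.fv (y, b)⟫ = ev x ab.1 ∧ 2 * ⟪D.fv q, D.fv (y, b)⟫ = ev x ab.2 := by
    intro b z hz e
    obtain ⟨rfl, e'⟩ := C.triple hp hq (hl b) hpq hpy hqy h hz e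
    exact ⟨b, ((0, 0), (-1, 0)), by simp, e', e⟩
  have B : ∀ b, ∀ z ∈ neg3, 2 * ⟪D.fv p, D.fv (y, b)⟫ = ev x z → 
      ∃ b : Bool, ∃ ab ∈ [(((0, 0) : Zp), ((0, 0) : Zp)), ((-1, 0), (0, 0)), ((0, 0), (-1, 0))],
      2 * ⟪D.fv p, D.fv (y, b)⟫ = ev x ab.1 ∧ 2 * ⟪D.fv q, D.fv (y, b)⟫ = ev x ab.2 := by
    intro b z hz e
    obtain ⟨rfl, e'⟩ := C.triple hq hp (hl b) hpq.symm hqy hpy h' hz e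
    exact ⟨b, ((-1, 0), (0, 0)), by simp, e, e'⟩
  rcases neg3_cases z2 m2 with h2 | h2 | h2
  · rcases neg3_cases z1 m1 with h1 | h1 | h1
    · exact ⟨true, ((0, 0), (0, 0)), by simp, by rw [e1, h1], by rw [e2, h2]⟩
    · exact B true z1 h1 e1
    · exact B false _ h1 (val_flip e1)
  · exact A true z2 h2 e2
  · exact A false _ h2 (val_flip e2)

/-- configuration of type H3 -/
structure Hc3 (D : CoxeterRootSystem V) (s0 : D.W) (x : ℝ) (p q r : D.W × Bool) : Prop where
  hp : D.Lt s0 p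
  hq : D.Lt s0 q
  hr : D.Lt s0 r
  hpq : p.1 ≠ q.1
  hpr : p.1 ≠ r.1
  hqr : q.1 ≠ r.1
  pq : 2 * ⟪D.fv p, D.fv q⟫ = ev x (0, -1)
  pr : 2 * ⟪D.fv p, D.fv r⟫ = ev x (0, 0)
  qr : 2 * ⟪D.fv q, D.fv r⟫ = ev x (-1, 0)

theorem Hc3.itp (C : Gctx D s0 x) {p q r : D.W × Bool} (T : Hc3 D s0 x p q r) :
    Itp D s0 x [p, q, r] [(0, -1), (0, 0), (-1, 0)] :=
  Gctx.itp3 (C.itp2 T.hp T.hq T.hpq T.pq) T.hr T.hpr T.hqr T.pr T.qr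

theorem Hc3.next (C : Gctx D s0 x) {p q r : D.W × Bool} (T : Hc3 D s0 x p q r) {y : D.W} (hy : y ∈ D.S)
    (hcy : D.Cmp s0 y) (hpy : p.1 ≠ y) (hqy : q.1 ≠ y) (hry : r.1 ≠ y) :
    ∃ b : Bool, ∃ z : Zp, (z = (0, 0) ∨ z = (-1, 0)) ∧ 2 * ⟪D.fv p, D.fv (y, b)⟫ = ev x (0, 0) ∧
      2 * ⟪D.fv q, D.fv (y, b)⟫ = ev x (0, 0) ∧ 2 * ⟪D.fv r, D.fv (y, b)⟫ = ev x z := by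
  have hl : ∀ b, D.Lt s0 (y, b) := fun b => ⟨hy, hcy⟩
  have pre : ∃ b : Bool, ∃ ab ∈ [(((0, 0) : Zp), ((0, 0) : Zp)), ((-1, 0), (0, 0)), ((0, 0), (-1, 0))],
      ∃ z ∈ pm7, (ab = ((0, 0), (0, 0)) → z = (0, 0) ∨ z ∈ neg3) ∧
      2 * ⟪D.fv p, D.fv (y, b)⟫ = ev x ab.1 ∧ 2 * ⟪D.fv q, D.fv (y, b)⟫ = ev x ab.2 ∧
      2 * ⟪D.fv r, D.fv (y, b)⟫ = ev x z := by
    obtain ⟨b, ab, hab, e1, e2⟩ := C.pair T.hp T.hq T.hpq T.pq hy hcy hpy hqy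
    obtain ⟨z, hz, e3⟩ := C.val T.hr (hl b) hry
    by_cases h0 : ab = ((0, 0), (0, 0))
    · rcases neg3_cases z hz with h | h | h
      · exact ⟨b, ab, hab, z, hz, fun _ => Or.inl h, e1, e2, e3⟩
      · exact ⟨b, ab, hab, z, hz, fun _ => Or.inr h, e1, e2, e3⟩
      · refine ⟨!b, ab, hab, zneg z, zneg_pm7 z hz, fun _ => Or.inr h, ?_, ?_, val_flip e3⟩
        · have := val_flip e1; rw [h0] at this ⊢; exact this
        · have := val_flip e2; rw [h0] at this ⊢; exact this
    · exact ⟨b, ab, hab, z, hz, fun h => absurd h h0, e1, e2, e3⟩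
  obtain ⟨b, ab, hab, z, hz, hz0, e1, e2, e3⟩ := pre
  rcases typQ ab hab z hz with ⟨h1, h2⟩ | ⟨h1, h2⟩ | h3
  · rcases hz0 h1 with h | h
    · exact ⟨b, z, Or.inl h, by rw [e1, h1], by rw [e2, h1], e3⟩
    · exact absurd h h2
  · exact ⟨b, z, Or.inr h2, by rw [e1, h1], by rw [e2, h1], e3⟩
  · exfalso
    obtain ⟨c, hc⟩ := any_sound tabQ_ok h3
    exact (Gctx.itp4 (T.itp C) (hl b) hpy hqy hry e1 e2 e3).chk_sound C.HA C.HH hc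

theorem Hc3.last (C : Gctx D s0 x) {p q r d : D.W × Bool} (T : Hc3 D s0 x p q r) 
    (I : Itp D s0 x [p, q, r, d] [(0, -1), (0, 0), (-1, 0), (0, 0), (0, 0), (-1, 0)])
    (hd : D.Lt s0 d) {y : D.W} (hy : y ∈ D.S)
    (hcy : D.Cmp s0 y) (hpy : p.1 ≠ y) (hqy : q.1 ≠ y) (hry : r.1 ≠ y) (hdy : d.1 ≠ y) :
    ∃ b : Bool, 2 * ⟪D.fv p, D.fv (y, b)⟫ = ev x (0, 0) ∧
      2 * ⟪D.fv q, D.fv (y, b)⟫ = ev x (0, 0) ∧ 2 * ⟪D.fv r, D.fv (y, b)⟫ = ev x (0, 0) ∧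
      2 * ⟪D.fv d, D.fv (y, b)⟫ = ev x (0, 0) := by
  have hl : ∀ b, D.Lt s0 (y, b) := fun b => ⟨hy, hcy⟩
  obtain ⟨b, z, hz, e1, e2, e3⟩ := T.next C hy hcy hpy hqy hry
  obtain ⟨w, hw, e4⟩ := C.val hd (hl b) hdy
  have F : ∀ b, ∀ z w : Zp, (z = (0, 0) ∧ w ∈ neg3 ∨ z = (-1, 0)) → w ∈ pm7 → 2 * ⟪D.fv p, D.fv (y, b)⟫ = ev x (0, 0) →
      2 * ⟪D.fv q, D.fv (y, b)⟫ = ev x (0, 0) → 2 * ⟪D.fv r, D.fv (y, b)⟫ = ev x z →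
      2 * ⟪D.fv d, D.fv (y, b)⟫ = ev x w → False := by
    intro b z w hz hw e1 e2 e3 e4
    rcases typV ((0, 0), (0, 0), z) (by rcases hz with ⟨rfl, _⟩ | rfl <;> simp) w hw with ⟨h1, h2⟩ | h3
    · rcases hz with ⟨_, h⟩ | rfl
      · exact h2 h
      · simp at h1
    · obtain ⟨c, hc⟩ := any_sound tabV_ok h3
      exact (Gctx.itp5 I (hl b) hpy hqy hry hdy e1 e2 e3 e4).chk_sound C.HA C.HH hc
  rcases hz with rfl | rfl
  · rcases neg3_cases w hw with h | h | h
    · exact ⟨b, e1, e2, e3, by rw [e4, h]⟩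
    · exact (F b _ w (Or.inl ⟨rfl, h⟩) hw e1 e2 e3 e4).elim
    · exact (F (!b) _ _ (Or.inl ⟨rfl, h⟩) (zneg_pm7 w hw) (val_flip e1) (val_flip e2) (val_flip e3) (val_flip e4)).elim
  · exact (F b _ w (Or.inr rfl) hw e1 e2 e3 e4).elim

theorem orth_of_val {p : D.W × Bool} {y : D.W} {b : Bool} (h : 2 * ⟪D.fv p, D.fv (y, b)⟫ = ev x (0, 0)) :
    ⟪D.e p.1, D.e y⟫ = 0 := by
  rw [ev_zero] at h
  obtain ⟨s, b'⟩ := p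
  cases b <;> cases b' <;> simpa [fv] using h

theorem cover {L : List (D.W × Bool)} {p : D.W × Bool} (hp : p ∈ L) (hc : D.Cmp s0 p.1)
    (h : ∀ y ∈ D.S, D.Cmp s0 y → y ∉ L.map Prod.fst → ∀ q ∈ L, ⟪D.e q.1, D.e y⟫ = 0) :
    ∀ y ∈ D.S, D.Cmp s0 y → y ∈ L.map Prod.fst := by
  intro y _ hcy
  have key : ∀ y, D.Cmp p.1 y → y ∈ L.map Prod.fst := by
    intro y hy
    induction hy with
    | refl => exact List.mem_map_of_mem hp
    | @tail b c hb hbc ih =>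
      by_contra hn
      obtain ⟨q, hq, rfl⟩ := List.mem_map.1 ih
      exact hbc.2.2 (h c hbc.2.1 (Cmp.step (Relation.ReflTransGen.trans hc hb) hbc.1 hbc.2.1 hbc.2.2) hn q hq)
  exact key y (Relation.ReflTransGen.trans hc.symm hcy)

theorem star_gold3 (C : Gctx D s0 x) (hs : s0 ∈ D.S) {p q r : D.W × Bool} (T : Hc3 D s0 x p q r) {t : D.W}
    (ht : t ∈ D.S) : D.Star s0 t := by
  by_cases H : ∀ y ∈ D.S, D.Cmp s0 y → y ∉ [p, q, r].map Prod.fst → ∀ q' ∈ [p, q, r], ⟪D.e q'.1, D.e y⟫ = 0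
  · exact (T.itp C).star_tab (cover (p := p) (by simp) T.hp.2 H) hs tabH3_ok ht
  · push Not at H
    obtain ⟨y, hy, hcy, hyn, q', hq', hne⟩ := H
    simp only [List.map_cons, List.map_nil, List.mem_cons, List.not_mem_nil, or_false, not_or] at hyn hq'
    obtain ⟨n1, n2, n3⟩ := hyn
    obtain ⟨b, z, hz, e1, e2, e3⟩ := T.next C hy hcy (Ne.symm n1) (Ne.symm n2) (Ne.symm n3)
    rcases hz with rfl | rfl
    · exfalso
      rcases hq' with rfl | rfl | rfl
      · exact hne (orth_of_val e1)
      · exact hne (orth_of_val e2)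
      · exact hne (orth_of_val e3)
    have hd : D.Lt s0 (y, b) := ⟨hy, hcy⟩
    have I := Gctx.itp4 (T.itp C) hd (Ne.symm n1) (Ne.symm n2) (Ne.symm n3) e1 e2 e3
    refine I.star_tab (cover (p := p) (by simp) T.hp.2 ?_) hs tabH4_ok ht
    intro v hv hcv hvn
    simp only [List.map_cons, List.map_nil, List.mem_cons, List.not_mem_nil, or_false, not_or] at hvn
    obtain ⟨m1, m2, m3, m4⟩ := hvn
    obtain ⟨b', f1, f2, f3, f4⟩ := T.last C I hd hv hcv (Ne.symm m1) (Ne.symm m2) (Ne.symm m3) (Ne.symm m4)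
    intro q'' hq''
    simp only [List.mem_cons, List.not_mem_nil, or_false] at hq''
    rcases hq'' with rfl | rfl | rfl | rfl
    · exact orth_of_val f1
    · exact orth_of_val f2
    · exact orth_of_val f3
    · exact orth_of_val f4

theorem star_gold2 (C : Gctx D s0 x) (hs : s0 ∈ D.S) {p q : D.W × Bool} (hp : D.Lt s0 p) (hq : D.Lt s0 q)
    (hpq : p.1 ≠ q.1) (h : 2 * ⟪D.fv p, D.fv q⟫ = ev x (0, -1)) {t : D.W}
    (ht : t ∈ D.S) : D.Star s0 t := by
  by_cases H : ∀ y ∈ D.S, D.Cmp s0 y → y ∉ [p, q].map Prod.fst → ∀ q' ∈ [p, q], ⟪D.e q'.1, D.e y⟫ = 0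
  · refine star_dih (a := p.1) (b := q.1) hs ht ?_
    intro y hy hcy
    simpa using cover (p := p) (by simp) hp.2 H y hy hcy
  · push Not at H
    obtain ⟨y, hy, hcy, hyn, q', hq', hne⟩ := H
    simp only [List.map_cons, List.map_nil, List.mem_cons, List.not_mem_nil, or_false, not_or] at hyn hq'
    obtain ⟨n1, n2⟩ := hyn
    obtain ⟨b, ab, hab, e1, e2⟩ := C.pair hp hq hpq h hy hcy (Ne.symm n1) (Ne.symm n2)
    have hl : D.Lt s0 (y, b) := ⟨hy, hcy⟩
    have h' : 2 * ⟪D.fv q, D.fv p⟫ = ev x (0, -1) := by rw [real_inner_comm]; exact h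
    simp only [List.mem_cons, List.not_mem_nil, or_false] at hab
    rcases hab with rfl | rfl | rfl
    · exfalso
      rcases hq' with rfl | rfl
      · exact hne (orth_of_val e1)
      · exact hne (orth_of_val e2)
    · exact star_gold3 C hs ⟨hq, hp, hl, hpq.symm, Ne.symm n2, Ne.symm n1, h', e2, e1⟩ ht
    · exact star_gold3 C hs ⟨hp, hq, hl, hpq, Ne.symm n1, Ne.symm n2, h, e1, e2⟩ ht

end

theorem star_all {s t : D.W} (hs : s ∈ D.S) (ht : t ∈ D.S) : D.Star s t := by
  by_cases hst : D.Cmp s t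
  swap
  · exact star_of_not_cmp hs ht hst
  rcases small_or_alw hs with ⟨a, b, hab⟩ | HA
  · exact star_dih hs ht hab
  by_cases H5 : ∀ x ∈ D.S, ∀ y ∈ D.S, D.Cmp s x → D.Cmp s y → Nv ⟪D.e x, D.e y⟫
  · exact star_no5 hs ht hst (HA s hs Relation.ReflTransGen.refl) (nv_of_no5 HA H5)
  push Not at H5
  obtain ⟨a, ha, b, hb, hca, hcb, hn⟩ := H5
  have hal := HA a ha hca _ _ (rtOf_e a) (rt_e hb)
  have hg : Gol ⟪D.e a, D.e b⟫ := by
    unfold Nv at hn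
    unfold Alw at hal
    unfold Gol
    tauto
  have hab : a ≠ b := by
    rintro rfl
    rw [D.e_self ha] at hg
    rcases hg with h | h <;> norm_num at h
  have hV : D.GoldV s (D.e a) := ⟨crt_e ha hca, _, crt_e hb hcb, hg⟩
  have mk : ∀ x : ℝ, x ^ 2 = x + 1 → Gctx D s x := fun x hx => ⟨hx, HA, hf_all HA hca hV hx⟩
  rcases hg with h | h
  · have hx : (2 * ⟪D.e a, D.e b⟫) ^ 2 = 2 * ⟪D.e a, D.e b⟫ + 1 := by linear_combination h
    refine star_gold2 (mk _ hx) hs (p := (a, true)) (q := (b, false)) ⟨ha, hca⟩ ⟨hb, hcb⟩ hab ?_ ht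
    simp [fv, ev]
  · have hx : (-(2 * ⟪D.e a, D.e b⟫)) ^ 2 = -(2 * ⟪D.e a, D.e b⟫) + 1 := by linear_combination h
    refine star_gold2 (mk _ hx) hs (p := (a, true)) (q := (b, true)) ⟨ha, hca⟩ ⟨hb, hcb⟩ hab ?_ ht
    simp [fv, ev]

end CoxeterRootSystem
end

variable {V : Type} [NormedAddCommGroup V] [InnerProductSpace ℝ V]
/-- The greedy facet (the lexicographically first facet of `SC(Q,w)`) is the
unique facet `I` with `R(I) ⊆ Φ⁺`, and the antigreedy facet (the lexicographically last facet)
is the unique facet `I` with `R(I) ⊆ w(Φ⁺)`. -/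
theorem greedy_antigreedy_facet_characterization
    (D : CoxeterRootSystem V) (Q : List D.W) (hQ : ∀ x ∈ Q, x ∈ D.S) (w : D.W)
    (Ig Iag : Finset (Fin Q.length))
    (hg : D.IsFacet Q w Ig ∧ ∀ J, D.IsFacet Q w J → J ≠ Ig →
      List.Lex (· < ·) (Ig.sort (· ≤ ·)) (J.sort (· ≤ ·)))
    (hag : D.IsFacet Q w Iag ∧ ∀ J, D.IsFacet Q w J → J ≠ Iag →
      List.Lex (· < ·) (J.sort (· ≤ ·)) (Iag.sort (· ≤ ·))) :
    (D.rootConf Q Ig ⊆ D.Φpos ∧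
      ∀ J, D.IsFacet Q w J → D.rootConf Q J ⊆ D.Φpos → J = Ig) ∧
    (D.rootConf Q Iag ⊆ ⇑(D.ρ w) '' D.Φpos ∧
      ∀ J, D.IsFacet Q w J → D.rootConf Q J ⊆ ⇑(D.ρ w) '' D.Φpos → J = Iag) := by
  exact CoxeterRootSystem.main_of_star D (fun s hs t ht => CoxeterRootSystem.star_all hs ht) Q hQ w Ig Iag hg hag
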